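/- Let m ≥ 3 be an integer having at most three distinct prime divisors, let a, b ∈ ZMod m with a ≠ 0, b ≠ 0, 2a ≠ 0, 2b ≠ 0, and let S ⊆ ZMod m with 0 ∈ S and |S| ≥ 3. If the bicirculant G = B(m;{a,−a},S,{b,−b}) is connected, then G is Hamiltonian. -/

import Mathlib

open SimpleGraph

/-- The bicirculant graph `B(m;R,S,T)` on vertex set `ZMod m ⊕ ZMod m`. -/
def bicirculant (m : ℕ) (R S T : Set (ZMod m)) : SimpleGraph (ZMod m ⊕ ZMod m) :=
  SimpleGraph.fromRel (fun x y =>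
    match x, y with
    | Sum.inl i, Sum.inl i' => ∃ j ∈ R, i' = i + j
    | Sum.inr i, Sum.inr i' => ∃ j ∈ T, i' = i + j
    | Sum.inl i, Sum.inr i' => ∃ j ∈ S, i' = i + j
    | Sum.inr _, Sum.inl _ => False)

section PathAlgebra

variable {W : Type*} {G : SimpleGraph W}

/-- `IsPathOn G X E x y`: there is a path from `x` to `y` whose vertex set is `X` and whose edge
set is `E`. -/
inductive IsPathOn (G : SimpleGraph W) : Set W → Set (Sym2 W) → W → W → Prop
  | single (x : W) : IsPathOn G {x} ∅ x x
  | cons {X : Set W} {E : Set (Sym2 W)} {x y z : W} (h : G.Adj x y) (hx : x ∉ X)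
      (p : IsPathOn G X E y z) : IsPathOn G (insert x X) (insert s(x, y) E) x z

namespace IsPathOn

variable {X Y : Set W} {E F : Set (Sym2 W)} {x y z w : W}

theorem left_mem (p : IsPathOn G X E x y) : x ∈ X := by
  cases p <;> simp

theorem right_mem (p : IsPathOn G X E x y) : y ∈ X := by
  induction p with
  | single x => simp
  | cons h hx p ih => exact Or.inr ih

theorem mem_of_mem_edges (p : IsPathOn G X E x y) {e : Sym2 W} (he : e ∈ E) {w : W}
    (hw : w ∈ e) : w ∈ X := by
  induction p with
  | single x => exact absurd he (Set.notMem_empty _)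
  | cons h hx p ih =>
    rcases he with rfl | he
    · rcases Sym2.mem_iff.1 hw with rfl | rfl
      · exact Or.inl rfl
      · exact Or.inr p.left_mem
    · exact Or.inr (ih he)

theorem append (p : IsPathOn G X E x y) (q : IsPathOn G Y F z w) (h : G.Adj y z)
    (hd : Disjoint X Y) : IsPathOn G (X ∪ Y) (E ∪ F ∪ {s(y, z)}) x w := by
  induction p with
  | single x =>
    have := IsPathOn.cons h (Set.disjoint_left.1 hd rfl) q
    rwa [Set.insert_eq, Set.insert_eq (s(x, z)), Set.union_comm _ F, ← Set.empty_union F] at this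
  | cons h' hx p ih =>
    rw [Set.disjoint_left] at hd
    have := IsPathOn.cons h' (X := _) (x := _) ?_ (ih h (Set.disjoint_left.2
      fun t ht => hd (Or.inr ht)))
    · convert this using 1
      · rw [Set.insert_union]
      · rw [Set.insert_union, Set.insert_union]
    · rintro (h1 | h1)
      · exact hx h1
      · exact hd (Or.inl rfl) h1

theorem reverse (p : IsPathOn G X E x y) : IsPathOn G X E y x := by
  induction p with
  | single x => exact single x
  | @cons X E x y z h hx p ih =>
    have := ih.append (single x) h.symm (Set.disjoint_singleton_right.2 hx)
    convert this using 1
    · ext t; simp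
    · ext t; simp [Sym2.eq_swap]

theorem split (p : IsPathOn G X E x y) {a b : W} (he : s(a, b) ∈ E) :
    ∃ X₁ X₂ E₁ E₂ a' b', X = X₁ ∪ X₂ ∧ Disjoint X₁ X₂ ∧ E = E₁ ∪ E₂ ∪ {s(a, b)} ∧
      ((a' = a ∧ b' = b) ∨ (a' = b ∧ b' = a)) ∧
      IsPathOn G X₁ E₁ x a' ∧ IsPathOn G X₂ E₂ b' y := by
  induction p with
  | single x => exact absurd he (Set.notMem_empty _)
  | @cons X E x y z h hx p ih =>
    by_cases hxy : s(a, b) = s(x, y)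
    · refine ⟨{x}, X, ∅, E, x, y, rfl, Set.disjoint_singleton_left.2 hx, ?_, ?_, single x, p⟩
      · ext t; simp [hxy]
      · rcases Sym2.eq_iff.1 hxy with ⟨rfl, rfl⟩ | ⟨rfl, rfl⟩ <;> simp
    · obtain ⟨X₁, X₂, E₁, E₂, a', b', rfl, hd, rfl, hab, p₁, p₂⟩ := ih (he.resolve_left hxy)
      refine ⟨insert x X₁, X₂, insert s(x, y) E₁, E₂, a', b', by rw [Set.insert_union], ?_, ?_, hab,
        cons h (fun h1 => hx (Or.inl h1)) p₁, p₂⟩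
      · rw [Set.disjoint_insert_left]
        exact ⟨fun h1 => hx (Or.inr h1), hd⟩
      · rw [Set.insert_union, Set.insert_union]

theorem exists_walk (p : IsPathOn G X E x y) :
    ∃ q : G.Walk x y, q.IsPath ∧ (∀ t, t ∈ q.support ↔ t ∈ X) ∧ ∀ e, e ∈ q.edges ↔ e ∈ E := by
  induction p with
  | single x => exact ⟨Walk.nil, by simp, by simp, by simp⟩
  | cons h hx p ih =>
    obtain ⟨q, hq, hX, hE⟩ := ih
    exact ⟨Walk.cons h q, by rw [Walk.cons_isPath_iff]; exact ⟨hq, by rwa [hX]⟩,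
      by simp [hX], by simp [hE]⟩

end IsPathOn

/-- `Pth G X E x y`: there is a path from `x` to `y` with vertex set `X` using all edges in `E`. -/
def Pth (G : SimpleGraph W) (X : Set W) (E : Set (Sym2 W)) (x y : W) : Prop :=
  ∃ F, IsPathOn G X F x y ∧ E ⊆ F

/-- `Cyc G X E`: there is a cycle with vertex set `X` using all edges in `E` (a single edge
traversed twice is tolerated). -/
def Cyc (G : SimpleGraph W) (X : Set W) (E : Set (Sym2 W)) : Prop :=
  ∃ E' x y, IsPathOn G X E' x y ∧ G.Adj y x ∧ E ⊆ insert s(x, y) E'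

namespace Pth

variable {X Y : Set W} {E F : Set (Sym2 W)} {x y z w : W}

theorem single (x : W) : Pth G {x} ∅ x x := ⟨_, .single x, subset_rfl⟩

theorem reverse (p : Pth G X E x y) : Pth G X E y x :=
  let ⟨E', p', h⟩ := p
  ⟨E', p'.reverse, h⟩

theorem mono (p : Pth G X E x y) (h : F ⊆ E) : Pth G X F x y :=
  let ⟨E', p', h'⟩ := p
  ⟨E', p', h.trans h'⟩

theorem left_mem (p : Pth G X E x y) : x ∈ X := let ⟨_, p', _⟩ := p; p'.left_mem

theorem right_mem (p : Pth G X E x y) : y ∈ X := let ⟨_, p', _⟩ := p; p'.right_mem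

theorem append' (p : Pth G X E x y) (h : G.Adj y z) (q : Pth G Y F z w) (hd : Disjoint X Y) :
    Pth G (X ∪ Y) (E ∪ F ∪ {s(y, z)}) x w :=
  let ⟨_, p', hp⟩ := p
  let ⟨_, q', hq⟩ := q
  ⟨_, p'.append q' h hd, Set.union_subset_union (Set.union_subset_union hp hq) subset_rfl⟩

theorem append (p : Pth G X E x y) (h : G.Adj y z) (q : Pth G Y F z w) (hd : Disjoint X Y) :
    Pth G (X ∪ Y) (E ∪ F) x w :=
  (p.append' h q hd).mono Set.subset_union_left

theorem close (p : Pth G X E x y) (h : G.Adj y x) : Cyc G X (insert s(x, y) E) :=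
  let ⟨_, p', hp⟩ := p
  ⟨_, _, _, p', h, Set.insert_subset_insert hp⟩

/-- Pósa rotation: the end `y` of a path is adjacent to a vertex `z` both of whose path
neighbours are known. -/
theorem rotate {y₁ z₁ z₂ : W} (p : Pth G X E y y₁) (hzy : z ≠ y) (h : G.Adj z y)
    (h₁ : s(z, z₁) ∈ E) (h₂ : s(z, z₂) ∈ E) (h₁₂ : z₁ ≠ z₂) :
    ∃ z', (z' = z₁ ∨ z' = z₂) ∧ Pth G X (E \ {s(z, z')}) y₁ z' := by
  obtain ⟨E', p, hE⟩ := p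
  have hz2 : s(z, z₂) ≠ s(z, z₁) := fun h => h₁₂ (Sym2.congr_right.1 h).symm
  obtain ⟨X₁, X₂, E₁, E₂, a', b', rfl, hd, rfl, hab, p₁, p₂⟩ := p.split (hE h₁)
  rcases hab with ⟨rfl, rfl⟩ | ⟨rfl, rfl⟩
  · have h2 := hE h₂
    simp only [Set.mem_union, Set.mem_singleton_iff, hz2, or_false] at h2
    rcases h2 with h2 | h2
    · obtain ⟨X₃, X₄, E₃, E₄, a'', b'', rfl, hd', rfl, hab, p₃, p₄⟩ := p₁.split h2
      rcases hab with ⟨rfl, rfl⟩ | ⟨rfl, rfl⟩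
      · exact absurd p₄.right_mem (Set.disjoint_left.1 hd' p₃.right_mem)
      · refine ⟨a'', Or.inr rfl, _, ((p₃.reverse.append p₄ h.symm hd').append p₂ ?_ hd).reverse, ?_⟩
        · have := p₁
          clear hE
          have hadj : ∀ {X : Set W} {E : Set (Sym2 W)} {x y : W}, IsPathOn G X E x y →
              ∀ e ∈ E, e ∈ G.edgeSet := by
            intro X E x y q
            induction q with
            | single x => intro e he; exact absurd he (Set.notMem_empty _)
            | cons h hx p ih =>
              rintro e (rfl | he)
              · exact h
              · exact ih e he
          exact hadj p _ (Or.inr rfl)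
        · rintro e ⟨he, hne⟩
          have := hE he
          simp only [Set.mem_union, Set.mem_singleton_iff] at this hne ⊢
          tauto
    · exact absurd (p₂.mem_of_mem_edges h2 (Sym2.mem_mk_left _ _))
        (Set.disjoint_left.1 hd p₁.right_mem)
  · refine ⟨_, Or.inl rfl, _, (p₁.reverse.append p₂ h.symm hd).reverse, ?_⟩
    rintro e ⟨he, hne⟩
    have := hE he
    simp only [Set.mem_union, Set.mem_singleton_iff] at this hne ⊢
    tauto

end Pth

namespace Cyc

variable {X : Set W} {E F : Set (Sym2 W)} {x y z w : W}

theorem mono (p : Cyc G X E) (h : F ⊆ E) : Cyc G X F :=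
  let ⟨E', x, y, p', ha, h'⟩ := p
  ⟨E', x, y, p', ha, h.trans h'⟩

theorem cut (p : Cyc G X E) {a b : W} (h : s(a, b) ∈ E) : Pth G X (E \ {s(a, b)}) a b := by
  obtain ⟨E', x, y, p, ha, hE⟩ := p
  by_cases hab : s(a, b) = s(x, y)
  · have : Pth G X (E \ {s(a, b)}) x y :=
      ⟨E', p, fun e he => (hE he.1).resolve_left (fun h => he.2 (by rw [h, hab]; rfl))⟩
    rcases Sym2.eq_iff.1 hab with ⟨rfl, rfl⟩ | ⟨rfl, rfl⟩
    · exact this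
    · exact this.reverse
  · obtain ⟨X₁, X₂, E₁, E₂, a', b', rfl, hd, rfl, hab', p₁, p₂⟩ := p.split ((hE h).resolve_left hab)
    have : Pth G (X₁ ∪ X₂) (E \ {s(a, b)}) a' b' := by
      refine ⟨_, by
        have := p₁.reverse.append p₂.reverse ha.symm hd
        exact this, ?_⟩
      rintro e ⟨he, hne⟩
      have := hE he
      simp only [Set.mem_union, Set.mem_singleton_iff, Set.mem_insert_iff] at this hne ⊢
      tauto
    rcases hab' with ⟨rfl, rfl⟩ | ⟨rfl, rfl⟩
    · exact this
    · exact this.reverse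

/-- Cutting a cycle at the edge `y y₁`, then rotating at a neighbour `z` of `y`. -/
theorem cut_rotate {y₁ z₁ z₂ : W} (p : Cyc G X E) (hzy : z ≠ y) (h : G.Adj z y)
    (h₀ : s(y, y₁) ∈ E) (h₁ : s(z, z₁) ∈ E) (h₂ : s(z, z₂) ∈ E) (h₁₂ : z₁ ≠ z₂)
    (hzy₁ : z ≠ y₁) :
    ∃ z', (z' = z₁ ∨ z' = z₂) ∧ Pth G X (E \ {s(y, y₁), s(z, z')}) y₁ z' := by
  have key : ∀ t, s(z, t) ≠ s(y, y₁) := by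
    intro t ht
    rcases Sym2.eq_iff.1 ht with ⟨h, -⟩ | ⟨h, -⟩
    · exact hzy h
    · exact hzy₁ h
  obtain ⟨z', hz', q⟩ := (p.cut h₀).rotate hzy h ⟨h₁, key _⟩ ⟨h₂, key _⟩ h₁₂
  refine ⟨z', hz', q.mono ?_⟩
  rintro e ⟨he, hne⟩
  simp only [Set.mem_insert_iff, Set.mem_singleton_iff, not_or] at hne
  exact ⟨⟨he, hne.1⟩, hne.2⟩

theorem isHamiltonian [Fintype W] [DecidableEq W] (p : Cyc G Set.univ E)
    (hW : 3 ≤ Fintype.card W) : G.IsHamiltonian := by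
  intro _
  obtain ⟨E', x, y, p, ha, -⟩ := p
  obtain ⟨q, hq, hX, -⟩ := p.exists_walk
  have hlen : q.length + 1 = Fintype.card W := by
    have h1 : q.IsHamiltonian := hq.isHamiltonian_of_mem (by simp [hX])
    have := h1.length_eq
    omega
  refine ⟨y, Walk.cons ha q, ?_⟩
  rw [Walk.isHamiltonianCycle_iff_isCycle_and_support_count_tail_eq_one]
  refine ⟨?_, ?_⟩
  · rw [Walk.cons_isCycle_iff]
    refine ⟨hq, fun he => ?_⟩
    have : q.length = 1 := by
      cases q with
      | nil => simp at he
      | cons h r =>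
        rw [Walk.edges_cons, List.mem_cons] at he
        rw [Walk.cons_isPath_iff] at hq
        rcases he with he | he
        · rcases Sym2.eq_iff.1 he with ⟨h1, -⟩ | ⟨h1, h2⟩
          · exact absurd h1 ha.ne
          · subst h1
            have := Walk.length_eq_zero_iff.2 (Walk.isPath_iff_nil.1 hq.1)
            simp [this]
        · exact absurd (Walk.snd_mem_support_of_mem_edges _ he) hq.2
    omega
  · intro t
    rw [Walk.support_cons, List.tail_cons]
    exact List.count_eq_one_of_mem hq.support_nodup (by simp [hX])

end Cyc

end PathAlgebra

section Columns

variable {W Z Q : Type*} [AddCommGroup Z] [AddCommGroup Q]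

/-- The data of a bicirculant-like graph: two copies `u, v` of `Z`, edges `u i ~ u (i+a)`,
`v i ~ v (i+b)`, `u i ~ v i`, `u i ~ v (i+s)`, and the projection `π` of `Z` along the subgroup
generated by `s`. The fibres of `π` are the columns of the graph. -/
structure Bic (G : SimpleGraph W) (u v : Z → W) (a b s : Z) (π : Z →+ Q) : Prop where
  adjA : ∀ i, G.Adj (u i) (u (i + a))
  adjB : ∀ i, G.Adj (v i) (v (i + b))
  adj0 : ∀ i, G.Adj (u i) (v i)
  adjS : ∀ i, G.Adj (u i) (v (i + s))
  u_inj : Function.Injective u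
  v_inj : Function.Injective v
  u_ne_v : ∀ i j, u i ≠ v j
  cover : ∀ w, (∃ i, w = u i) ∨ ∃ i, w = v i
  map_s : π s = 0
  ker : ∀ i j, π i = π j → ∃ k : ℤ, j = i + k • s
  s_ne : s ≠ 0
  ss_ne : s + s ≠ 0

/-- The union of the columns over `R`. -/
def reg (u v : Z → W) (π : Z →+ Q) (R : Set Q) : Set W :=
  {w | ∃ i, π i ∈ R ∧ (w = u i ∨ w = v i)}

/-- The periodic walk `v i, u i, v (i+s), u (i+s), v (i+2s), …` along a column. -/
def col (u v : Z → W) (s i : Z) (k : ℤ) : W :=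
  if Even k then v (i + (k / 2) • s) else u (i + (k / 2) • s)

theorem col_even {u v : Z → W} {s i : Z} {k : ℤ} (l : ℤ) (h : k = 2 * l) :
    col u v s i k = v (i + l • s) := by
  subst h
  rw [col, if_pos (even_two_mul l), Int.mul_ediv_cancel_left _ two_ne_zero]

theorem col_odd {u v : Z → W} {s i : Z} {k : ℤ} (l : ℤ) (h : k = 2 * l + 1) :
    col u v s i k = u (i + l • s) := by
  subst h
  rw [col, if_neg (by simp)]
  congr 3
  omega

theorem reg_union {u v : Z → W} {π : Z →+ Q} (R S : Set Q) :
    reg u v π (R ∪ S) = reg u v π R ∪ reg u v π S := by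
  ext w
  simp only [reg, Set.mem_ofPred_eq, Set.mem_union]
  constructor
  · rintro ⟨i, h | h, hw⟩
    · exact Or.inl ⟨i, h, hw⟩
    · exact Or.inr ⟨i, h, hw⟩
  · rintro (⟨i, h, hw⟩ | ⟨i, h, hw⟩)
    · exact ⟨i, Or.inl h, hw⟩
    · exact ⟨i, Or.inr h, hw⟩

namespace Bic

variable {G : SimpleGraph W} {u v : Z → W} {a b s : Z} {π : Z →+ Q}

theorem adjU (H : Bic G u v a b s π) {i j : Z} (h : j = i + a) : G.Adj (u i) (u j) :=
  h ▸ H.adjA i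

theorem adjV (H : Bic G u v a b s π) {i j : Z} (h : j = i + b) : G.Adj (v i) (v j) :=
  h ▸ H.adjB i

theorem swap (H : Bic G u v a b s π) : Bic G v u b a (-s) π where
  adjA := H.adjB
  adjB := H.adjA
  adj0 i := (H.adj0 i).symm
  adjS i := by simpa using (H.adjS (i + -s)).symm
  u_inj := H.v_inj
  v_inj := H.u_inj
  u_ne_v i j h := H.u_ne_v j i h.symm
  cover w := (H.cover w).symm
  map_s := by simp [H.map_s]
  ker i j h := by
    obtain ⟨k, hk⟩ := H.ker i j h
    exact ⟨-k, by simpa using hk⟩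
  s_ne := neg_ne_zero.2 H.s_ne
  ss_ne h := H.ss_ne (by rw [← neg_eq_zero, neg_add]; exact h)

theorem negA (H : Bic G u v a b s π) : Bic G u v (-a) b s π :=
  { H with adjA := fun i => by simpa using (H.adjA (i + -a)).symm }

theorem negB (H : Bic G u v a b s π) : Bic G u v a (-b) s π :=
  { H with adjB := fun i => by simpa using (H.adjB (i + -b)).symm }

theorem map_zsmul (H : Bic G u v a b s π) (k : ℤ) : π (k • s) = 0 := by
  rw [_root_.map_zsmul, H.map_s, smul_zero]

theorem reg_disjoint (H : Bic G u v a b s π) {R S : Set Q} (h : Disjoint R S) :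
    Disjoint (reg u v π R) (reg u v π S) := by
  rw [Set.disjoint_left] at h ⊢
  rintro w ⟨i, hi, hw⟩ ⟨j, hj, hw'⟩
  have hij : i = j := by
    rcases hw with rfl | rfl <;> rcases hw' with hw' | hw'
    · exact H.u_inj hw'
    · exact absurd hw' (H.u_ne_v _ _)
    · exact absurd hw'.symm (H.u_ne_v _ _)
    · exact H.v_inj hw'
  exact h hi (hij ▸ hj)

theorem reg_univ (H : Bic G u v a b s π) : reg u v π Set.univ = Set.univ := by
  ext w
  simp only [reg, Set.mem_univ, true_and, Set.mem_ofPred_eq, iff_true]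
  rcases H.cover w with ⟨i, h⟩ | ⟨i, h⟩
  · exact ⟨i, Or.inl h⟩
  · exact ⟨i, Or.inr h⟩

theorem col_adj (H : Bic G u v a b s π) (i : Z) (k : ℤ) :
    G.Adj (col u v s i k) (col u v s i (k + 1)) := by
  obtain ⟨l, rfl | rfl⟩ := Int.even_or_odd' k
  · rw [col_even l rfl, col_odd l rfl]
    exact (H.adj0 _).symm
  · rw [col_odd l rfl, col_even (l + 1) (by ring), add_smul, one_smul, ← add_assoc]
    exact H.adjS _

theorem map_col (H : Bic G u v a b s π) {R : Set Q} {i : Z} (h : π i ∈ R) (k : ℤ) :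
    col u v s i k ∈ reg u v π R := by
  obtain ⟨l, rfl | rfl⟩ := Int.even_or_odd' k
  · rw [col_even l rfl]
    exact ⟨_, by rwa [map_add, H.map_zsmul, add_zero], Or.inr rfl⟩
  · rw [col_odd l rfl]
    exact ⟨_, by rwa [map_add, H.map_zsmul, add_zero], Or.inl rfl⟩

theorem dvd_of_smul_eq {i : Z} {k l : ℤ} (h : i + k • s = i + l • s) :
    (addOrderOf s : ℤ) ∣ k - l := by
  rw [addOrderOf_dvd_iff_zsmul_eq_zero, sub_smul, add_left_cancel h, sub_self]

theorem col_inj (H : Bic G u v a b s π) {i : Z} {k l : ℤ}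
    (h : col u v s i k = col u v s i l) : (2 * addOrderOf s : ℤ) ∣ k - l := by
  obtain ⟨k, rfl | rfl⟩ := Int.even_or_odd' k <;> obtain ⟨l, rfl | rfl⟩ := Int.even_or_odd' l
  · rw [col_even k rfl, col_even l rfl] at h
    have := mul_dvd_mul_left 2 (dvd_of_smul_eq (H.v_inj h))
    rwa [mul_sub] at this
  · rw [col_even k rfl, col_odd l rfl] at h
    exact absurd h.symm (H.u_ne_v _ _)
  · rw [col_odd k rfl, col_even l rfl] at h
    exact absurd h (H.u_ne_v _ _)
  · rw [col_odd k rfl, col_odd l rfl] at h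
    have := mul_dvd_mul_left 2 (dvd_of_smul_eq (H.u_inj h))
    rwa [mul_sub, ← add_sub_add_right_eq_sub _ _ 1] at this

theorem col_inj' (H : Bic G u v a b s π) {i : Z} {k l : ℤ}
    (h : col u v s i k = col u v s i l) (h1 : k < l + 2 * addOrderOf s)
    (h2 : l < k + 2 * addOrderOf s) : k = l := by
  have := Int.eq_zero_of_abs_lt_dvd (H.col_inj h) (abs_lt.2 ⟨by linarith, by linarith⟩)
  linarith

/-- A segment of a column. -/
theorem arc_aux (H : Bic G u v a b s π) (i : Z) (lo : ℤ) (d : ℕ)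
    (h : (d : ℤ) < 2 * addOrderOf s) :
    Pth G (col u v s i '' Set.Icc lo (lo + d))
      {e | ∃ k, lo ≤ k ∧ k + 1 ≤ lo + d ∧ e = s(col u v s i k, col u v s i (k + 1))}
      (col u v s i lo) (col u v s i (lo + d)) := by
  induction d with
  | zero =>
    have := Pth.single (G := G) (col u v s i lo)
    simp only [Nat.cast_zero, add_zero, Set.Icc_self, Set.image_singleton]
    refine this.mono ?_
    rintro e ⟨k, h1, h2, -⟩
    omega
  | succ d ih =>
    push_cast at h ⊢
    have hw : lo + ((d : ℤ) + 1) = lo + d + 1 := by ring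
    rw [hw]
    have := (ih (by linarith)).append' (H.col_adj i (lo + d)) (Pth.single _) ?_
    · have hset : col u v s i '' Set.Icc lo (lo + d) ∪ {col u v s i (lo + d + 1)} =
          col u v s i '' Set.Icc lo (lo + d + 1) := by
        rw [← Set.image_singleton, ← Set.image_union]
        congr 1
        ext k
        simp only [Set.mem_union, Set.mem_Icc, Set.mem_singleton_iff]
        omega
      rw [hset] at this
      refine this.mono ?_
      rintro e ⟨k, h1, h2, rfl⟩
      by_cases hk : k = lo + d
      · subst hk
        exact Or.inr rfl
      · exact Or.inl (Or.inl ⟨k, h1, by omega, rfl⟩)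
    · rw [Set.disjoint_singleton_right]
      rintro ⟨k, ⟨h1, h2⟩, hk⟩
      have := H.col_inj' hk (by linarith) (by linarith)
      linarith

/-- A segment of a column. -/
theorem arc (H : Bic G u v a b s π) (i : Z) (lo hi : ℤ) (h0 : lo ≤ hi)
    (h : hi < lo + 2 * addOrderOf s) :
    Pth G (col u v s i '' Set.Icc lo hi)
      {e | ∃ k, lo ≤ k ∧ k + 1 ≤ hi ∧ e = s(col u v s i k, col u v s i (k + 1))}
      (col u v s i lo) (col u v s i hi) := by
  have := H.arc_aux i lo (hi - lo).toNat (by omega)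
  rwa [Int.toNat_of_nonneg (by omega), add_sub_cancel] at this

theorem arc_disjoint (H : Bic G u v a b s π) (i : Z) {l₁ h₁ l₂ h₂ : ℤ}
    (h12 : h₁ < l₂) (h21 : h₂ < l₁ + 2 * addOrderOf s) :
    Disjoint (col u v s i '' Set.Icc l₁ h₁) (col u v s i '' Set.Icc l₂ h₂) := by
  rw [Set.disjoint_left]
  rintro w ⟨k, ⟨h1, h2⟩, rfl⟩ ⟨l, ⟨h3, h4⟩, h⟩
  have := H.col_inj' h (by linarith) (by linarith)
  linarith

theorem arc_subset (H : Bic G u v a b s π) {R : Set Q} {i : Z} (h : π i ∈ R) (l : Set ℤ) :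
    col u v s i '' l ⊆ reg u v π R := by
  rintro w ⟨k, -, rfl⟩
  exact H.map_col h k

theorem arc_full [Finite Z] (H : Bic G u v a b s π) (i : Z) {lo hi : ℤ}
    (h : hi + 1 = lo + 2 * addOrderOf s) :
    col u v s i '' Set.Icc lo hi = reg u v π {π i} := by
  refine (H.arc_subset (Set.mem_singleton _) _).antisymm ?_
  have hn : (0 : ℤ) < addOrderOf s := by exact_mod_cast addOrderOf_pos s
  have key : ∀ l : ℤ, ∃ k, (2 * k = lo ∨ 2 * k = lo + 1 ∨ lo + 1 < 2 * k) ∧ 2 * k ≤ hi + 1 ∧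
      lo ≤ 2 * k ∧ k • s = l • s := by
    intro l
    refine ⟨(l - (lo + 1) / 2) % addOrderOf s + (lo + 1) / 2, ?_, ?_, ?_, ?_⟩
    · have := Int.emod_nonneg (l - (lo + 1) / 2) hn.ne'
      omega
    · have := Int.emod_lt_of_pos (l - (lo + 1) / 2) hn
      omega
    · have := Int.emod_nonneg (l - (lo + 1) / 2) hn.ne'
      omega
    · rw [← sub_eq_zero, ← sub_smul, ← addOrderOf_dvd_iff_zsmul_eq_zero]
      have := Int.emod_add_mul_ediv (l - (lo + 1) / 2) (addOrderOf s)
      exact ⟨-((l - (lo + 1) / 2) / (addOrderOf s)), by linarith⟩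
  rintro w ⟨j, hj, hw⟩
  obtain ⟨l, rfl⟩ := H.ker i j (Set.mem_singleton_iff.1 hj).symm
  obtain ⟨k, h1, h2, h3, h4⟩ := key l
  rcases hw with rfl | rfl
  · by_cases h5 : 2 * k + 1 ≤ hi
    · exact ⟨2 * k + 1, ⟨by omega, h5⟩, by rw [col_odd k rfl, h4]⟩
    · refine ⟨2 * (k - addOrderOf s) + 1, ⟨by omega, by omega⟩, ?_⟩
      rw [col_odd _ rfl, sub_smul, h4, natCast_zsmul, addOrderOf_nsmul_eq_zero, sub_zero]
  · by_cases h5 : 2 * k ≤ hi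
    · exact ⟨2 * k, ⟨by omega, h5⟩, by rw [col_even k rfl, h4]⟩
    · refine ⟨2 * (k - addOrderOf s), ⟨by omega, by omega⟩, ?_⟩
      rw [col_even _ rfl, sub_smul, h4, natCast_zsmul, addOrderOf_nsmul_eq_zero, sub_zero]

/-- The column of `i` minus the edge `u i ~ v i`. -/
theorem colPath_zero [Finite Z] (H : Bic G u v a b s π) (i : Z) :
    Pth G (reg u v π {π i})
      {e | ∃ j ε, e = s(u j, v (j + ε)) ∧ (ε = 0 ∨ ε = s) ∧ π j = π i ∧ (j, ε) ≠ (i, 0)}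
      (u i) (v i) := by
  have hn : (0 : ℤ) < addOrderOf s := by exact_mod_cast addOrderOf_pos s
  have := H.arc i 1 (2 * addOrderOf s) (by omega) (by omega)
  rw [H.arc_full i (by ring), col_odd 0 (by ring), col_even _ rfl, natCast_zsmul,
    addOrderOf_nsmul_eq_zero, zero_smul, add_zero] at this
  refine this.mono ?_
  rintro e ⟨j, ε, rfl, hε, hj, hne⟩
  obtain ⟨l, rfl⟩ := H.ker i j hj.symm
  have hl : (l % addOrderOf s) • s = l • s := mod_addOrderOf_zsmul s l
  have h1 := Int.emod_nonneg l hn.ne'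
  have h2 := Int.emod_lt_of_pos l hn
  rw [← hl] at hne ⊢
  generalize l % addOrderOf s = k at h1 h2 hne
  rcases hε with rfl | rfl
  · have hk : k ≠ 0 := by
      rintro rfl
      simp at hne
    refine ⟨2 * k, by omega, by omega, ?_⟩
    rw [col_even k rfl, col_odd k rfl, add_zero, Sym2.eq_swap]
  · refine ⟨2 * k + 1, by omega, by omega, ?_⟩
    rw [col_odd k rfl, col_even (k + 1) (by ring), add_smul, one_smul, add_assoc]

/-- The column of `i` minus the edge `u i ~ v (i + s)`. -/
theorem colPath_s [Finite Z] (H : Bic G u v a b s π) (i : Z) :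
    Pth G (reg u v π {π i})
      {e | ∃ j ε, e = s(u j, v (j + ε)) ∧ (ε = 0 ∨ ε = s) ∧ π j = π i ∧ (j, ε) ≠ (i, s)}
      (u i) (v (i + s)) := by
  have hn : (0 : ℤ) < addOrderOf s := by exact_mod_cast addOrderOf_pos s
  have := H.arc i 2 (2 * addOrderOf s + 1) (by omega) (by omega)
  rw [H.arc_full i (by ring), col_even 1 (by ring), col_odd _ rfl, natCast_zsmul,
    addOrderOf_nsmul_eq_zero, one_smul, add_zero] at this
  refine this.reverse.mono ?_
  rintro e ⟨j, ε, rfl, hε, hj, hne⟩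
  obtain ⟨l, rfl⟩ := H.ker i j hj.symm
  have hl : ((l - 1) % addOrderOf s + 1) • s = l • s := by
    rw [add_smul, mod_addOrderOf_zsmul, ← add_smul, sub_add_cancel]
  have h1 : 1 ≤ (l - 1) % addOrderOf s + 1 := by linarith [Int.emod_nonneg (l - 1) hn.ne']
  have h2 : (l - 1) % addOrderOf s + 1 ≤ addOrderOf s := by
    linarith [Int.add_one_le_of_lt (Int.emod_lt_of_pos (l - 1) hn)]
  rw [← hl] at hne ⊢
  generalize (l - 1) % addOrderOf s + 1 = k at h1 h2 hne
  rcases hε with rfl | rfl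
  · refine ⟨2 * k, by omega, by omega, ?_⟩
    rw [col_even k rfl, col_odd k rfl, add_zero, Sym2.eq_swap]
  · have hk : k ≠ addOrderOf ε := by
      rintro rfl
      rw [natCast_zsmul, addOrderOf_nsmul_eq_zero, add_zero] at hne
      exact hne rfl
    refine ⟨2 * k + 1, by omega, by omega, ?_⟩
    rw [col_odd k rfl, col_even (k + 1) (by ring), add_smul, one_smul, add_assoc]

/-- The column of `i` minus one of the edges at `u i`. -/
theorem colPath [Finite Z] (H : Bic G u v a b s π) (i : Z) {ε : Z} (hε : ε = 0 ∨ ε = s) :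
    Pth G (reg u v π {π i})
      {e | ∃ j δ, e = s(u j, v (j + δ)) ∧ (δ = 0 ∨ δ = s) ∧ π j = π i ∧ (j, δ) ≠ (i, ε)}
      (u i) (v (i + ε)) := by
  rcases hε with rfl | rfl
  · simpa using H.colPath_zero i
  · exact H.colPath_s i

end Bic
end Columns

section Chain

variable {W Z Q : Type*} [AddCommGroup Z] [AddCommGroup Q]

theorem col_shift {u v : Z → W} {s i : Z} (l k : ℤ) :
    col u v s (i + l • s) k = col u v s i (k + 2 * l) := by
  obtain ⟨k, rfl | rfl⟩ := Int.even_or_odd' k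
  · rw [col_even k rfl, col_even (l + k) (by ring), add_smul, add_assoc]
  · rw [col_odd k rfl, col_odd (l + k) (by ring), add_smul, add_assoc]

theorem arc_shift {u v : Z → W} {s i : Z} (l x y : ℤ) :
    col u v s (i + l • s) '' Set.Icc x y = col u v s i '' Set.Icc (x + 2 * l) (y + 2 * l) := by
  ext w
  constructor
  · rintro ⟨k, ⟨h1, h2⟩, rfl⟩
    exact ⟨k + 2 * l, ⟨by linarith, by linarith⟩, (col_shift l k).symm⟩
  · rintro ⟨k, ⟨h1, h2⟩, rfl⟩
    exact ⟨k - 2 * l, ⟨by linarith, by linarith⟩, by rw [col_shift, sub_add_cancel]⟩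

theorem arc_union {u v : Z → W} {s i : Z} {l m h : ℤ} (h1 : l ≤ m + 1) (h2 : m ≤ h) :
    col u v s i '' Set.Icc l m ∪ col u v s i '' Set.Icc (m + 1) h =
      col u v s i '' Set.Icc l h := by
  rw [← Set.image_union]
  congr 1
  ext k
  simp only [Set.mem_union, Set.mem_Icc]
  omega

theorem nsmul_succ_notMem {x : Q} {k : ℕ} (h : k + 1 < addOrderOf x) :
    (k + 1) • x ∉ {c | ∃ j ≤ k, c = j • x} := by
  rintro ⟨j, hj, hjk⟩
  have := nsmul_injOn_Iio_addOrderOf (Set.mem_Iio.2 h) (Set.mem_Iio.2 (by omega)) hjk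
  omega

theorem nsmul_succ_union {x : Q} {k : ℕ} :
    {c | ∃ j ≤ k + 1, c = j • x} = {c | ∃ j ≤ k, c = j • x} ∪ {(k + 1) • x} := by
  ext c
  simp only [Set.mem_ofPred_eq, Set.mem_union, Set.mem_singleton_iff]
  constructor
  · rintro ⟨j, hj, rfl⟩
    rcases Nat.le_succ_iff.1 hj with h | rfl
    · exact Or.inl ⟨j, h, rfl⟩
    · exact Or.inr rfl
  · rintro (⟨j, hj, rfl⟩ | rfl)
    · exact ⟨j, by omega, rfl⟩
    · exact ⟨k + 1, le_rfl, rfl⟩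

theorem nsmul_lt_eq_univ [Finite Q] {x : Q} (hx : ∀ c : Q, ∃ k : ℤ, c = k • x) :
    {c | ∃ j ≤ addOrderOf x - 1, c = j • x} = Set.univ := by
  ext c
  simp only [Set.mem_ofPred_eq, Set.mem_univ, iff_true]
  obtain ⟨k, rfl⟩ := hx c
  have hn : (0 : ℤ) < addOrderOf x := by exact_mod_cast addOrderOf_pos x
  refine ⟨(k % addOrderOf x).toNat, ?_, ?_⟩
  · have := Int.emod_lt_of_pos k hn
    have := Int.emod_nonneg k hn.ne'
    omega
  · rw [← natCast_zsmul, Int.toNat_of_nonneg (Int.emod_nonneg k hn.ne'), mod_addOrderOf_zsmul]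

namespace Bic

variable {G : SimpleGraph W} {u v : Z → W} {a b s : Z} {π : Z →+ Q}

theorem chain_mem [Finite Z] (H : Bic G u v a b s π) {α : ℤ} (h1 : 1 ≤ α)
    (h2 : 2 * α + 1 ≤ addOrderOf s) (ha : a = α • s) (k : ℕ) (hk : k < addOrderOf (π b)) :
    ∃ i p q X, π i = k • π b ∧ Pth G X ∅ p q ∧ G.Adj (u i) p ∧ G.Adj q (v (i + (α + 1) • s)) ∧
      Disjoint X (col u v s i '' Set.Icc 1 (2 * α + 2)) ∧
      X ∪ col u v s i '' Set.Icc 1 (2 * α + 2) = reg u v π {c | ∃ j ≤ k, c = j • π b} := by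
  have hns : (addOrderOf s : ℤ) • s = 0 := by rw [natCast_zsmul, addOrderOf_nsmul_eq_zero]
  induction k with
  | zero =>
    refine ⟨0, _, _, _, by simp, ((H.arc 0 (2 * α + 3) (2 * addOrderOf s) (by omega)
      (by omega)).mono (Set.empty_subset _)).reverse, ?_, ?_, ?_, ?_⟩
    · rw [col_even _ rfl, hns, add_zero]
      exact H.adj0 0
    · rw [col_odd (α + 1) (by ring)]
      exact H.adj0 _
    · exact (H.arc_disjoint 0 (by omega) (by omega)).symm
    · rw [Set.union_comm, show 2 * α + 3 = 2 * α + 2 + 1 by ring, arc_union (by omega) (by omega),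
        H.arc_full 0 (by ring), _root_.map_zero]
      congr 1
      ext c
      simp
  | succ k ih =>
    obtain ⟨i, p, q, X, hi, hp, hup, hqv, hd, hX⟩ := ih (by omega)
    have old : Pth G (reg u v π {c | ∃ j ≤ k, c = j • π b}) ∅ (v (i + s)) (v (i + s + a)) := by
      have h3 := H.arc i 2 (2 * α + 1) (by omega) (by omega)
      rw [col_even 1 (by ring), one_smul, col_odd α rfl] at h3
      have h4 := H.arc i 1 1 (by omega) (by omega)
      rw [col_odd 0 (by ring), zero_smul, add_zero] at h4
      have h5 := H.arc i (2 * α + 2) (2 * α + 2) (by omega) (by omega)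
      rw [col_even (α + 1) (by ring)] at h5
      have d5 : Disjoint (col u v s i '' Set.Icc 2 (2 * α + 1)) X :=
        (hd.mono_right (Set.image_mono (Set.Icc_subset_Icc (by omega) (by omega)))).symm
      have d6 : Disjoint (col u v s i '' Set.Icc 1 1) X :=
        (hd.mono_right (Set.image_mono (Set.Icc_subset_Icc (by omega) (by omega)))).symm
      have d7 : Disjoint X (col u v s i '' Set.Icc (2 * α + 2) (2 * α + 2)) :=
        (hd.mono_right (Set.image_mono (Set.Icc_subset_Icc (by omega) (by omega))))
      have h6 := ((h3.append (H.adjU (by rw [ha])).symm h4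
        (H.arc_disjoint i (by omega) (by omega)).symm).append hup hp ?_).append hqv h5 ?_
      · convert h6.mono (Set.empty_subset _) using 1
        · rw [← hX, Set.union_comm (col u v s i '' Set.Icc 2 (2 * α + 1)),
            show (2 : ℤ) = 1 + 1 by norm_num, arc_union (by omega) (by omega), Set.union_comm _ X,
            Set.union_assoc, show (1 + 1) * α + (1 + 1) = (1 + 1) * α + 1 + 1 by ring,
            arc_union (by omega) (by omega)]
        · rw [add_smul, one_smul, ha, add_assoc, add_comm s]
      · exact Set.disjoint_union_left.2 ⟨d5, d6⟩
      · exact Set.disjoint_union_left.2 ⟨Set.disjoint_union_left.2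
          ⟨H.arc_disjoint i (by omega) (by omega), H.arc_disjoint i (by omega) (by omega)⟩, d7⟩
    have hi' : π (i + s + b) = (k + 1) • π b := by
      rw [map_add, map_add, hi, H.map_s, add_zero, add_smul, one_smul]
    have hdis : Disjoint (reg u v π {(k + 1) • π b})
        (reg u v π {c | ∃ j ≤ k, c = j • π b}) :=
      H.reg_disjoint (Set.disjoint_singleton_left.2 (nsmul_succ_notMem hk))
    have sub : ∀ l, col u v s (i + s + b) '' l ⊆ reg u v π {(k + 1) • π b} :=
      H.arc_subset (by rw [hi']; rfl)
    have h3 := H.arc (i + s + b) 1 (2 * α) (by omega) (by omega)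
    rw [col_odd 0 (by ring), zero_smul, add_zero, col_even α rfl] at h3
    have h4 := h3.append (H.adjV (by rw [ha]; abel)).symm old.reverse (hdis.mono_left (sub _))
    have hset : (col u v s (i + s + b) '' Set.Icc 1 (2 * α) ∪
        reg u v π {c | ∃ j ≤ k, c = j • π b} ∪
        col u v s (i + s + b) '' Set.Icc (4 * α + 2 + 1) (2 * addOrderOf s)) ∪
        col u v s (i + s + b + α • s) '' Set.Icc 1 (2 * α + 2) =
        reg u v π {c | ∃ j ≤ k + 1, c = j • π b} := by
      rw [nsmul_succ_union, reg_union, ← hi', ← H.arc_full (i + s + b) (lo := 1)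
        (hi := 2 * addOrderOf s) (by ring),
        ← arc_union (i := i + s + b) (l := 1) (m := 2 * α) (h := 2 * addOrderOf s) (by omega)
          (by omega), ← arc_union (l := 2 * α + 1) (m := 4 * α + 2) (by omega) (by omega),
        arc_shift, show 1 + 2 * α = 2 * α + 1 by ring,
        show 2 * α + 2 + 2 * α = 4 * α + 2 by ring]
      ac_rfl
    have hpi : π (i + s + b + α • s) = (k + 1) • π b := by
      rw [map_add, hi', H.map_zsmul, add_zero]
    have hdis' : Disjoint (col u v s (i + s + b) '' Set.Icc 1 (2 * α) ∪
        reg u v π {c | ∃ j ≤ k, c = j • π b} ∪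
        col u v s (i + s + b) '' Set.Icc (4 * α + 2 + 1) (2 * addOrderOf s))
        (col u v s (i + s + b + α • s) '' Set.Icc 1 (2 * α + 2)) := by
      refine Set.disjoint_union_left.2 ⟨Set.disjoint_union_left.2 ⟨?_, ?_⟩, ?_⟩
      · rw [arc_shift]
        exact H.arc_disjoint _ (by omega) (by omega)
      · exact (hdis.mono_left (H.arc_subset (by rw [hpi]; rfl) _)).symm
      · rw [arc_shift]
        exact (H.arc_disjoint _ (by omega) (by omega)).symm
    by_cases hn : 4 * α + 2 + 1 ≤ 2 * addOrderOf s
    · have h5 := H.arc (i + s + b) (4 * α + 2 + 1) (2 * addOrderOf s) hn (by omega)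
      rw [col_odd (2 * α + 1) (by ring), col_even _ rfl, hns, add_zero] at h5
      have h6 := h4.append (H.adjV rfl) h5.reverse (Set.disjoint_union_left.2
        ⟨H.arc_disjoint _ (by omega) (by omega), hdis.symm.mono_right (sub _)⟩)
      refine ⟨_, _, _, _, hpi, h6.mono (Set.empty_subset _), (H.adjU (by rw [ha])).symm, ?_,
        hdis', hset⟩
      convert H.adj0 _ using 2
      module
    · rw [Set.Icc_eq_empty hn, Set.image_empty, Set.union_empty] at hset hdis'
      refine ⟨_, _, _, _, hpi, h4.mono (Set.empty_subset _), (H.adjU (by rw [ha])).symm, ?_,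
        hdis', hset⟩
      apply H.adjV
      have : (addOrderOf s : ℤ) = 2 * α + 1 := by omega
      rw [this] at hns
      calc i + s + b + α • s + (α + 1) • s = i + s + b + (2 * α + 1) • s := by module
        _ = _ := by rw [hns, add_zero]

theorem cyc_of_mem [Finite Z] [Finite Q] (H : Bic G u v a b s π) {α : ℤ} (ha : a = α • s)
    (ha2 : 2 • a ≠ 0) (hb : ∀ c : Q, ∃ k : ℤ, c = k • π b) : Cyc G Set.univ ∅ := by
  have main : ∀ {a : Z} {α : ℤ}, Bic G u v a b s π → a = α • s → 1 ≤ α →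
      2 * α + 1 ≤ addOrderOf s → Cyc G Set.univ ∅ := by
    intro a α H ha h1 h2
    obtain ⟨i, p, q, X, -, hp, hup, hqv, hd, hX⟩ := H.chain_mem h1 h2 ha (addOrderOf (π b) - 1)
      (Nat.sub_lt (addOrderOf_pos _) one_pos)
    rw [nsmul_lt_eq_univ hb, H.reg_univ] at hX
    have h3 := H.arc i 1 (2 * α + 2) (by omega) (by omega)
    rw [col_odd 0 (by ring), col_even (α + 1) (by ring), zero_smul, add_zero] at h3
    have h4 := (hp.append hqv h3.reverse hd).close hup
    rw [hX] at h4
    exact h4.mono (Set.empty_subset _)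
  have hn : (0 : ℤ) < addOrderOf s := by exact_mod_cast addOrderOf_pos s
  have h0 := Int.emod_nonneg α hn.ne'
  have h1 := Int.emod_lt_of_pos α hn
  have ha' : a = (α % addOrderOf s) • s := by rw [mod_addOrderOf_zsmul, ha]
  have hns : (addOrderOf s : ℤ) • s = 0 := by rw [natCast_zsmul, addOrderOf_nsmul_eq_zero]
  generalize α % addOrderOf s = β at h0 h1 ha'
  have hβ : β ≠ 0 := by
    rintro rfl
    simp [ha'] at ha2
  rcases lt_trichotomy (2 * β) (addOrderOf s) with h | h | h
  · exact main H ha' (by omega) (by omega)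
  · refine absurd ?_ ha2
    rw [← h] at hns
    rw [ha', ← natCast_zsmul, smul_smul]
    exact hns
  · refine main (a := -a) (α := addOrderOf s - β) H.negA ?_ (by omega) (by omega)
    rw [sub_smul, hns, ha', zero_sub]

end Bic
end Chain

section Parallel

variable {W Z Q : Type*} [AddCommGroup Z] [AddCommGroup Q]

namespace Bic

variable {G : SimpleGraph W} {u v : Z → W} {a b s : Z} {π : Z →+ Q}

theorem arc_disjoint_of_ne (H : Bic G u v a b s π) {i j : Z} (h : π i ≠ π j) (l m : Set ℤ) :
    Disjoint (col u v s i '' l) (col u v s j '' m) :=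
  (H.reg_disjoint (Set.disjoint_singleton.2 h)).mono (H.arc_subset (Set.mem_singleton _) _)
    (H.arc_subset (Set.mem_singleton _) _)

theorem arc_disjoint_reg (H : Bic G u v a b s π) {i : Z} {R : Set Q} (h : π i ∉ R) (l : Set ℤ) :
    Disjoint (col u v s i '' l) (reg u v π R) :=
  (H.reg_disjoint (Set.disjoint_singleton_left.2 h)).mono_left
    (H.arc_subset (Set.mem_singleton _) _)

theorem arc_eq (H : Bic G u v a b s π) (i : Z) {lo hi : ℤ} {x y : W} (h0 : lo ≤ hi)
    (h : hi < lo + 2 * addOrderOf s) (hx : col u v s i lo = x) (hy : col u v s i hi = y) :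
    Pth G (col u v s i '' Set.Icc lo hi) ∅ x y :=
  hx ▸ hy ▸ (H.arc i lo hi h0 h).mono (Set.empty_subset _)

theorem zsmul_order (s : Z) : (addOrderOf s : ℤ) • s = 0 := by
  rw [natCast_zsmul, addOrderOf_nsmul_eq_zero]

/-- Two columns adjacent both along `a` and along `b` can be added to a path. -/
theorem parallel_step [Finite Z] (H : Bic G u v a b s π) {β : ℤ} (hb : b = a + β • s)
    (h0 : 0 ≤ β) (h1 : β < addOrderOf s) {R : Set Q} {i : Z}
    (p : Pth G (reg u v π R) ∅ (v (i + s)) (u i)) (hR₁ : π (i + a) ∉ R)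
    (hR₂ : π (i + a + a) ∉ R) (hne : π (i + a) ≠ π (i + a + a)) :
    ∃ i', π i' = π (i + a + a) ∧
      Pth G (reg u v π (R ∪ {π (i + a), π (i + a + a)})) ∅ (v (i' + s)) (u i') := by
  have hns := zsmul_order s
  obtain ⟨j, hj⟩ : ∃ j, j = i + s + b := ⟨_, rfl⟩
  have hπb : π b = π a := by rw [hb, map_add, H.map_zsmul, add_zero]
  have hπj : π j = π (i + a) := by
    rw [hj, map_add, map_add, H.map_s, hπb, map_add, add_zero]
  have hπj' : π (j + a) = π (i + a + a) := by
    rw [map_add, hπj, ← map_add]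
  rw [← hπj, ← hπj'] at hne
  rw [← hπj] at hR₁
  rw [← hπj'] at hR₂
  have A := H.arc_eq (j + a) (lo := 2 * addOrderOf s) (hi := 2 * addOrderOf s) (by omega)
    (by omega) (col_even _ rfl) (col_even _ rfl)
  have B := H.arc_eq j (lo := 2 * (addOrderOf s - β)) (hi := 2 * addOrderOf s) (by omega)
    (by omega) (col_even _ rfl) (col_even _ rfl)
  have C := H.arc_eq j (lo := 1) (hi := 2 * (addOrderOf s - β) - 1) (by omega)
    (by omega) (col_odd 0 (by ring)) (col_odd (addOrderOf s - β - 1) (by ring))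
  have D := H.arc_eq (j + a) (lo := 1) (hi := 2 * addOrderOf s - 1) (by omega)
    (by omega) (col_odd 0 (by ring)) (col_odd (addOrderOf s - 1) (by ring))
  have AB := A.append (H.adjV ?_).symm B (H.arc_disjoint_of_ne hne.symm _ _)
  have ABp := AB.append (H.adjV ?_).symm p ?_
  have ABpC := ABp.append (H.adjU ?_) C.reverse ?_
  have ABpCD := ABpC.append (H.adjU ?_) D ?_
  · refine ⟨j + a - s, by rw [map_sub, hπj', H.map_s, sub_zero], ?_⟩
    convert ABpCD.mono (Set.empty_subset _) using 1
    · rw [reg_union, ← hπj, ← hπj', Set.insert_eq, reg_union, ← H.arc_full j (lo := 1)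
        (hi := 2 * addOrderOf s) (by ring), ← H.arc_full (j + a) (lo := 1)
        (hi := 2 * addOrderOf s) (by ring),
        ← arc_union (i := j) (l := 1) (m := 2 * (addOrderOf s - β) - 1) (h := 2 * addOrderOf s)
          (by omega) (by omega),
        ← arc_union (i := j + a) (l := 1) (m := 2 * addOrderOf s - 1) (h := 2 * addOrderOf s)
          (by omega) (by omega), sub_add_cancel, sub_add_cancel]
      ac_rfl
    · congr 1
      rw [hns]
      abel
    · congr 1
      rw [sub_smul, hns, one_smul]
      abel
  · abel
  · exact Set.disjoint_union_left.2 ⟨Set.disjoint_union_left.2 ⟨Set.disjoint_union_left.2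
      ⟨(H.arc_disjoint _ (by omega) (by omega)).symm, H.arc_disjoint_of_ne hne _ _⟩,
      (H.arc_disjoint_reg hR₂ _).symm⟩, H.arc_disjoint_of_ne hne _ _⟩
  · rw [hj, sub_smul, sub_smul, hns, one_smul, hb]
    abel
  · exact Set.disjoint_union_left.2 ⟨Set.disjoint_union_left.2 ⟨H.arc_disjoint_of_ne hne.symm _ _,
      (H.arc_disjoint _ (by omega) (by omega)).symm⟩, (H.arc_disjoint_reg hR₁ _).symm⟩
  · rw [hj, hns, add_zero]
  · exact Set.disjoint_union_left.2 ⟨H.arc_disjoint_reg hR₂ _, H.arc_disjoint_reg hR₁ _⟩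
  · rw [hns, sub_smul, hns, hb]
    abel

/-- If `a = b`, then a single column can be added to a path. -/
theorem equal_step [Finite Z] (H : Bic G u v a b s π) (hb : b = a) {R : Set Q} {i : Z}
    (p : Pth G (reg u v π R) ∅ (v (i + s)) (u i)) (hR : π (i + a) ∉ R) :
    ∃ i', π i' = π (i + a) ∧
      Pth G (reg u v π (R ∪ {π (i + a)})) ∅ (v (i' + s)) (u i') := by
  have hns := zsmul_order s
  have hn := addOrderOf_pos s
  have hn1 : addOrderOf s ≠ 1 := by
    rw [Ne, AddMonoid.addOrderOf_eq_one_iff]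
    exact H.s_ne
  have A := H.arc_eq (i + a) (lo := 2) (hi := 3) (by omega) (by omega) (col_even 1 (by ring))
    (col_odd 1 (by ring))
  have B := H.arc_eq (i + a) (lo := 3 + 1) (hi := 2 * addOrderOf s + 1) (by omega)
    (by omega) (col_even 2 (by ring)) (col_odd (addOrderOf s) (by ring))
  have C := (A.reverse.append (H.adjV ?_).symm p (H.arc_disjoint_reg hR _)).append (H.adjU ?_)
    B.reverse ?_
  · refine ⟨i + a + s, by rw [map_add, H.map_s, add_zero], ?_⟩
    convert C.reverse.mono (Set.empty_subset _) using 1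
    · rw [reg_union, ← H.arc_full (i + a) (lo := 2) (hi := 2 * addOrderOf s + 1) (by ring),
        ← arc_union (l := 2) (m := 3) (h := 2 * addOrderOf s + 1) (by omega) (by omega)]
      ac_rfl
    · congr 1
      module
    · congr 1
      module
  · rw [hb]
    module
  · rw [hns, add_zero]
  · exact Set.disjoint_union_left.2 ⟨H.arc_disjoint _ (by omega) (by omega),
      (H.arc_disjoint_reg hR _).symm⟩

theorem two_columns [Finite Z] (H : Bic G u v a b s π) {β δ : ℤ} (hβ : b = a + β • s)
    (hδ : b = -a + δ • s) (h1 : b ≠ a) (h2 : b ≠ -a) (h3 : π a ≠ 0) :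
    Cyc G (reg u v π {0, π a}) ∅ := by
  have hns := zsmul_order s
  have hn : (0 : ℤ) < addOrderOf s := by exact_mod_cast addOrderOf_pos s
  have key : ∀ γ : ℤ, γ • s ≠ 0 → ∃ i : ℤ, 1 ≤ i ∧ i < addOrderOf s ∧ i • s = -(γ • s) := by
    intro γ hγ
    have e : ((-γ) % addOrderOf s) • s = -(γ • s) := by rw [mod_addOrderOf_zsmul, neg_smul]
    refine ⟨(-γ) % addOrderOf s, ?_, Int.emod_lt_of_pos _ hn, e⟩
    have := Int.emod_nonneg (-γ) hn.ne'
    by_contra h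
    rw [show (-γ) % (addOrderOf s : ℤ) = 0 by omega, zero_smul] at e
    exact hγ (neg_eq_zero.1 e.symm)
  obtain ⟨j, hj1, hj2, hj⟩ := key β (fun h => h1 (by rw [hβ, h, add_zero]))
  obtain ⟨i, hi1, hi2, hi⟩ := key δ (fun h => h2 (by rw [hδ, h, add_zero]))
  have h0a : π 0 ≠ π a := by rw [_root_.map_zero]; exact h3.symm
  have A := H.arc_eq 0 (lo := 1) (hi := 2 * j) (by omega) (by omega) (col_odd 0 (by ring))
    (col_even j rfl)
  have A' := H.arc_eq 0 (lo := 2 * j + 1) (hi := 2 * addOrderOf s) (by omega) (by omega)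
    (col_odd j (by ring)) (col_even _ rfl)
  have B := H.arc_eq a (lo := 1) (hi := 2 * i) (by omega) (by omega) (col_odd 0 (by ring))
    (col_even i rfl)
  have B' := H.arc_eq a (lo := 2 * i + 1) (hi := 2 * addOrderOf s) (by omega) (by omega)
    (col_odd i (by ring)) (col_even _ rfl)
  have C := ((A.reverse.append (H.adjU (by simp)) B (H.arc_disjoint_of_ne h0a _ _)).append
    (H.adjV ?_) A'.reverse ?_).append (H.adjU ?_).symm B' ?_
  have D := C.close (H.adjV ?_).symm
  · convert D.mono (Set.empty_subset _) using 1
    rw [Set.insert_eq, reg_union, ← _root_.map_zero π, ← H.arc_full 0 (lo := 1)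
      (hi := 2 * addOrderOf s) (by ring), ← H.arc_full a (lo := 1)
      (hi := 2 * addOrderOf s) (by ring), ← arc_union (i := a) (l := 1) (m := 2 * i)
      (h := 2 * addOrderOf s) (by omega) (by omega), ← arc_union (i := 0) (l := 1) (m := 2 * j)
      (h := 2 * addOrderOf s) (by omega) (by omega)]
    ac_rfl
  · rw [hns, hj, hβ]
    abel
  · rw [hns, hi, hδ]
    abel
  · exact Set.disjoint_union_left.2 ⟨H.arc_disjoint _ (by omega) (by omega),
      H.arc_disjoint_of_ne h0a.symm _ _⟩
  · have e : a + β • s = -a + δ • s := by rw [← hβ, ← hδ]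
    rw [hi, hj]
    calc 0 + -(β • s) = a + -(a + β • s) := by abel
      _ = a + -(δ • s) + a := by rw [e]; abel
  · exact Set.disjoint_union_left.2 ⟨Set.disjoint_union_left.2 ⟨H.arc_disjoint_of_ne h0a _ _,
      H.arc_disjoint _ (by omega) (by omega)⟩, H.arc_disjoint_of_ne h0a _ _⟩

theorem four_columns [Finite Z] (H : Bic G u v a b s π) {β : ℤ} (hb : b = a + β • s)
    (h0 : 1 ≤ β) (h1 : β < addOrderOf s) {i₀ i₁ i₂ i₃ : Z} (h₁ : i₁ = i₀ + a) (h₂ : i₂ = i₁ + a)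
    (h₃ : i₃ = i₂ + a) (h01 : π i₀ ≠ π i₁) (h02 : π i₀ ≠ π i₂) (h03 : π i₀ ≠ π i₃)
    (h12 : π i₁ ≠ π i₂) (h13 : π i₁ ≠ π i₃) (h23 : π i₂ ≠ π i₃) :
    Pth G (reg u v π {π i₀, π i₁, π i₂, π i₃}) ∅ (v (i₃ - s + s)) (u (i₃ - s)) := by
  have hns := zsmul_order s
  have hβs : ((addOrderOf s : ℤ) - β) • s = -(β • s) := by rw [sub_smul, hns, zero_sub]
  obtain ⟨m, hm⟩ : ∃ m : ℤ, m = addOrderOf s - β := ⟨_, rfl⟩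
  rw [← hm] at hβs
  have A := H.arc_eq i₃ (lo := 0) (hi := 1) (by omega) (by omega) (col_even 0 (by ring))
    (col_odd 0 (by ring))
  have B := H.arc_eq i₂ (lo := 1) (hi := 1) (by omega) (by omega) (col_odd 0 (by ring))
    (col_odd 0 (by ring))
  have C := H.arc_eq i₁ (lo := 1) (hi := 2 * m - 1) (by omega) (by omega) (col_odd 0 (by ring))
    (col_odd (m - 1) (by ring))
  have D := H.arc_eq i₀ (lo := 2 * m) (hi := 2 * (addOrderOf s + m - 1) + 1) (by omega) (by omega)
    (col_even m rfl) (col_odd (addOrderOf s + m - 1) (by ring))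
  have E := H.arc_eq i₁ (lo := 2 * m + 2) (hi := 2 * addOrderOf s) (by omega) (by omega)
    (col_even (m + 1) (by ring)) (col_even _ rfl)
  have F := H.arc_eq i₂ (lo := 2) (hi := 2 * m + 1) (by omega) (by omega)
    (col_even 1 (by ring)) (col_odd m rfl)
  have K := H.arc_eq i₁ (lo := 2 * m) (hi := 2 * m + 1) (by omega) (by omega)
    (col_even m (by ring)) (col_odd m rfl)
  have L := H.arc_eq i₂ (lo := 2 * m + 2) (hi := 2 * addOrderOf s) (by omega) (by omega)
    (col_even (m + 1) (by ring)) (col_even _ rfl)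
  have M := H.arc_eq i₃ (lo := 2) (hi := 2 * addOrderOf s - 1) (by omega) (by omega)
    (col_even 1 (by ring)) (col_odd (addOrderOf s - 1) (by ring))
  have X := (((((((A.append (H.adjU ?_).symm B ?_).append (H.adjU ?_).symm C ?_).append
    (H.adjU ?_).symm D.reverse ?_).append (H.adjV ?_) E.reverse ?_).append (H.adjV ?_) F ?_).append
    (H.adjU ?_).symm K.reverse ?_).append (H.adjV ?_) L.reverse ?_).append (H.adjV ?_) M ?_
  · convert X.mono (Set.empty_subset _) using 1
    · rw [Set.insert_eq, reg_union, Set.insert_eq, reg_union, Set.insert_eq, reg_union,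
        ← H.arc_full i₀ (lo := 2 * m) (hi := 2 * (addOrderOf s + m - 1) + 1) (by ring),
        ← H.arc_full i₁ (lo := 1) (hi := 2 * addOrderOf s) (by ring),
        ← H.arc_full i₂ (lo := 1) (hi := 2 * addOrderOf s) (by ring),
        ← H.arc_full i₃ (lo := 0) (hi := 2 * addOrderOf s - 1) (by ring),
        ← arc_union (i := i₁) (l := 1) (m := 2 * m - 1) (h := 2 * addOrderOf s) (by omega)
          (by omega), sub_add_cancel,
        ← arc_union (i := i₁) (l := 2 * m) (m := 2 * m + 1) (h := 2 * addOrderOf s) (by omega)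
          (by omega),
        ← arc_union (i := i₂) (l := 1) (m := 1) (h := 2 * addOrderOf s) (by omega)
          (by omega),
        ← arc_union (i := i₂) (l := 1 + 1) (m := 2 * m + 1) (h := 2 * addOrderOf s) (by omega)
          (by omega),
        ← arc_union (i := i₃) (l := 0) (m := 1) (h := 2 * addOrderOf s - 1) (by omega)
          (by omega), add_assoc (2 * m) 1 1, one_add_one_eq_two]
      ac_rfl
    · congr 1
      module
    · congr 1
      rw [sub_smul, hns]
      module
  all_goals first
    | simp only [h₁, h₂, h₃, sub_smul, add_smul, hns, hβs, hb, one_smul, zero_smul]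
      abel1
    | try simp only [Set.disjoint_union_left]
      repeat' apply And.intro
      all_goals first
        | exact H.arc_disjoint _ (by omega) (by omega)
        | exact (H.arc_disjoint _ (by omega) (by omega)).symm
        | exact H.arc_disjoint_of_ne (by assumption) _ _
        | exact (H.arc_disjoint_of_ne (by assumption) _ _).symm

end Bic
end Parallel

section ParallelCycle

variable {W Z Q : Type*} [AddCommGroup Z] [AddCommGroup Q]

namespace Bic

variable {G : SimpleGraph W} {u v : Z → W} {a b s : Z} {π : Z →+ Q}

/-- The columns over `0, x, …, k x` are covered by a path whose ends are joined by a rung. -/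
def ChainPath (G : SimpleGraph W) (u v : Z → W) (s : Z) (π : Z →+ Q) (x : Q) (k : ℕ) : Prop :=
  ∃ i, π i = k • x ∧ Pth G (reg u v π {c | ∃ j ≤ k, c = j • x}) ∅ (v (i + s)) (u i)

theorem chainPath_zero [Finite Z] (H : Bic G u v a b s π) (x : Q) : ChainPath G u v s π x 0 := by
  refine ⟨0, by simp, ?_⟩
  have : {c | ∃ j ≤ 0, c = j • x} = {π 0} := by
    ext c
    simp
  rw [this]
  exact (H.colPath_s 0).reverse.mono (Set.empty_subset _)

theorem nsmul_ne {x : Q} {j k : ℕ} (h : j < k) (hk : k < addOrderOf x) : j • x ≠ k • x := fun e =>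
  h.ne (nsmul_injOn_Iio_addOrderOf (Set.mem_Iio.2 (h.trans hk)) (Set.mem_Iio.2 hk) e)

theorem ChainPath.add_one [Finite Z] (H : Bic G u v a b s π) (hb : b = a) {k : ℕ}
    (p : ChainPath G u v s π (π a) k) (hk : k + 1 < addOrderOf (π a)) :
    ChainPath G u v s π (π a) (k + 1) := by
  obtain ⟨i, hi, p⟩ := p
  have e : π (i + a) = (k + 1) • π a := by rw [map_add, hi, succ_nsmul]
  obtain ⟨i', hi', p'⟩ := H.equal_step hb p (e ▸ nsmul_succ_notMem hk)
  refine ⟨i', hi'.trans e, ?_⟩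
  rwa [nsmul_succ_union, ← e]

theorem ChainPath.add_two [Finite Z] (H : Bic G u v a b s π) {β : ℤ} (hb : b = a + β • s)
    (h0 : 0 ≤ β) (h1 : β < addOrderOf s) {k : ℕ}
    (p : ChainPath G u v s π (π a) k) (hk : k + 2 < addOrderOf (π a)) :
    ChainPath G u v s π (π a) (k + 2) := by
  obtain ⟨i, hi, p⟩ := p
  have e : π (i + a) = (k + 1) • π a := by rw [map_add, hi, succ_nsmul]
  have e' : π (i + a + a) = (k + 1 + 1) • π a := by rw [map_add, e, succ_nsmul _ (k + 1)]
  have h2 : π (i + a + a) ∉ {c | ∃ j ≤ k, c = j • π a} := by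
    rw [e']
    rintro ⟨j, hj, h⟩
    exact nsmul_ne (by omega) hk h.symm
  have h3 : π (i + a) ≠ π (i + a + a) := by
    rw [e, e']
    exact nsmul_ne (by omega) hk
  obtain ⟨i', hi', p'⟩ := H.parallel_step hb h0 h1 p (e ▸ nsmul_succ_notMem (by omega)) h2 h3
  refine ⟨i', hi'.trans e', ?_⟩
  rwa [nsmul_succ_union, nsmul_succ_union, Set.union_assoc, ← e, ← e', Set.singleton_union]

theorem cyc_of_chainPath [Finite Q] (H : Bic G u v a b s π) (hQ : ∀ c : Q, ∃ k : ℤ, c = k • π a)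
    (p : ChainPath G u v s π (π a) (addOrderOf (π a) - 1)) : Cyc G Set.univ ∅ := by
  obtain ⟨i, hi, p⟩ := p
  rw [nsmul_lt_eq_univ hQ, H.reg_univ] at p
  exact (p.close (H.adjS i)).mono (Set.empty_subset _)

theorem cyc_of_eq [Finite Z] [Finite Q] (H : Bic G u v a b s π) (hb : b = a)
    (hQ : ∀ c : Q, ∃ k : ℤ, c = k • π a) : Cyc G Set.univ ∅ := by
  have : ∀ k < addOrderOf (π a), ChainPath G u v s π (π a) k := by
    intro k
    induction k with
    | zero => exact fun _ => H.chainPath_zero _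
    | succ k ih => exact fun hk => (ih (by omega)).add_one H hb hk
  exact H.cyc_of_chainPath hQ (this _ (Nat.sub_lt (addOrderOf_pos _) one_pos))

theorem cyc_of_parallel [Finite Z] [Finite Q] (H : Bic G u v a b s π) (hab : π b = π a)
    (hQ : ∀ c : Q, ∃ k : ℤ, c = k • π a) (ha : π a ≠ 0) : Cyc G Set.univ ∅ := by
  by_cases hba : b = a
  · exact H.cyc_of_eq hba hQ
  have hn : (0 : ℤ) < addOrderOf s := by exact_mod_cast addOrderOf_pos s
  obtain ⟨β, hβ, h0, h1⟩ : ∃ β : ℤ, b = a + β • s ∧ 1 ≤ β ∧ β < addOrderOf s := by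
    obtain ⟨β, hβ⟩ := H.ker a b hab.symm
    refine ⟨β % addOrderOf s, by rwa [mod_addOrderOf_zsmul], ?_, Int.emod_lt_of_pos _ hn⟩
    have := Int.emod_nonneg β hn.ne'
    by_contra h
    rw [← mod_addOrderOf_zsmul, show β % (addOrderOf s : ℤ) = 0 by omega, zero_smul,
      add_zero] at hβ
    exact hba hβ
  have hq := addOrderOf_pos (π a)
  have hq1 : addOrderOf (π a) ≠ 1 := by rwa [Ne, AddMonoid.addOrderOf_eq_one_iff]
  obtain ⟨r, hr⟩ := Nat.even_or_odd' (addOrderOf (π a))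
  have step : ∀ k₀, ChainPath G u v s π (π a) k₀ → ∀ r, k₀ + 2 * r < addOrderOf (π a) →
      ChainPath G u v s π (π a) (k₀ + 2 * r) := by
    intro k₀ p r
    induction r with
    | zero => exact fun _ => p
    | succ r ih => exact fun h => (ih (by omega)).add_two H hβ (by omega) h1 h
  rcases hr with hr | hr
  · by_cases hr1 : r = 1
    · have h2 : (2 : ℕ) • π a = 0 := by rw [← addOrderOf_nsmul_eq_zero (π a), hr, hr1]
      have hneg : -π a = π a := by rw [neg_eq_iff_add_eq_zero, ← two_nsmul, h2]
      by_cases hb2 : b = -a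
      · exact H.negB.cyc_of_eq (by rw [hb2, neg_neg]) hQ
      · obtain ⟨δ, hδ⟩ := H.ker (-a) b (by rw [map_neg, hneg, hab])
        have := H.two_columns hβ hδ hba hb2 ha
        have huniv : {0, π a} = (Set.univ : Set Q) := by
          rw [← nsmul_lt_eq_univ hQ]
          ext c
          simp only [hr, hr1, Set.mem_insert_iff, Set.mem_singleton_iff, Set.mem_ofPred_eq]
          constructor
          · rintro (rfl | rfl)
            · exact ⟨0, by omega, (zero_smul _ _).symm⟩
            · exact ⟨1, by omega, (one_smul _ _).symm⟩
          · rintro ⟨j, hj, rfl⟩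
            interval_cases j
            · exact Or.inl (zero_smul _ _)
            · exact Or.inr (one_smul _ _)
        rwa [huniv, H.reg_univ] at this
    · have e : ∀ j : ℕ, π (j • a) = j • π a := fun j => map_nsmul π j a
      have p := H.four_columns hβ h0 h1 (i₀ := 0 • a) (i₁ := 1 • a) (i₂ := 2 • a) (i₃ := 3 • a)
        (by module) (by module) (by module)
        (by rw [e, e]; exact nsmul_ne (by omega) (by omega))
        (by rw [e, e]; exact nsmul_ne (by omega) (by omega))
        (by rw [e, e]; exact nsmul_ne (by omega) (by omega))
        (by rw [e, e]; exact nsmul_ne (by omega) (by omega))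
        (by rw [e, e]; exact nsmul_ne (by omega) (by omega))
        (by rw [e, e]; exact nsmul_ne (by omega) (by omega))
      have p3 : ChainPath G u v s π (π a) 3 := by
        refine ⟨3 • a - s, by rw [map_sub, H.map_s, e, sub_zero], ?_⟩
        convert p using 2
        ext c
        simp only [e, Set.mem_insert_iff, Set.mem_singleton_iff, Set.mem_ofPred_eq]
        constructor
        · rintro ⟨j, hj, rfl⟩
          interval_cases j <;> simp
        · rintro (rfl | rfl | rfl | rfl)
          exacts [⟨0, by omega, rfl⟩, ⟨1, by omega, rfl⟩, ⟨2, by omega, rfl⟩, ⟨3, by omega, rfl⟩]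
      apply H.cyc_of_chainPath hQ
      convert step 3 p3 (r - 2) (by omega) using 1
      omega
  · apply H.cyc_of_chainPath hQ
    convert step 0 (H.chainPath_zero _) r (by omega) using 1
    omega

end Bic
end ParallelCycle

section Dominoes

variable {W Z Q : Type*} [AddCommGroup Z] [AddCommGroup Q]

/-- The rungs `u i ~ v i` and `u i ~ v (i+s)` in the columns over `R`, apart from those
indexed by `M`. -/
def rungs (u v : Z → W) (s : Z) (π : Z →+ Q) (R : Set Q) (M : Set (Z × Z)) : Set (Sym2 W) :=
  {e | ∃ i ε, e = s(u i, v (i + ε)) ∧ (ε = 0 ∨ ε = s) ∧ π i ∈ R ∧ (i, ε) ∉ M}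

/-- There is a cycle through the columns over `R` which uses all their rungs, apart from those
indexed by `M`. -/
def RungCyc (G : SimpleGraph W) (u v : Z → W) (s : Z) (π : Z →+ Q) (R : Set Q)
    (M : Set (Z × Z)) : Prop :=
  (∀ x ∈ M, π x.1 ∈ R) ∧ Cyc G (reg u v π R) (rungs u v s π R M)

namespace Bic

variable {G : SimpleGraph W} {u v : Z → W} {a b s : Z} {π : Z →+ Q} {R : Set Q} {M : Set (Z × Z)}

theorem rung_inj (H : Bic G u v a b s π) {i j ε δ : Z} (h : s(u i, v (i + ε)) = s(u j, v (j + δ))) :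
    i = j ∧ ε = δ := by
  rcases Sym2.eq_iff.1 h with ⟨h1, h2⟩ | ⟨h1, h2⟩
  · obtain rfl := H.u_inj h1
    exact ⟨rfl, add_left_cancel (H.v_inj h2)⟩
  · exact absurd h1 (H.u_ne_v _ _)

theorem mem_rungs {i ε : Z} (hε : ε = 0 ∨ ε = s) (h : π i ∈ R) (hM : (i, ε) ∉ M) :
    s(u i, v (i + ε)) ∈ rungs u v s π R M := ⟨i, ε, rfl, hε, h, hM⟩

theorem column (H : Bic G u v a b s π) [Finite Z] (j : Z) {ε : Z} (hε : ε = 0 ∨ ε = s) :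
    Pth G (reg u v π {π j}) (rungs u v s π {π j} {(j, ε)}) (u j) (v (j + ε)) :=
  (H.colPath j hε).mono (by
    rintro e ⟨i, δ, rfl, hδ, hi, hM⟩
    exact ⟨i, δ, rfl, hδ, hi, hM⟩)

theorem rungs_union_subset {R' : Set Q} {M M₁ M₂ : Set (Z × Z)} (h₁ : M₁ ⊆ M) (h₂ : M₂ ⊆ M) :
    rungs u v s π (R ∪ R') M ⊆ rungs u v s π R M₁ ∪ rungs u v s π R' M₂ := by
  rintro e ⟨i, ε, rfl, hε, hi | hi, hM⟩
  · exact Or.inl ⟨i, ε, rfl, hε, hi, fun h => hM (h₁ h)⟩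
  · exact Or.inr ⟨i, ε, rfl, hε, hi, fun h => hM (h₂ h)⟩

theorem rungs_subset_diff (H : Bic G u v a b s π) {M' : Set (Z × Z)} (h : M ⊆ M') {i ε j δ : Z}
    (h₁ : (i, ε) ∈ M') (h₂ : (j, δ) ∈ M') :
    rungs u v s π R M' ⊆ rungs u v s π R M \ {s(u i, v (i + ε)), s(u j, v (j + δ))} := by
  rintro e ⟨k, η, rfl, hη, hk, hM⟩
  refine ⟨⟨k, η, rfl, hη, hk, fun h' => hM (h h')⟩, ?_⟩
  rintro (he | he)
  · obtain ⟨rfl, rfl⟩ := H.rung_inj he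
    exact hM h₁
  · obtain ⟨rfl, rfl⟩ := H.rung_inj he
    exact hM h₂

theorem rungCyc_start [Finite Z] (H : Bic G u v a b s π) (i : Z) :
    RungCyc G u v s π {π i} ∅ := by
  refine ⟨by simp, ((H.colPath_zero i).close ?_).mono ?_⟩
  · exact (H.adj0 i).symm
  · rintro e ⟨j, ε, rfl, hε, hj, -⟩
    by_cases h : (j, ε) = (i, 0)
    · obtain ⟨rfl, rfl⟩ := Prod.mk.inj h
      left
      rw [add_zero]
    · exact Or.inr ⟨j, ε, rfl, hε, hj, h⟩

theorem _root_.RungCyc.mono {M' : Set (Z × Z)} (C : RungCyc G u v s π R M) (h : M ⊆ M')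
    (h' : ∀ x ∈ M', π x.1 ∈ R) : RungCyc G u v s π R M' :=
  ⟨h', C.2.mono (by
    rintro e ⟨i, ε, rfl, hε, hi, hM⟩
    exact ⟨i, ε, rfl, hε, hi, fun hmem => hM (h hmem)⟩)⟩

/-- Insert two columns across the edge `u i ~ u (i + a)`. -/
theorem uDomino [Finite Z] (H : Bic G u v a b s π) (C : RungCyc G u v s π R M) {i i' j j' ε : Z}
    (hi' : i' = i + a) (hj : j = i + b) (hj' : j' = i' + b)
    (hε : ε = 0 ∨ ε = s) (hi0 : (i, ε) ∉ M)
    (hi'0 : (i', 0) ∉ M) (hi's : (i', s) ∉ M) (hiR : π i ∈ R) (hi'R : π i' ∈ R)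
    (hne : π j ≠ π j') (hjR : π j ∉ R) (hj'R : π j' ∉ R) :
    ∃ ε', (ε' = 0 ∨ ε' = s) ∧ RungCyc G u v s π (R ∪ {π j, π j'})
      (M ∪ {(i, ε), (i', ε'), (j, ε), (j', ε')}) := by
  obtain ⟨z', hz', p⟩ := C.2.cut_rotate (H.adjU hi').ne' (H.adjU hi').symm (mem_rungs hε hiR hi0)
    (mem_rungs (Or.inl rfl) hi'R hi'0) (mem_rungs (Or.inr rfl) hi'R hi's)
    (fun h => H.s_ne (add_left_cancel (H.v_inj h)).symm) (H.u_ne_v _ _)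
  obtain ⟨ε', hε', rfl⟩ : ∃ ε', (ε' = 0 ∨ ε' = s) ∧ z' = v (i' + ε') := by
    rcases hz' with rfl | rfl
    exacts [⟨0, Or.inl rfl, rfl⟩, ⟨s, Or.inr rfl, rfl⟩]
  refine ⟨ε', hε', ?_, ?_⟩
  · rintro x (hx | rfl | rfl | rfl | rfl)
    exacts [Or.inl (C.1 _ hx), Or.inl hiR, Or.inl hi'R, Or.inr (Or.inl rfl), Or.inr (Or.inr rfl)]
  have q := (H.column j hε).reverse.append (H.adjU (by rw [hj', hj, hi']; abel)) (H.column j' hε')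
    (H.reg_disjoint (Set.disjoint_singleton.2 hne))
  rw [← reg_union, Set.singleton_union] at q
  have r := p.append (H.adjV (by rw [hj']; abel)) q.reverse (H.reg_disjoint (by
    rw [Set.disjoint_right]
    rintro x (rfl | rfl)
    exacts [hjR, hj'R]))
  rw [← reg_union] at r
  refine (r.close (H.adjV (by rw [hj]; abel)).symm).mono
    ((rungs_union_subset subset_rfl subset_rfl).trans ((Set.union_subset_union ?_ ?_).trans
      (Set.subset_insert _ _)))
  · exact H.rungs_subset_diff Set.subset_union_left (Or.inr (Or.inl rfl))
      (Or.inr (Or.inr (Or.inl rfl)))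
  · rw [← Set.singleton_union]
    refine rungs_union_subset ?_ ?_
    · rw [Set.singleton_subset_iff]
      exact Or.inr (Or.inr (Or.inr (Or.inl rfl)))
    · rw [Set.singleton_subset_iff]
      exact Or.inr (Or.inr (Or.inr (Or.inr rfl)))

/-- Insert three columns at the rung `u i ~ v i`. -/
theorem threeColumns [Finite Z] (H : Bic G u v a b s π) (C : RungCyc G u v s π R M) {i j k l : Z}
    (hj : j = i + a) (hk : k = i + b) (hl : l = j + b) (hi : (i, 0) ∉ M) (hiR : π i ∈ R)
    (hjk : π j ≠ π k) (hjl : π j ≠ π l) (hkl : π k ≠ π l) (hjR : π j ∉ R) (hkR : π k ∉ R)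
    (hlR : π l ∉ R) :
    RungCyc G u v s π (R ∪ {π j, π k, π l}) (M ∪ {(i, 0), (j, 0), (k, 0), (l, 0)}) := by
  constructor
  · rintro x (hx | rfl | rfl | rfl | rfl)
    exacts [Or.inl (C.1 _ hx), Or.inl hiR, Or.inr (Or.inl rfl), Or.inr (Or.inr (Or.inl rfl)),
      Or.inr (Or.inr (Or.inr rfl))]
  have p := C.2.cut (mem_rungs (Or.inl rfl) hiR hi)
  have q := ((H.column j (Or.inl rfl)).append (H.adjV (by rw [hl]; abel))
    (H.column l (Or.inl rfl)).reverse (H.reg_disjoint (Set.disjoint_singleton.2 hjl))).append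
      (H.adjU (by rw [hl, hj, hk]; abel)).symm (H.column k (Or.inl rfl)) ?_
  · have r := p.reverse.append (H.adjU hj) q ?_
    · rw [← reg_union, ← reg_union, ← reg_union] at r
      convert (r.close (H.adjV (by rw [hk]; abel)).symm).mono ?_ using 1
      · congr 1
        ext x
        simp only [Set.mem_union, Set.mem_insert_iff, Set.mem_singleton_iff]
        tauto
      · refine Set.Subset.trans ?_ (Set.subset_insert _ _)
        rintro e ⟨m, ε, rfl, hε, hm, hM⟩
        simp only [Set.mem_union, Set.mem_insert_iff, Set.mem_singleton_iff, not_or] at hM hm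
        obtain ⟨hM, hMi, hMj, hMk, hMl⟩ := hM
        rcases hm with hm | hm | hm | hm
        · refine Or.inl ⟨⟨m, ε, rfl, hε, hm, hM⟩, fun he => hMi ?_⟩
          obtain ⟨rfl, rfl⟩ := H.rung_inj he
          rfl
        · exact Or.inr (Or.inl (Or.inl ⟨m, ε, rfl, hε, hm, hMj⟩))
        · exact Or.inr (Or.inr ⟨m, ε, rfl, hε, hm, hMk⟩)
        · exact Or.inr (Or.inl (Or.inr ⟨m, ε, rfl, hε, hm, hMl⟩))
    · rw [← reg_union, ← reg_union]
      apply H.reg_disjoint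
      rw [Set.disjoint_right]
      rintro x ((rfl | rfl) | rfl)
      exacts [hjR, hlR, hkR]
  · rw [← reg_union]
    apply H.reg_disjoint
    rw [Set.disjoint_left]
    rintro x (rfl | rfl)
    exacts [hjk, hkl.symm]

theorem _root_.RungCyc.swap (C : RungCyc G u v s π R M) (hs : π s = 0) :
    RungCyc G v u (-s) π R {x | (x.1 + x.2, -x.2) ∈ M ∧ (x.2 = 0 ∨ x.2 = -s)} := by
  constructor
  · rintro x ⟨hx, h | h⟩
    · have := C.1 _ hx
      rwa [h, add_zero] at this
    · have := C.1 _ hx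
      rwa [h, map_add, map_neg, hs, neg_zero, add_zero] at this
  have hreg : reg v u π R = reg u v π R := by
    simp only [reg, or_comm]
  rw [hreg]
  refine C.2.mono ?_
  rintro e ⟨i, ε, rfl, hε, hi, hM⟩
  have hπ : π ε = 0 := by rcases hε with rfl | rfl <;> simp [hs]
  refine ⟨i + ε, -ε, by rw [add_neg_cancel_right, Sym2.eq_swap], ?_,
    by rwa [map_add, hπ, add_zero], fun h => hM ⟨h, hε⟩⟩
  rcases hε with rfl | rfl <;> simp

/-- Insert two columns across the edge `v (i + ε) ~ v (i' + ε')`; the rungs at these vertices are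
indexed by the index of their end in the other row. -/
theorem vDomino [Finite Z] (H : Bic G u v a b s π) (C : RungCyc G u v s π R M) {y z δ i j : Z}
    (hz : z = y + b) (hδ : δ = 0 ∨ δ = s) (hiy : i = y - δ) (hj : j = i + a)
    (hy : (i, δ) ∉ M) (hz0 : (z, 0) ∉ M) (hzs : (z - s, s) ∉ M) (hyR : π y ∈ R) (hzR : π z ∈ R)
    (hne : π (y + a) ≠ π (z + a)) (hy'R : π (y + a) ∉ R) (hz'R : π (z + a) ∉ R) :
    ∃ δ', (δ' = 0 ∨ δ' = s) ∧ RungCyc G u v s π (R ∪ {π (y + a), π (z + a)})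
      (M ∪ {(i, δ), (z - δ', δ'), (j, δ), (z + a - δ', δ')}) := by
  obtain ⟨ε', hε', D⟩ := H.swap.uDomino (C.swap H.map_s) (i := y) (i' := z) (j := y + a)
    (j' := z + a) (ε := -δ) hz rfl rfl (by rcases hδ with rfl | rfl <;> simp)
    (by
      rintro ⟨h, -⟩
      simp only [neg_neg, ← sub_eq_add_neg, ← hiy] at h
      exact hy h)
    (by
      rintro ⟨h, -⟩
      simp only [add_zero, neg_zero] at h
      exact hz0 h)
    (by
      rintro ⟨h, -⟩
      simp only [neg_neg, ← sub_eq_add_neg] at h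
      exact hzs h) hyR hzR hne hy'R hz'R
  have hε'' : -ε' = 0 ∨ -ε' = s := by rcases hε' with rfl | rfl <;> simp
  have hπ : ∀ t : Z, t = 0 ∨ t = s → π t = 0 := by
    rintro t (rfl | rfl)
    exacts [_root_.map_zero _, H.map_s]
  refine ⟨-ε', hε'', ?_⟩
  have D' := D.swap (by rw [map_neg, H.map_s, neg_zero])
  rw [neg_neg] at D'
  refine D'.mono ?_ ?_
  · rintro ⟨k, η⟩ ⟨⟨h, -⟩ | h | h | h | h, -⟩
    · left
      simpa using h
    all_goals
      obtain ⟨h1, h2⟩ := Prod.mk.inj h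
      simp only at h1 h2
    · obtain rfl : η = δ := neg_injective h2
      exact Or.inr (Or.inl (by rw [hiy, ← h1]; simp))
    · obtain rfl : η = -ε' := by rw [← h2, neg_neg]
      exact Or.inr (Or.inr (Or.inl (by rw [← h1]; simp)))
    · obtain rfl : η = δ := neg_injective h2
      refine Or.inr (Or.inr (Or.inr (Or.inl ?_)))
      rw [hj, hiy]
      congr 1
      rw [eq_sub_of_add_eq h1]
      abel
    · obtain rfl : η = -ε' := by rw [← h2, neg_neg]
      exact Or.inr (Or.inr (Or.inr (Or.inr (by rw [← h1]; simp))))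
  · rintro x (hx | rfl | rfl | rfl | rfl)
    · exact Or.inl (C.1 _ hx)
    · left
      rwa [hiy, map_sub, hπ _ hδ, sub_zero]
    · left
      rwa [map_sub, hπ _ hε'', sub_zero]
    · right
      left
      simp only
      rw [hj, hiy, map_add, map_add, map_sub, hπ _ hδ, sub_zero]
    · right
      right
      simp only
      rw [map_sub, hπ _ hε'', sub_zero]
      rfl

end Bic
end Dominoes

section Strip

variable {W Z Q : Type*} [AddCommGroup Z] [AddCommGroup Q]

/-- The classes `x • A` and `x • A + B` for `x ≤ k`. -/
def stripSet (A B : Q) (k : ℕ) : Set Q := {c | ∃ x ≤ k, c = x • A ∨ c = x • A + B}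

theorem stripSet_succ (A B : Q) (k : ℕ) :
    stripSet A B (k + 1) = stripSet A B k ∪ {(k + 1) • A + B, (k + 1) • A} := by
  ext c
  simp only [stripSet, Set.mem_ofPred_eq, Set.mem_union, Set.mem_insert_iff,
    Set.mem_singleton_iff]
  constructor
  · rintro ⟨x, hx, h⟩
    rcases Nat.le_succ_iff.1 hx with hx | rfl
    · exact Or.inl ⟨x, hx, h⟩
    · exact Or.inr h.symm
  · rintro (⟨x, hx, h⟩ | h)
    · exact ⟨x, by omega, h⟩
    · exact ⟨k + 1, le_rfl, h.symm⟩

namespace Bic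

variable {G : SimpleGraph W} {u v : Z → W} {a b s : Z} {π : Z →+ Q}

theorem strip [Finite Z] (H : Bic G u v a b s π) {k : ℕ} (hk : 1 ≤ k)
    (h1 : ∀ x ≤ k, ∀ y ≤ k, x • π a = y • π a → x = y)
    (h2 : ∀ x ≤ k, ∀ y ≤ k, x • π a ≠ y • π a + π b) :
    ∃ M ε, (ε = 0 ∨ ε = s) ∧ RungCyc G u v s π (stripSet (π a) (π b) k) M ∧
      (∀ i δ, (i, δ) ∈ M → π i = k • π a → i + δ = k • a + ε) ∧
      (∀ i δ, (i, δ) ∈ M → π i = k • π a + π b → i + δ = k • a + b + ε) ∧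
      ∀ x ≤ k, ∀ i δ, (i, δ) ∈ M → π i = x • π a + π b → i = x • a + b := by
  have hs0 := H.s_ne
  have hπ0 : ∀ x : ℕ, π (x • a) = x • π a := fun x => map_nsmul π x a
  have hπb : ∀ x : ℕ, π (x • a + b) = x • π a + π b := fun x => by rw [map_add, hπ0]
  have h3 : ∀ x ≤ k, ∀ y ≤ k, x • π a + π b = y • π a + π b → x = y := fun x hx y hy h =>
    h1 x hx y hy (add_right_cancel h)
  induction k, hk using Nat.le_induction with
  | base =>
    have e0 : π 0 = 0 • π a := by simp
    have e1 : π a = 1 • π a := by simp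
    have e2 : π b = 0 • π a + π b := by simp
    have e3 : π (a + b) = 1 • π a + π b := by simp
    have C := H.threeColumns (H.rungCyc_start 0) (i := 0) (j := a) (k := b) (l := a + b)
      (by abel) (by abel) rfl (by simp) rfl
      (by rw [e1, e2]; exact h2 1 le_rfl 0 zero_le_one)
      (by rw [e1, e3]; exact h2 1 le_rfl 1 le_rfl)
      (by rw [e2, e3]; exact fun h => absurd (h3 0 zero_le_one 1 le_rfl h) (by omega))
      (fun h => absurd (h1 1 le_rfl 0 zero_le_one (by rw [← e1, ← e0]; exact h)) (by omega))
      (fun h => h2 0 zero_le_one 0 zero_le_one (by rw [← e2, ← e0]; exact h.symm))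
      (fun h => h2 0 zero_le_one 1 le_rfl (by rw [← e3, ← e0]; exact h.symm))
    have hset : ({π 0} ∪ {π a, π b, π (a + b)} : Set Q) = stripSet (π a) (π b) 1 := by
      ext c
      simp only [stripSet, Set.mem_union, Set.mem_insert_iff, Set.mem_singleton_iff,
        Set.mem_ofPred_eq, map_zero, map_add]
      constructor
      · rintro (rfl | rfl | rfl | rfl)
        exacts [⟨0, by omega, by simp⟩, ⟨1, by omega, by simp⟩, ⟨0, by omega, by simp⟩,
          ⟨1, by omega, by simp⟩]
      · rintro ⟨x, hx, h⟩
        interval_cases x <;> rcases h with rfl | rfl <;> simp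
    rw [hset, Set.empty_union] at C
    refine ⟨_, 0, Or.inl rfl, C, ?_, ?_, ?_⟩
    · rintro i δ h hi
      simp only [Set.mem_insert_iff, Set.mem_singleton_iff, Prod.mk.injEq] at h
      rcases h with ⟨rfl, rfl⟩ | ⟨rfl, rfl⟩ | ⟨rfl, rfl⟩ | ⟨rfl, rfl⟩
      · rw [e0] at hi
        exact absurd (h1 0 zero_le_one 1 le_rfl hi) (by omega)
      · simp
      · rw [e2] at hi
        exact absurd hi.symm (h2 1 le_rfl 0 zero_le_one)
      · rw [e3] at hi
        exact absurd hi.symm (h2 1 le_rfl 1 le_rfl)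
    · rintro i δ h hi
      simp only [Set.mem_insert_iff, Set.mem_singleton_iff, Prod.mk.injEq] at h
      rcases h with ⟨rfl, rfl⟩ | ⟨rfl, rfl⟩ | ⟨rfl, rfl⟩ | ⟨rfl, rfl⟩
      · rw [e0] at hi
        exact absurd hi (h2 0 zero_le_one 1 le_rfl)
      · nth_rw 1 [e1] at hi
        exact absurd hi (h2 1 le_rfl 1 le_rfl)
      · nth_rw 1 [e2] at hi
        exact absurd (h3 0 zero_le_one 1 le_rfl hi) (by omega)
      · simp
    · rintro x hx i δ h hi
      simp only [Set.mem_insert_iff, Set.mem_singleton_iff, Prod.mk.injEq] at h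
      rcases h with ⟨rfl, rfl⟩ | ⟨rfl, rfl⟩ | ⟨rfl, rfl⟩ | ⟨rfl, rfl⟩
      · rw [e0] at hi
        exact absurd hi (h2 0 zero_le_one x hx)
      · nth_rw 1 [e1] at hi
        exact absurd hi (h2 1 le_rfl x hx)
      · nth_rw 1 [e2] at hi
        obtain rfl := h3 0 zero_le_one x hx hi
        simp
      · rw [e3] at hi
        obtain rfl := h3 1 le_rfl x hx hi
        simp
  | succ k hk ih =>
    obtain ⟨M, ε, hε, C, hA, hB, hT⟩ := ih (fun x hx y hy => h1 x (by omega) y (by omega))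
      (fun x hx y hy => h2 x (by omega) y (by omega))
      (fun x hx y hy => h3 x (by omega) y (by omega))
    obtain ⟨η, hη, hηε⟩ : ∃ η, (η = 0 ∨ η = s) ∧ η ≠ ε := by
      rcases hε with rfl | rfl
      exacts [⟨s, Or.inr rfl, hs0⟩, ⟨0, Or.inl rfl, hs0.symm⟩]
    have hπ : ∀ t : Z, t = 0 ∨ t = s → π t = 0 := by
      rintro t (rfl | rfl)
      exacts [_root_.map_zero _, H.map_s]
    have ey : π (k • a + b + η) = k • π a + π b := by rw [map_add, hπ _ hη, add_zero, hπb]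
    have ez : π (k • a + η) = k • π a := by rw [map_add, hπ _ hη, add_zero, hπ0]
    have eya : π (k • a + b + η + a) = (k + 1) • π a + π b := by rw [map_add, ey]; module
    have eza : π (k • a + η + a) = (k + 1) • π a := by rw [map_add, ez]; module
    have new1 : (k + 1) • π a + π b ∉ stripSet (π a) (π b) k := by
      rintro ⟨x, hx, h | h⟩
      · exact h2 x (by omega) (k + 1) le_rfl h.symm
      · exact absurd (h3 _ le_rfl x (by omega) h) (by omega)
    have new2 : (k + 1) • π a ∉ stripSet (π a) (π b) k := by
      rintro ⟨x, hx, h | h⟩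
      · exact absurd (h1 _ le_rfl x (by omega) h) (by omega)
      · exact h2 (k + 1) le_rfl x (by omega) h
    obtain ⟨θ, hθ, D⟩ := H.negB.vDomino C (y := k • a + b + η) (z := k • a + η) (δ := η)
      (i := k • a + b) (j := k • a + b + a) (by abel) hη (by abel) rfl
      (fun h => hηε (by simpa using hB _ _ h (hπb k)))
      (fun h => hηε (by simpa using hA _ _ h ez))
      (fun h => hηε (by simpa using hA _ _ h (by rw [map_sub, H.map_s, sub_zero, ez])))
      (by rw [ey]; exact ⟨k, le_rfl, Or.inr rfl⟩) (by rw [ez]; exact ⟨k, le_rfl, Or.inl rfl⟩)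
      (by rw [eya, eza]; exact (h2 _ le_rfl _ le_rfl).symm) (by rwa [eya]) (by rwa [eza])
    rw [eya, eza, ← stripSet_succ] at D
    have e1 : π (k • a + b) = k • π a + π b := hπb k
    have e2 : π (k • a + η - θ) = k • π a := by rw [map_sub, ez, hπ _ hθ, sub_zero]
    have e3 : π (k • a + b + a) = (k + 1) • π a + π b := by rw [map_add, e1]; module
    have e4 : π (k • a + η + a - θ) = (k + 1) • π a := by rw [map_sub, eza, hπ _ hθ, sub_zero]
    refine ⟨_, η, hη, D, ?_, ?_, ?_⟩
    · rintro i δ h hi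
      simp only [Set.mem_union, Set.mem_insert_iff, Set.mem_singleton_iff, Prod.mk.injEq] at h
      rcases h with h | ⟨rfl, rfl⟩ | ⟨rfl, rfl⟩ | ⟨rfl, rfl⟩ | ⟨rfl, rfl⟩
      · exact absurd (hi ▸ C.1 _ h) new2
      · rw [e1] at hi
        exact absurd hi.symm (h2 _ le_rfl _ (by omega))
      · rw [e2] at hi
        exact absurd (h1 _ (by omega) _ le_rfl hi) (by omega)
      · rw [e3] at hi
        exact absurd hi.symm (h2 _ le_rfl _ le_rfl)
      · module
    · rintro i δ h hi
      simp only [Set.mem_union, Set.mem_insert_iff, Set.mem_singleton_iff, Prod.mk.injEq] at h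
      rcases h with h | ⟨rfl, rfl⟩ | ⟨rfl, rfl⟩ | ⟨rfl, rfl⟩ | ⟨rfl, rfl⟩
      · exact absurd (hi ▸ C.1 _ h) new1
      · rw [e1] at hi
        exact absurd (h3 _ (by omega) _ le_rfl hi) (by omega)
      · rw [e2] at hi
        exact absurd hi (h2 _ (by omega) _ le_rfl)
      · module
      · rw [e4] at hi
        exact absurd hi (h2 _ le_rfl _ le_rfl)
    · rintro x hx i δ h hi
      simp only [Set.mem_union, Set.mem_insert_iff, Set.mem_singleton_iff, Prod.mk.injEq] at h
      rcases h with h | ⟨rfl, rfl⟩ | ⟨rfl, rfl⟩ | ⟨rfl, rfl⟩ | ⟨rfl, rfl⟩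
      · rcases Nat.le_succ_iff.1 hx with hx | rfl
        · exact hT x hx i δ h hi
        · exact absurd (hi ▸ C.1 _ h) new1
      · rw [e1] at hi
        obtain rfl := h3 _ (by omega) _ hx hi
        rfl
      · rw [e2] at hi
        exact absurd hi (h2 _ (by omega) _ hx)
      · rw [e3] at hi
        obtain rfl := h3 _ le_rfl _ hx hi
        module
      · rw [e4] at hi
        exact absurd hi (h2 _ le_rfl _ hx)

end Bic
end Strip

section Growth

variable {W Z Q ι : Type*} [AddCommGroup Z] [AddCommGroup Q]

/-- The columns indexed by `I` are covered by a rung cycle such that in each column of the frontier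
`F` only the rungs at one vertex `u t` are possibly unused. -/
def Grown (G : SimpleGraph W) (u v : Z → W) (s : Z) (π : Z →+ Q) (P : ι → Q) (I F : Set ι) : Prop :=
  F ⊆ I ∧ ∃ M, RungCyc G u v s π (P '' I) M ∧
    ∀ c ∈ F, ∃ t, ∀ i ε, π i = P c → (i, ε) ∈ M → i = t

namespace Bic

variable {G : SimpleGraph W} {u v : Z → W} {a b s : Z} {π : Z →+ Q} {P : ι → Q} {D I F : Set ι}

theorem exists_ne_ne (H : Bic G u v a b s π) (i t t' : Z) :
    ∃ j, π j = π i ∧ j ≠ t ∧ j ≠ t' := by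
  have h1 := H.s_ne
  have h2 := H.ss_ne
  have e : ∀ k : ℕ, π (i + k • s) = π i := fun k => by simp [H.map_s]
  have e1 : i + 1 • s ≠ i + 0 • s := by simpa
  have e2 : i + 2 • s ≠ i + 0 • s := by simpa [two_nsmul]
  have e3 : i + 2 • s ≠ i + 1 • s := by simpa [two_nsmul]
  by_contra! h
  have h0 := h _ (e 0)
  have h1 := h _ (e 1)
  have h2 := h _ (e 2)
  grind

theorem _root_.Grown.mono {F' : Set ι} (g : Grown G u v s π P I F) (h : F' ⊆ F) :
    Grown G u v s π P I F' :=
  let ⟨h1, M, C, h2⟩ := g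
  ⟨h.trans h1, M, C, fun c hc => h2 c (h hc)⟩

theorem grown_extend (hP : Set.InjOn P D) {N F' : Set ι} {M L : Set (Z × Z)} (hI : I ⊆ D)
    (hFI : F ⊆ I)
    (hM : ∀ x ∈ M, π x.1 ∈ P '' I) (hF : ∀ c ∈ F, ∃ t, ∀ i ε, π i = P c → (i, ε) ∈ M → i = t)
    (hND : N ⊆ D) (hNI : ∀ c ∈ N, c ∉ I)
    (hF' : ∀ c ∈ F', (c ∈ F ∧ ∀ x ∈ L, π x.1 ≠ P c) ∨
      (c ∈ N ∧ ∃ t, ∀ i ε, π i = P c → (i, ε) ∈ L → i = t))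
    (C : RungCyc G u v s π (P '' I ∪ P '' N) (M ∪ L)) : Grown G u v s π P (I ∪ N) F' := by
  refine ⟨?_, M ∪ L, by rwa [Set.image_union], ?_⟩
  · intro c hc
    rcases hF' c hc with ⟨h, -⟩ | ⟨h, -⟩
    exacts [Or.inl (hFI h), Or.inr h]
  · intro c hc
    rcases hF' c hc with ⟨h, hL⟩ | ⟨h, t, hL⟩
    · obtain ⟨t, ht⟩ := hF c h
      refine ⟨t, fun i ε hi hx => ?_⟩
      rcases hx with hx | hx
      · exact ht i ε hi hx
      · exact absurd hi (hL _ hx)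
    · refine ⟨t, fun i ε hi hx => ?_⟩
      rcases hx with hx | hx
      · obtain ⟨d, hd, hdi⟩ := hM _ hx
        have : d = c := hP (hI hd) (hND h) (by rw [hdi, ← hi])
        exact absurd (this ▸ hd) (hNI c h)
      · exact hL i ε hi hx

theorem grown_domino [Finite Z] (H : Bic G u v a b s π) (hπ : Function.Surjective π)
    (hP : Set.InjOn P D) (hI : I ⊆ D) (g : Grown G u v s π P I F) (i i' j j' : ι)
    (hi : i ∈ F) (hi' : i' ∈ F) (hjD : j ∈ D) (hj'D : j' ∈ D) (hjI : j ∉ I)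
    (hj'I : j' ∉ I) (hjj' : j ≠ j') (e1 : P i' = P i + π a) (e2 : P j = P i + π b)
    (e3 : P j' = P i' + π b) :
    Grown G u v s π P (I ∪ {j, j'}) ((F \ {i, i'}) ∪ {j, j'}) := by
  obtain ⟨hFI, M, C, hF⟩ := g
  obtain ⟨t, ht⟩ := hF i hi
  obtain ⟨t', ht'⟩ := hF i' hi'
  obtain ⟨x₀, hx₀⟩ := hπ (P i)
  obtain ⟨x, hx, hxt, hxt'⟩ := H.exists_ne_ne x₀ t (t' - a)
  rw [hx₀] at hx
  have hx' : π (x + a) = P i' := by rw [map_add, hx, e1]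
  have hy : π (x + b) = P j := by rw [map_add, hx, e2]
  have hy' : π (x + a + b) = P j' := by rw [map_add, hx', e3]
  have hxt'' : x + a ≠ t' := fun h => hxt' (eq_sub_of_add_eq h)
  have hN : ∀ c ∈ ({j, j'} : Set ι), c ∈ D ∧ c ∉ I := by
    rintro c (rfl | rfl)
    exacts [⟨hjD, hjI⟩, ⟨hj'D, hj'I⟩]
  have hnot : ∀ c ∈ D, c ∉ I → P c ∉ P '' I := by
    rintro c hc hcI ⟨d, hd, h⟩
    exact hcI (hP (hI hd) hc h ▸ hd)
  obtain ⟨ε, hε, C'⟩ := H.uDomino C (i := x) (ε := 0) rfl rfl rfl (Or.inl rfl)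
    (fun h => hxt (ht _ _ hx h)) (fun h => hxt'' (ht' _ _ hx' h)) (fun h => hxt'' (ht' _ _ hx' h))
    (by rw [hx]; exact ⟨i, hFI hi, rfl⟩) (by rw [hx']; exact ⟨i', hFI hi', rfl⟩)
    (by rw [hy, hy']; exact fun h => hjj' (hP hjD hj'D h)) (by rw [hy]; exact hnot j hjD hjI)
    (by rw [hy']; exact hnot j' hj'D hj'I)
  have hinj : ∀ {c d}, c ∈ D → d ∈ D → c ≠ d → P c ≠ P d := fun hc hd h e => h (hP hc hd e)
  refine grown_extend hP hI hFI C.1 hF (N := {j, j'}) (fun c hc => (hN c hc).1)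
    (fun c hc => (hN c hc).2) ?_ (by rw [Set.image_pair, ← hy, ← hy']; exact C')
  rintro c (⟨hc, hc'⟩ | rfl | rfl)
  · refine Or.inl ⟨hc, ?_⟩
    simp only [Set.mem_insert_iff, Set.mem_singleton_iff, not_or] at hc'
    have hcI := hFI hc
    rintro y (rfl | rfl | rfl | rfl) h
    · exact hinj (hI (hFI hi)) (hI hcI) (Ne.symm hc'.1) (hx.symm.trans h)
    · exact hinj (hI (hFI hi')) (hI hcI) (Ne.symm hc'.2) (hx'.symm.trans h)
    · exact hinj hjD (hI hcI) (fun e => hjI (e ▸ hcI)) (hy.symm.trans h)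
    · exact hinj hj'D (hI hcI) (fun e => hj'I (e ▸ hcI)) (hy'.symm.trans h)
  · refine Or.inr ⟨Or.inl rfl, x + b, fun y δ hyc h => ?_⟩
    rcases h with h | h | h | h <;> obtain ⟨rfl, rfl⟩ := Prod.mk.inj h
    · exact absurd (hx.symm.trans hyc) (hinj (hI (hFI hi)) hjD fun e => hjI (e ▸ hFI hi))
    · exact absurd (hx'.symm.trans hyc) (hinj (hI (hFI hi')) hjD fun e => hjI (e ▸ hFI hi'))
    · rfl
    · exact absurd (hy'.symm.trans hyc) (hinj hj'D hjD hjj'.symm)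
  · refine Or.inr ⟨Or.inr rfl, x + a + b, fun y δ hyc h => ?_⟩
    rcases h with h | h | h | h <;> obtain ⟨rfl, rfl⟩ := Prod.mk.inj h
    · exact absurd (hx.symm.trans hyc) (hinj (hI (hFI hi)) hj'D fun e => hj'I (e ▸ hFI hi))
    · exact absurd (hx'.symm.trans hyc) (hinj (hI (hFI hi')) hj'D fun e => hj'I (e ▸ hFI hi'))
    · exact absurd (hy.symm.trans hyc) (hinj hjD hj'D hjj')
    · rfl

theorem grown_three [Finite Z] (H : Bic G u v a b s π) (hπ : Function.Surjective π)
    (hP : Set.InjOn P D) (hI : I ⊆ D) (g : Grown G u v s π P I F) (i j k l : ι)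
    (hi : i ∈ F) (hjD : j ∈ D) (hkD : k ∈ D) (hlD : l ∈ D) (hjI : j ∉ I) (hkI : k ∉ I)
    (hlI : l ∉ I) (hjk : j ≠ k) (hjl : j ≠ l) (hkl : k ≠ l)
    (e1 : P j = P i + π a) (e2 : P k = P i + π b) (e3 : P l = P j + π b) :
    Grown G u v s π P (I ∪ {j, k, l}) ((F \ {i}) ∪ {j, k, l}) := by
  obtain ⟨hFI, M, C, hF⟩ := g
  obtain ⟨t, ht⟩ := hF i hi
  obtain ⟨x₀, hx₀⟩ := hπ (P i)
  obtain ⟨x, hx, hxt, -⟩ := H.exists_ne_ne x₀ t t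
  rw [hx₀] at hx
  have hj : π (x + a) = P j := by rw [map_add, hx, e1]
  have hk : π (x + b) = P k := by rw [map_add, hx, e2]
  have hl : π (x + a + b) = P l := by rw [map_add, hj, e3]
  have hN : ∀ c ∈ ({j, k, l} : Set ι), c ∈ D ∧ c ∉ I := by
    rintro c (rfl | rfl | rfl)
    exacts [⟨hjD, hjI⟩, ⟨hkD, hkI⟩, ⟨hlD, hlI⟩]
  have hnot : ∀ c ∈ D, c ∉ I → P c ∉ P '' I := by
    rintro c hc hcI ⟨d, hd, h⟩
    exact hcI (hP (hI hd) hc h ▸ hd)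
  have hinj : ∀ {c d}, c ∈ D → d ∈ D → c ≠ d → P c ≠ P d := fun hc hd h e => h (hP hc hd e)
  have C' := H.threeColumns C (i := x) rfl rfl rfl (fun h => hxt (ht _ _ hx h))
    (by rw [hx]; exact ⟨i, hFI hi, rfl⟩)
    (by rw [hj, hk]; exact hinj hjD hkD hjk) (by rw [hj, hl]; exact hinj hjD hlD hjl)
    (by rw [hk, hl]; exact hinj hkD hlD hkl) (by rw [hj]; exact hnot j hjD hjI)
    (by rw [hk]; exact hnot k hkD hkI) (by rw [hl]; exact hnot l hlD hlI)
  refine grown_extend hP hI hFI C.1 hF (N := {j, k, l}) (fun c hc => (hN c hc).1)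
    (fun c hc => (hN c hc).2) ?_
    (by rw [Set.image_insert_eq, Set.image_pair, ← hj, ← hk, ← hl]; exact C')
  have hiI := hFI hi
  have hDi := hI hiI
  rintro c (⟨hc, hc'⟩ | hc)
  · refine Or.inl ⟨hc, ?_⟩
    have hcI := hFI hc
    rintro y (rfl | rfl | rfl | rfl) h
    · exact hinj hDi (hI hcI) (Ne.symm hc') (hx.symm.trans h)
    · exact hinj hjD (hI hcI) (fun e => hjI (e ▸ hcI)) (hj.symm.trans h)
    · exact hinj hkD (hI hcI) (fun e => hkI (e ▸ hcI)) (hk.symm.trans h)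
    · exact hinj hlD (hI hcI) (fun e => hlI (e ▸ hcI)) (hl.symm.trans h)
  · refine Or.inr ⟨hc, ?_⟩
    rcases hc with rfl | rfl | rfl
    · refine ⟨x + a, fun y δ hyc h => ?_⟩
      rcases h with h | h | h | h <;> obtain ⟨rfl, rfl⟩ := Prod.mk.inj h
      · exact absurd (hx.symm.trans hyc) (hinj hDi hjD fun e => hjI (e ▸ hiI))
      · rfl
      · exact absurd (hk.symm.trans hyc) (hinj hkD hjD hjk.symm)
      · exact absurd (hl.symm.trans hyc) (hinj hlD hjD hjl.symm)
    · refine ⟨x + b, fun y δ hyc h => ?_⟩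
      rcases h with h | h | h | h <;> obtain ⟨rfl, rfl⟩ := Prod.mk.inj h
      · exact absurd (hx.symm.trans hyc) (hinj hDi hkD fun e => hkI (e ▸ hiI))
      · exact absurd (hj.symm.trans hyc) (hinj hjD hkD hjk)
      · rfl
      · exact absurd (hl.symm.trans hyc) (hinj hlD hkD hkl.symm)
    · refine ⟨x + a + b, fun y δ hyc h => ?_⟩
      rcases h with h | h | h | h <;> obtain ⟨rfl, rfl⟩ := Prod.mk.inj h
      · exact absurd (hx.symm.trans hyc) (hinj hDi hlD fun e => hlI (e ▸ hiI))
      · exact absurd (hj.symm.trans hyc) (hinj hjD hlD hjl)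
      · exact absurd (hk.symm.trans hyc) (hinj hkD hlD hkl)
      · rfl

theorem grown_strip [Finite Z] (H : Bic G u v a b s π) {k : ℕ} (hk : 1 ≤ k)
    (h1 : ∀ x ≤ k, ∀ y ≤ k, x • π a = y • π a → x = y)
    (h2 : ∀ x ≤ k, ∀ y ≤ k, x • π a ≠ y • π a + π b) (hFI : F ⊆ I)
    (hI : P '' I = stripSet (π a) (π b) k) (hF : ∀ c ∈ F, ∃ x ≤ k, P c = x • π a + π b) :
    Grown G u v s π P I F := by
  obtain ⟨M, -, -, C, -, -, hT⟩ := H.strip hk h1 h2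
  refine ⟨hFI, M, hI ▸ C, fun c hc => ?_⟩
  obtain ⟨x, hx, hcx⟩ := hF c hc
  exact ⟨x • a + b, fun i ε hi hM => hT x hx i ε hM (hi.trans hcx)⟩

theorem cyc_of_grown (H : Bic G u v a b s π) (g : Grown G u v s π P I F) (h : P '' I = Set.univ) :
    Cyc G Set.univ ∅ := by
  obtain ⟨-, M, C, -⟩ := g
  have := C.2
  rw [h, H.reg_univ] at this
  exact this.mono (Set.empty_subset _)

/-- Dominoes complete the graph when the columns are enumerated by an interval of naturals and the
frontier consists of the last `x` columns. -/
theorem grown_range [Finite Z] (H : Bic G u v a b s π) (hπ : Function.Surjective π) {P : ℕ → Q}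
    {q x N : ℕ} (hP : Set.InjOn P (Set.Iio q)) (hx : 2 ≤ x) (hxN : x ≤ N)
    (g : Grown G u v s π P (Set.Iio N) (Set.Ico (N - x) N))
    (hA : ∀ c, N ≤ c + x → (c + x - N) % 2 = 0 → c + x + 2 ≤ q → P (c + 1) = P c + π a)
    (hB : ∀ c, N ≤ c + x → c + x + 1 ≤ q → P (c + x) = P c + π b) (r : ℕ) (hr : N + 2 * r ≤ q) :
    Grown G u v s π P (Set.Iio (N + 2 * r)) (Set.Ico (N + 2 * r - x) (N + 2 * r)) := by
  induction r with
  | zero => exact g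
  | succ r ih =>
    have ih := ih (by omega)
    obtain ⟨c, hc⟩ : ∃ c, c + x = N + 2 * r := ⟨N + 2 * r - x, by omega⟩
    have := H.grown_domino hπ hP (fun t ht => by simp only [Set.mem_Iio] at ht ⊢; omega) ih
      c (c + 1) (c + x) (c + x + 1) (by simp only [Set.mem_Ico]; omega)
      (by simp only [Set.mem_Ico]; omega) (by simp only [Set.mem_Iio]; omega)
      (by simp only [Set.mem_Iio]; omega) (by simp only [Set.mem_Iio]; omega)
      (by simp only [Set.mem_Iio]; omega) (by omega) (hA c (by omega) (by omega) (by omega))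
      (hB c (by omega) (by omega))
      (by rw [← hB (c + 1) (by omega) (by omega)]; congr 1; omega)
    convert this.mono (F' := Set.Ico (N + 2 * (r + 1) - x) (N + 2 * (r + 1))) ?_ using 1
    · ext t
      simp only [Set.mem_Iio, Set.mem_union, Set.mem_insert_iff, Set.mem_singleton_iff]
      omega
    · intro t
      simp only [Set.mem_Ico, Set.mem_union, Set.mem_sdiff, Set.mem_insert_iff,
        Set.mem_singleton_iff]
      omega

end Bic
end Growth

section Multiple

variable {W Z Q : Type*} [AddCommGroup Z] [AddCommGroup Q]

namespace Bic

variable {G : SimpleGraph W} {u v : Z → W} {a b s : Z} {π : Z →+ Q}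

theorem cyc_of_nsmul_of_even_or [Finite Z] [Finite Q] (H : Bic G u v a b s π)
    (hπ : Function.Surjective π) (hQ : ∀ c : Q, ∃ k : ℤ, c = k • π a) {κ : ℕ}
    (hb : π b = κ • π a) (h2 : 2 ≤ κ) (hq : 2 * κ ≤ addOrderOf (π a))
    (h : Even (addOrderOf (π a)) ∨ 3 ≤ κ) : Cyc G Set.univ ∅ := by
  obtain ⟨q, hqdef⟩ : ∃ q, q = addOrderOf (π a) := ⟨_, rfl⟩
  rw [← hqdef] at hq h
  obtain ⟨P, hPdef⟩ : ∃ P : ℕ → Q, P = fun c : ℕ => c • π a := ⟨_, rfl⟩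
  have hPc : ∀ c : ℕ, c • π a = P c := fun c => by rw [hPdef]
  have hP : Set.InjOn P (Set.Iio q) := by
    rw [hPdef, hqdef]
    exact nsmul_injOn_Iio_addOrderOf
  have hA : ∀ c, P (c + 1) = P c + π a := fun c => by rw [hPdef]; exact succ_nsmul _ _
  have hB : ∀ c, P (c + κ) = P c + π b := fun c => by
    rw [hPdef, hb]
    exact add_nsmul _ _ _
  have huniv : P '' Set.Iio q = Set.univ := by
    rw [← nsmul_lt_eq_univ hQ, ← hqdef]
    have := addOrderOf_pos (π a)
    ext c
    simp only [Set.mem_image, Set.mem_Iio, Set.mem_ofPred_eq, hPc]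
    constructor
    · rintro ⟨j, hj, rfl⟩
      exact ⟨j, by omega, rfl⟩
    · rintro ⟨j, hj, rfl⟩
      exact ⟨j, by omega, rfl⟩
  have hinj : ∀ {x y}, x < q → y < q → P x = P y → x = y := fun hx hy h => hP hx hy h
  have hstrip : ∀ k, 1 ≤ k → k + 1 ≤ κ → Grown G u v s π P {c | c ≤ k ∨ κ ≤ c ∧ c ≤ κ + k}
      (Set.Icc κ (κ + k)) := by
    intro k hk hkκ
    refine H.grown_strip hk ?_ ?_ ?_ ?_ ?_
    · intro x hx y hy h
      rw [hPc, hPc] at h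
      exact hinj (by omega) (by omega) h
    · intro x hx y hy h
      rw [hPc, hPc, ← hB] at h
      have := hinj (by omega) (by omega) h
      omega
    · intro c hc
      exact Or.inr hc
    · ext c
      simp only [stripSet, Set.mem_image, Set.mem_ofPred_eq, hPc, ← hB]
      constructor
      · rintro ⟨x, hx | hx, rfl⟩
        · exact ⟨x, hx, Or.inl rfl⟩
        · refine ⟨x - κ, by omega, Or.inr ?_⟩
          congr 1
          omega
      · rintro ⟨x, hx, rfl | rfl⟩
        · exact ⟨x, Or.inl hx, rfl⟩
        · exact ⟨x + κ, Or.inr (by omega), rfl⟩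
    · rintro c ⟨hc1, hc2⟩
      refine ⟨c - κ, by omega, ?_⟩
      rw [hPc, ← hB]
      congr 1
      omega
  have finish : ∀ N, κ ≤ N → N ≤ q → (q - N) % 2 = 0 →
      Grown G u v s π P (Set.Iio N) (Set.Ico (N - κ) N) → Cyc G Set.univ ∅ := by
    intro N hN hNq hpar g
    have := H.grown_range hπ hP h2 hN g (fun c _ _ _ => hA c) (fun c _ _ => hB c) ((q - N) / 2)
      (by omega)
    rw [show N + 2 * ((q - N) / 2) = q by omega] at this
    exact H.cyc_of_grown this huniv
  rcases Nat.even_or_odd' q with ⟨r, hr | hr⟩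
  · apply finish (2 * κ) (by omega) (by omega) (by omega)
    convert hstrip (κ - 1) (by omega) (by omega) using 1
    · ext c
      simp only [Set.mem_Iio, Set.mem_ofPred_eq]
      omega
    · ext c
      simp only [Set.mem_Ico, Set.mem_Icc]
      omega
  · have hκ : 3 ≤ κ := h.resolve_left (by rw [hr]; simp)
    apply finish (2 * κ + 1) (by omega) (by omega) (by omega)
    have := H.negA.grown_three hπ hP
      (by intro c; simp only [Set.mem_ofPred_eq, Set.mem_Iio]; omega)
      ((hstrip (κ - 2) (by omega) (by omega))) κ (κ - 1) (2 * κ)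
      (2 * κ - 1) (by simp only [Set.mem_Icc]; omega)
      (by simp only [Set.mem_Iio]; omega) (by simp only [Set.mem_Iio]; omega)
      (by simp only [Set.mem_Iio]; omega) (by simp only [Set.mem_ofPred_eq]; omega)
      (by simp only [Set.mem_ofPred_eq]; omega) (by simp only [Set.mem_ofPred_eq]; omega)
      (by omega) (by omega) (by omega)
      (by
        have := hA (κ - 1)
        rw [Nat.sub_add_cancel (by omega)] at this
        rw [this, map_neg, add_neg_cancel_right])
      (by rw [← hB]; congr 1; omega) (by rw [← hB]; congr 1; omega)
    convert this.mono (F' := Set.Ico (κ + 1) (2 * κ + 1)) ?_ using 1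
    · ext c
      simp only [Set.mem_Iio, Set.mem_union, Set.mem_ofPred_eq, Set.mem_insert_iff,
        Set.mem_singleton_iff]
      omega
    · congr 1
      omega
    · intro c
      simp only [Set.mem_Ico, Set.mem_union, Set.mem_sdiff, Set.mem_Icc, Set.mem_insert_iff,
        Set.mem_singleton_iff]
      omega

end Bic
end Multiple

section FiveColumns

variable {W Z Q : Type*} [AddCommGroup Z] [AddCommGroup Q]

namespace Bic

variable {G : SimpleGraph W} {u v : Z → W} {a b s : Z} {π : Z →+ Q}

theorem five_columns [Finite Z] (H : Bic G u v a b s π) {w : ℤ} (hw : w • s = a + a + s - b)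
    (h0 : 1 ≤ w) (h1 : w ≤ addOrderOf s) {c d e : Z} (hc : c = a + b) (hd : d = c + a)
    (he : e = 0) (n1 : π e ≠ π a) (n2 : π e ≠ π b) (n3 : π e ≠ π c) (n4 : π e ≠ π d)
    (n5 : π a ≠ π b) (n6 : π a ≠ π c) (n7 : π a ≠ π d) (n8 : π b ≠ π c) (n9 : π b ≠ π d)
    (n10 : π c ≠ π d) : Cyc G (reg u v π {π e, π a, π b, π c, π d}) ∅ := by
  have hns := zsmul_order s
  have hn2 : 1 < addOrderOf s := by
    have := addOrderOf_pos s
    have : addOrderOf s ≠ 1 := by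
      rw [Ne, AddMonoid.addOrderOf_eq_one_iff]
      exact H.s_ne
    omega
  have A := H.arc_eq d (lo := 3) (hi := 2 * addOrderOf s + 2) (by omega) (by omega)
    (col_odd 1 (by ring)) (col_even (addOrderOf s + 1) (by ring))
  have B := H.arc_eq b (lo := 2 * w) (hi := 2 * addOrderOf s) (by omega) (by omega)
    (col_even w rfl) (col_even _ rfl)
  have C := H.arc_eq e (lo := 1) (hi := 2 * addOrderOf s) (by omega) (by omega)
    (col_odd 0 (by ring)) (col_even _ rfl)
  have D := H.arc_eq a (lo := 1) (hi := 1) (by omega) (by omega)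
    (col_odd 0 (by ring)) (col_odd 0 (by ring))
  have E := H.arc_eq b (lo := 1) (hi := 2 * w - 1) (by omega) (by omega)
    (col_odd 0 (by ring)) (col_odd (w - 1) (by ring))
  have F := H.arc_eq c (lo := 1) (hi := 2) (by omega) (by omega)
    (col_odd 0 (by ring)) (col_even 1 (by ring))
  have K := H.arc_eq a (lo := 1 + 1) (hi := 2 * addOrderOf s) (by omega) (by omega)
    (col_even 1 (by ring)) (col_even _ rfl)
  have L := H.arc_eq c (lo := 2 + 1) (hi := 2 * addOrderOf s) (by omega) (by omega)
    (col_odd 1 (by ring)) (col_even _ rfl)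
  have X := (((((((A.append (H.adjV ?_).symm B ?_).append (H.adjV ?_).symm C.reverse ?_).append
    (H.adjU ?_) D ?_).append (H.adjU ?_) E.reverse ?_).append (H.adjU ?_) F ?_).append
    (H.adjV ?_).symm K ?_).append (H.adjV ?_) L.reverse ?_).close (H.adjU ?_)
  · convert X.mono (Set.empty_subset _) using 1
    rw [Set.insert_eq, reg_union, Set.insert_eq, reg_union, Set.insert_eq, reg_union,
        Set.insert_eq, reg_union,
        ← H.arc_full e (lo := 1) (hi := 2 * addOrderOf s) (by ring),
        ← H.arc_full a (lo := 1) (hi := 2 * addOrderOf s) (by ring),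
        ← H.arc_full b (lo := 1) (hi := 2 * addOrderOf s) (by ring),
        ← H.arc_full c (lo := 1) (hi := 2 * addOrderOf s) (by ring),
        ← H.arc_full d (lo := 3) (hi := 2 * addOrderOf s + 2) (by ring),
        ← arc_union (i := b) (l := 1) (m := 2 * w - 1) (h := 2 * addOrderOf s) (by omega)
          (by omega), sub_add_cancel,
        ← arc_union (i := a) (l := 1) (m := 1) (h := 2 * addOrderOf s) (by omega) (by omega),
        ← arc_union (i := c) (l := 1) (m := 2) (h := 2 * addOrderOf s) (by omega)
          (by omega)]
    ac_rfl
  all_goals first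
    | simp only [hc, hd, he, sub_smul, add_smul, hns, hw, one_smul, zero_smul]
      abel1
    | try simp only [Set.disjoint_union_left]
      repeat' apply And.intro
      all_goals first
        | exact H.arc_disjoint _ (by omega) (by omega)
        | exact (H.arc_disjoint _ (by omega) (by omega)).symm
        | exact H.arc_disjoint_of_ne (by assumption) _ _
        | exact (H.arc_disjoint_of_ne (by assumption) _ _).symm

theorem cyc_of_nsmul [Finite Z] [Finite Q] (H : Bic G u v a b s π)
    (hπ : Function.Surjective π) (hQ : ∀ c : Q, ∃ k : ℤ, c = k • π a) {κ : ℕ}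
    (hb : π b = κ • π a) (h2 : 2 ≤ κ) (hq : 2 * κ ≤ addOrderOf (π a)) : Cyc G Set.univ ∅ := by
  obtain ⟨r, hr⟩ := Nat.even_or_odd' (addOrderOf (π a))
  by_cases h : Even (addOrderOf (π a)) ∨ 3 ≤ κ
  · exact H.cyc_of_nsmul_of_even_or hπ hQ hb h2 hq h
  rw [not_or] at h
  obtain rfl : κ = 2 := by omega
  replace hr := hr.resolve_left (fun e => h.1 (e ▸ even_two_mul r))
  have hq0 : (2 * r + 1) • π a = 0 := by rw [← hr, addOrderOf_nsmul_eq_zero]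
  by_cases h5 : r = 2
  · subst h5
    have e : ∀ j : ℕ, π (j • a) = j • π a := fun j => map_nsmul π j a
    have ne : ∀ {j k : ℕ}, j < k → k < 5 → j • π a ≠ k • π a := fun h h' =>
      nsmul_ne h (by omega)
    have e0 : π 0 = 0 • π a := by simp
    have nea : ∀ {k : ℕ}, 1 < k → k < 5 → π a ≠ k • π a := fun h h' => by
      have := ne h h'
      rwa [one_smul] at this
    have e3 : π (a + b) = 3 • π a := by rw [map_add, hb]; module
    have e4 : π (a + b + a) = 4 • π a := by rw [map_add, e3]; module
    obtain ⟨β, hβ⟩ := H.ker b (a + a) (by rw [hb, map_add, two_nsmul])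
    have hn : (0 : ℤ) < addOrderOf s := by exact_mod_cast addOrderOf_pos s
    have := H.five_columns (w := β % addOrderOf s + 1)
      (by rw [add_smul, mod_addOrderOf_zsmul, hβ]; module)
      (by linarith [Int.emod_nonneg β hn.ne'])
      (by linarith [Int.add_one_le_of_lt (Int.emod_lt_of_pos β hn)]) rfl rfl rfl
      (by rw [_root_.map_zero]; exact fun h => ne (j := 0) (k := 1) (by omega) (by omega) (by simpa using h))
      (by rw [e0, hb]; exact ne (by omega) (by omega))
      (by rw [e0, e3]; exact ne (by omega) (by omega))
      (by rw [e0, e4]; exact ne (by omega) (by omega))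
      (by rw [hb]; exact nea (by omega) (by omega))
      (by rw [e3]; exact nea (by omega) (by omega))
      (by rw [e4]; exact nea (by omega) (by omega))
      (by rw [hb, e3]; exact ne (by omega) (by omega))
      (by rw [hb, e4]; exact ne (by omega) (by omega))
      (by rw [e3, e4]; exact ne (by omega) (by omega))
    have huniv : {π 0, π a, π b, π (a + b), π (a + b + a)} = (Set.univ : Set Q) := by
      rw [← nsmul_lt_eq_univ hQ, e0, hb, e3, e4, hr]
      ext c
      simp only [Set.mem_insert_iff, Set.mem_singleton_iff, Set.mem_ofPred_eq]
      constructor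
      · rintro (rfl | rfl | rfl | rfl | rfl)
        exacts [⟨0, by omega, rfl⟩, ⟨1, by omega, by simp⟩, ⟨2, by omega, rfl⟩,
          ⟨3, by omega, rfl⟩, ⟨4, by omega, rfl⟩]
      · rintro ⟨j, hj, rfl⟩
        have : j ≤ 4 := by omega
        interval_cases j <;> simp
    rwa [huniv, H.reg_univ] at this
  · refine H.swap.negB.cyc_of_nsmul_of_even_or hπ ?_ (κ := r) ?_ (by omega) ?_ (Or.inr (by omega))
    · intro c
      obtain ⟨k, rfl⟩ := hQ c
      refine ⟨k * (r + 1), ?_⟩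
      calc k • π a = k • π a + k • ((2 * r + 1) • π a) := by rw [hq0, smul_zero, add_zero]
        _ = _ := by rw [hb]; module
    · rw [map_neg, neg_eq_iff_add_eq_zero, hb, ← hq0]
      module
    · have : addOrderOf (π b) = addOrderOf (π a) := by
        rw [hb, addOrderOf_nsmul, hr]
        simp
      omega

end Bic
end FiveColumns

section Blocks

variable {W Z Q ι : Type*} [AddCommGroup Z] [AddCommGroup Q]

theorem Set.not_mem_union_quadruple {α : Type*} {M : Set α} {x x₁ x₂ x₃ x₄ : α} (h : x ∉ M)
    (h₁ : x ≠ x₁) (h₂ : x ≠ x₂) (h₃ : x ≠ x₃) (h₄ : x ≠ x₄) : x ∉ M ∪ {x₁, x₂, x₃, x₄} := by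
  rintro (h | h | h | h | h)
  exacts [‹x ∉ M› h, h₁ h, h₂ h, h₃ h, h₄ h]

namespace Bic

variable {G : SimpleGraph W} {u v : Z → W} {a b s : Z} {π : Z →+ Q} {P : ι → Q} {D I F : Set ι}
  {R : Set Q} {M : Set (Z × Z)}

theorem map_of_rung (H : Bic G u v a b s π) {t : Z} (ht : t = 0 ∨ t = s) : π t = 0 := by
  rcases ht with rfl | rfl
  exacts [_root_.map_zero _, H.map_s]

theorem rung_ne {i j δ ε : Z} {c d : Q} (h : c ≠ d) (hi : π i = c) (hj : π j = d) :
    (i, δ) ≠ (j, ε) := by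
  rintro ⟨⟩
  exact h (hi.symm.trans hj)

theorem block [Finite Z] (H : Bic G u v a b s π) (C : RungCyc G u v s π R M) {x x' y y' w w' : Z}
    {p₁ p₂ n₀ n₁ n₂ m₀ m₁ m₂ : Q} (hx' : x' = x + a) (hy : y = x + b) (hy' : y' = x' + b)
    (hw : w = y + s + b) (hw' : w' = y' + s + b)
    (px : π x = p₁) (px' : π x' = p₂) (py : π y = n₁) (py' : π y' = n₂) (pw : π w = m₁)
    (pw' : π w' = m₂) (pn₀ : n₁ + -π a = n₀) (pm₀ : m₁ + -π a = m₀)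
    (h1 : p₁ ∈ R) (h2 : p₂ ∈ R) (h3 : n₀ ∉ R) (h4 : n₁ ∉ R) (h5 : n₂ ∉ R) (h6 : m₀ ∉ R)
    (h7 : m₁ ∉ R) (h8 : m₂ ∉ R) (hnd : [n₀, n₁, n₂, m₀, m₁, m₂].Nodup)
    (k1 : (x, s) ∉ M) (k2 : (x', 0) ∉ M) (k3 : (x', s) ∉ M) :
    ∃ ε₁ ε₂ δ, (δ = 0 ∨ δ = s) ∧
      RungCyc G u v s π (R ∪ {n₁, n₂} ∪ {m₁, m₂} ∪ {m₀, n₀})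
        (M ∪ {(x, s), (x', ε₁), (y, s), (y', ε₁)} ∪ {(y + s, 0), (y' + s, ε₂), (w, 0), (w', ε₂)} ∪
          {(w, s), (y + s + s - δ, δ), (w + -a, s), (y + s + s + -a - δ, δ)}) := by
  have hs0 := H.s_ne
  have pys : π (y + s) = n₁ := by rw [map_add, H.map_s, py, add_zero]
  have pys' : π (y' + s) = n₂ := by rw [map_add, H.map_s, py', add_zero]
  have pws : π (w + s) = m₁ := by rw [map_add, pw, H.map_s, add_zero]
  have pyss : π (y + s + s) = n₁ := by rw [map_add, pys, H.map_s, add_zero]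
  have pwsa : π (w + s + -a) = m₀ := by rw [map_add, pws, map_neg, pm₀]
  have pyssa : π (y + s + s + -a) = n₀ := by rw [map_add, pyss, map_neg, pn₀]
  simp only [List.nodup_cons, List.mem_cons, List.not_mem_nil, or_false, not_or, not_false_eq_true,
    and_true, List.nodup_nil] at hnd
  obtain ⟨⟨a1, a2, a3, a4, a5⟩, ⟨b1, b2, b3, b4⟩, ⟨c1, c2, c3⟩, ⟨d1, d2⟩, e1⟩ := hnd
  have hin : ∀ {p n : Q}, p ∈ R → n ∉ R → n ≠ p := fun h h' e => h' (e ▸ h)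
  have hM : ∀ {i δ c}, π i = c → c ∉ R → (i, δ) ∉ M := fun hi hc h => hc (hi ▸ C.1 _ h)
  obtain ⟨ε₁, hε₁, C₁⟩ := H.uDomino C (i := x) (i' := x') (j := y) (j' := y') (ε := s) hx' hy hy'
    (Or.inr rfl) k1 k2 k3 (px ▸ h1) (px' ▸ h2) (by rwa [py, py']) (by rwa [py]) (by rwa [py'])
  rw [py, py'] at C₁
  have nys : ∀ {δ}, (y + s, δ) ≠ (y, s) := fun h => hs0 (by simpa using congrArg Prod.fst h)
  have nys' : ∀ {δ ε : Z}, (y' + s, δ) ≠ (y', ε) := fun h => hs0 (by simpa using congrArg Prod.fst h)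
  have k4 : ∀ {δ}, (y + s, δ) ∉ M ∪ {(x, s), (x', ε₁), (y, s), (y', ε₁)} := fun {δ} =>
    Set.not_mem_union_quadruple (hM pys h4) (rung_ne (hin h1 h4) pys px)
      (rung_ne (hin h2 h4) pys px') nys (rung_ne b1 pys py')
  have k5 : ∀ {δ}, (y' + s, δ) ∉ M ∪ {(x, s), (x', ε₁), (y, s), (y', ε₁)} := fun {δ} =>
    Set.not_mem_union_quadruple (hM pys' h5) (rung_ne (hin h1 h5) pys' px)
      (rung_ne (hin h2 h5) pys' px') (rung_ne (Ne.symm b1) pys' py) nys'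
  obtain ⟨ε₂, hε₂, C₂⟩ := H.uDomino C₁ (i := y + s) (i' := y' + s) (j := w) (j' := w') (ε := 0)
    (by rw [hy, hy', hx']; abel) hw hw' (Or.inl rfl) k4 k5 k5 (Or.inr (Or.inl pys))
    (Or.inr (Or.inr pys')) (by rwa [pw, pw'])
    (by
      rw [pw]
      rintro (h | h | h)
      exacts [h7 h, b3 h.symm, c2 h.symm])
    (by
      rw [pw']
      rintro (h | h | h)
      exacts [h8 h, b4 h.symm, c3 h.symm])
  rw [pw, pw'] at C₂
  have nz : ∀ {i : Z}, (i, s) ≠ (i, (0 : Z)) := fun h => hs0 (by simpa using congrArg Prod.snd h)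
  obtain ⟨δ, hδ, C₃⟩ := H.negA.negB.vDomino C₂ (y := w + s) (z := y + s + s) (δ := s) (i := w)
    (j := w + -a) (by rw [hw]; abel) (Or.inr rfl) (by abel) rfl
    (Set.not_mem_union_quadruple (Set.not_mem_union_quadruple (hM pw h7)
      (rung_ne (hin h1 h7) pw px) (rung_ne (hin h2 h7) pw px') (rung_ne (Ne.symm b3) pw py)
      (rung_ne (Ne.symm c2) pw py')) (rung_ne (Ne.symm b3) pw pys) (rung_ne (Ne.symm c2) pw pys')
      nz (rung_ne e1 pw pw'))
    (Set.not_mem_union_quadruple (Set.not_mem_union_quadruple (hM pyss h4)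
      (rung_ne (hin h1 h4) pyss px) (rung_ne (hin h2 h4) pyss px')
      (fun h => H.ss_ne (by simpa [add_assoc] using congrArg Prod.fst h))
      (rung_ne b1 pyss py')) (fun h => hs0 (by simpa using congrArg Prod.fst h))
      (rung_ne b1 pyss pys') (rung_ne b3 pyss pw) (rung_ne b4 pyss pw'))
    (by
      rw [add_sub_cancel_right]
      exact Set.not_mem_union_quadruple k4 nz (rung_ne b1 pys pys') (rung_ne b3 pys pw)
        (rung_ne b4 pys pw'))
    (Or.inr (Or.inl pws)) (Or.inl (Or.inr (Or.inl pyss))) (by rw [pwsa, pyssa]; exact Ne.symm a3)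
    (by
      rw [pwsa]
      rintro ((h | h | h) | h | h)
      exacts [h6 h, b2 h.symm, c1 h.symm, d1 h, d2 h])
    (by
      rw [pyssa]
      rintro ((h | h | h) | h | h)
      exacts [h3 h, a1 h, a2 h, a4 h, a5 h])
  rw [pwsa, pyssa] at C₃
  exact ⟨ε₁, ε₂, δ, hδ, C₃⟩

/-- Extend the covered columns by a block of three times two columns. -/
theorem grown_block [Finite Z] (H : Bic G u v a b s π) (hπ : Function.Surjective π)
    (hP : Set.InjOn P D) (hI : I ⊆ D) (g : Grown G u v s π P I F)
    (p₁ p₂ n₀ n₁ n₂ m₀ m₁ m₂ : ι) (hp₁ : p₁ ∈ F) (hp₂ : p₂ ∈ F)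
    (hN : ∀ c ∈ ({n₀, n₁, n₂, m₀, m₁, m₂} : Set ι), c ∈ D ∧ c ∉ I)
    (hnd : [n₀, n₁, n₂, m₀, m₁, m₂].Nodup)
    (e2 : P p₂ = P p₁ + π a) (e3 : P n₁ = P p₁ + π b) (e4 : P n₂ = P p₂ + π b)
    (e5 : P m₁ = P n₁ + π b) (e6 : P m₂ = P n₂ + π b) (e7 : P n₀ = P n₁ + -π a)
    (e8 : P m₀ = P m₁ + -π a) :
    Grown G u v s π P (I ∪ {n₀, n₁, n₂, m₀, m₁, m₂}) ((F \ {p₁, p₂}) ∪ {m₀, m₁, m₂}) := by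
  obtain ⟨hFI, M, C, hF⟩ := g
  obtain ⟨t, ht⟩ := hF p₁ hp₁
  obtain ⟨t', ht'⟩ := hF p₂ hp₂
  obtain ⟨x₀, hx₀⟩ := hπ (P p₁)
  obtain ⟨x, hx, hxt, hxt'⟩ := H.exists_ne_ne x₀ t (t' - a)
  rw [hx₀] at hx
  have hinj : ∀ {c d}, c ∈ D → d ∈ D → P c = P d → c = d := fun hc hd e => hP hc hd e
  have hD1 := hI (hFI hp₁)
  have hD2 := hI (hFI hp₂)
  have hnot : ∀ c ∈ ({n₀, n₁, n₂, m₀, m₁, m₂} : Set ι), P c ∉ P '' I := by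
    rintro c hc ⟨d, hd, h⟩
    exact (hN c hc).2 (hP (hI hd) (hN c hc).1 h ▸ hd)
  obtain ⟨x', hx'⟩ : ∃ x', x' = x + a := ⟨_, rfl⟩
  obtain ⟨y, hy⟩ : ∃ y, y = x + b := ⟨_, rfl⟩
  obtain ⟨y', hy'⟩ : ∃ y', y' = x' + b := ⟨_, rfl⟩
  obtain ⟨w, hw⟩ : ∃ w, w = y + s + b := ⟨_, rfl⟩
  obtain ⟨w', hw'⟩ : ∃ w', w' = y' + s + b := ⟨_, rfl⟩
  have px' : π x' = P p₂ := by rw [hx', map_add, hx, e2]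
  have py : π y = P n₁ := by rw [hy, map_add, hx, e3]
  have py' : π y' = P n₂ := by rw [hy', map_add, px', e4]
  have pw : π w = P m₁ := by rw [hw, map_add, map_add, H.map_s, add_zero, py, e5]
  have pw' : π w' = P m₂ := by rw [hw', map_add, map_add, H.map_s, add_zero, py', e6]
  have hxt'' : x' ≠ t' := fun h => hxt' (eq_sub_of_add_eq (hx' ▸ h))
  have hPnd : (List.map P [n₀, n₁, n₂, m₀, m₁, m₂]).Nodup := by
    refine hnd.map_on fun c hc d hd e => hinj (hN c ?_).1 (hN d ?_).1 e
    exacts [by simpa using hc, by simpa using hd]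
  simp only [List.map_cons, List.map_nil] at hPnd
  obtain ⟨ε₁, ε₂, δ, hδ, C'⟩ := H.block C hx' hy hy' hw hw' hx px' py py' pw pw' e7.symm e8.symm
    ⟨_, hFI hp₁, rfl⟩ ⟨_, hFI hp₂, rfl⟩ (hnot _ (by simp)) (hnot _ (by simp)) (hnot _ (by simp))
    (hnot _ (by simp)) (hnot _ (by simp)) (hnot _ (by simp)) hPnd
    (fun h => hxt (ht _ _ hx h)) (fun h => hxt'' (ht' _ _ px' h)) (fun h => hxt'' (ht' _ _ px' h))
  rw [Set.union_assoc M, Set.union_assoc M] at C'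
  have pδ := H.map_of_rung hδ
  have ps := H.map_s
  refine grown_extend hP hI hFI C.1 hF (fun c hc => (hN c hc).1) (fun c hc => (hN c hc).2) ?_
    (by
      convert C' using 1
      simp only [Set.image_insert_eq, Set.image_singleton]
      simp only [Set.insert_eq]
      ac_rfl)
  have pys : π (y + s) = P n₁ := by rw [map_add, H.map_s, py, add_zero]
  have pys' : π (y' + s) = P n₂ := by rw [map_add, H.map_s, py', add_zero]
  have pz : π (y + s + s - δ) = P n₁ := by rw [map_sub, pδ, map_add, pys, ps]; abel
  have pwa : π (w + -a) = P m₀ := by rw [map_add, map_neg, pw, e8]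
  have pz' : π (y + s + s + -a - δ) = P n₀ := by
    rw [map_sub, pδ, map_add, map_add, pys, ps, map_neg, e7]
    abel
  have hne : ∀ c ∈ I, ∀ d ∈ ({n₀, n₁, n₂, m₀, m₁, m₂} : Set ι), P d ≠ P c :=
    fun c hc d hd h => hnot d hd ⟨c, hc, h.symm⟩
  have hne1 := hne _ (hFI hp₁)
  have hne2 := hne _ (hFI hp₂)
  clear C C' hF ht ht' hxt hxt' hxt''
  simp only [List.nodup_cons, List.mem_cons, List.not_mem_nil, or_false, not_or, not_false_eq_true,
    and_true, List.nodup_nil] at hPnd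
  rintro c (⟨hc, hc'⟩ | hc)
  · refine Or.inl ⟨hc, ?_⟩
    have hc1 : P p₁ ≠ P c := fun h => hc' (Or.inl (hinj hD1 (hI (hFI hc)) h).symm)
    have hc2 : P p₂ ≠ P c := fun h => hc' (Or.inr (hinj hD2 (hI (hFI hc)) h).symm)
    have hne3 := hne _ (hFI hc)
    rintro z (((rfl | rfl | rfl | rfl) | (rfl | rfl | rfl | rfl)) | rfl | rfl | rfl | rfl) <;>
      simp only [hx, px', py, py', pys, pys', pw, pw', pz, pz', pwa]
    all_goals first
      | assumption
      | exact hne3 _ (by simp)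
  · refine Or.inr ⟨Or.inr (Or.inr (Or.inr hc)), ?_⟩
    simp only [Set.mem_insert_iff, Set.mem_singleton_iff, forall_eq_or_imp, forall_eq] at hne1 hne2
    obtain ⟨f1, f2, f3, f4, f5, f6⟩ := hne1
    obtain ⟨g1, g2, g3, g4, g5, g6⟩ := hne2
    obtain ⟨⟨a1, a2, a3, a4, a5⟩, ⟨b1, b2, b3, b4⟩, ⟨c1, c2, c3⟩, ⟨d1, d2⟩, k1⟩ := hPnd
    rcases hc with rfl | rfl | rfl
    · refine ⟨w + -a, fun i ε hi h => ?_⟩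
      rcases h with ((h | h | h | h) | (h | h | h | h)) | h | h | h | h <;>
        obtain ⟨rfl, rfl⟩ := Prod.mk.inj h <;> 
        first
          | rfl
          | (simp only [hx, px', py, py', pys, pys', pw, pw', pz, pz'] at hi
             first
               | exact absurd hi (by assumption)
               | exact absurd hi.symm (by assumption))
    · refine ⟨w, fun i ε hi h => ?_⟩
      rcases h with ((h | h | h | h) | (h | h | h | h)) | h | h | h | h <;>
        obtain ⟨rfl, rfl⟩ := Prod.mk.inj h <;> 
        first
          | rfl
          | (simp only [hx, px', py, py', pys, pys', pw', pz, pz', pwa] at hi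
             first
               | exact absurd hi (by assumption)
               | exact absurd hi.symm (by assumption))
    · refine ⟨w', fun i ε hi h => ?_⟩
      rcases h with ((h | h | h | h) | (h | h | h | h)) | h | h | h | h <;>
        obtain ⟨rfl, rfl⟩ := Prod.mk.inj h <;> 
        first
          | rfl
          | (simp only [hx, px', py, py', pys, pys', pw, pz, pz', pwa] at hi
             first
               | exact absurd hi (by assumption)
               | exact absurd hi.symm (by assumption))

end Bic
end Blocks

section Corner

variable {W Z Q ι : Type*} [AddCommGroup Z] [AddCommGroup Q]

namespace Bic

variable {G : SimpleGraph W} {u v : Z → W} {a b s : Z} {π : Z →+ Q} {P : ι → Q} {D I F : Set ι}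
  {R : Set Q} {M : Set (Z × Z)}

theorem corner [Finite Z] (H : Bic G u v a b s π) (C : RungCyc G u v s π R M) {x y z w : Z}
    {p j k l m n e f : Q} (hy : y = x + -a) (hz : z = x + b) (hw : w = y + b)
    (px : π x = p) (py : π y = j) (pz : π z = k) (pw : π w = l)
    (pm : l + -π a = m) (pn : j + -π a = n) (pe : n + -π b = e) (pf : j + -π b = f)
    (hp : p ∈ R) (hR : ∀ c ∈ ({j, k, l, m, n, e, f} : Set Q), c ∉ R)
    (hnd : [j, k, l, m, n, e, f].Nodup) (h0 : (x, 0) ∉ M) :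
    ∃ δ ε, (δ = 0 ∨ δ = s) ∧
      RungCyc G u v s π (R ∪ {j, k, l} ∪ {m, n} ∪ {e, f})
        (M ∪ {(x, 0), (y, 0), (z, 0), (w, 0)} ∪
          {(w, s), (y + s - δ, δ), (w + -a, s), (y + s + -a - δ, δ)} ∪
          {(y + -a + s + s, 0), (y + s + s, ε), (y + -a + s + s + -b, 0), (y + s + s + -b, ε)}) := by
  have hs0 := H.s_ne
  have ps := H.map_s
  simp only [Set.mem_insert_iff, Set.mem_singleton_iff, forall_eq_or_imp, forall_eq] at hR
  simp only [List.nodup_cons, List.mem_cons, List.not_mem_nil, or_false, not_or, not_false_eq_true,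
    and_true, List.nodup_nil] at hnd
  obtain ⟨⟨a1, a2, a3, a4, a5, a6⟩, ⟨b1, b2, b3, b4, b5⟩, ⟨c1, c2, c3, c4⟩, ⟨d1, d2, d3⟩,
    ⟨e1, e2⟩, f1⟩ := hnd
  obtain ⟨r1, r2, r3, r4, r5, r6, r7⟩ := hR
  have hin : ∀ {n : Q}, n ∉ R → n ≠ p := fun h' e => h' (e ▸ hp)
  have hM : ∀ {i δ c}, π i = c → c ∉ R → (i, δ) ∉ M := fun hi hc h => hc (hi ▸ C.1 _ h)
  have nz : ∀ {i : Z}, (i, s) ≠ (i, (0 : Z)) := fun h => hs0 (by simpa using congrArg Prod.snd h)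
  have C₁ := H.negA.threeColumns C hy hz hw h0 (px ▸ hp) (by rwa [py, pz]) (by rwa [py, pw])
    (by rwa [pz, pw]) (by rwa [py]) (by rwa [pz]) (by rwa [pw])
  rw [py, pz, pw] at C₁
  have pys : π (y + s) = j := by rw [map_add, ps, add_zero, py]
  have pyss : π (y + s + s) = j := by rw [map_add, ps, add_zero, pys]
  have pws : π (w + s) = l := by rw [map_add, ps, add_zero, pw]
  have pm' : π (w + s + -a) = m := by rw [map_add, pws, map_neg, pm]
  have pn' : π (y + s + -a) = n := by rw [map_add, pys, map_neg, pn]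
  have pn'' : π (y + -a + s + s) = n := by
    rw [map_add, map_add, map_add, ps, add_zero, add_zero, py, map_neg, pn]
  have pe' : π (y + -a + s + s + -b) = e := by rw [map_add, pn'', map_neg, pe]
  have pf' : π (y + s + s + -b) = f := by rw [map_add, pyss, map_neg, pf]
  have pwa : π (w + -a) = m := by rw [map_add, pw, map_neg, pm]
  obtain ⟨δ, hδ, C₂⟩ := H.negA.negB.vDomino C₁ (y := w + s) (z := y + s) (δ := s) (i := w)
    (j := w + -a) (by rw [hw]; abel) (Or.inr rfl) (by abel) rfl
    (Set.not_mem_union_quadruple (hM pw r3) (rung_ne (hin r3) pw px)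
      (rung_ne (Ne.symm a2) pw py) (rung_ne (Ne.symm b1) pw pz) nz)
    (Set.not_mem_union_quadruple (hM pys r1) (rung_ne (hin r1) pys px)
      (fun h => hs0 (by simpa using congrArg Prod.fst h)) (rung_ne a1 pys pz) (rung_ne a2 pys pw))
    (by
      rw [add_sub_cancel_right]
      exact Set.not_mem_union_quadruple (hM py r1) (rung_ne (hin r1) py px) nz (rung_ne a1 py pz)
        (rung_ne a2 py pw))
    (Or.inr (Or.inr (Or.inr pws))) (Or.inr (Or.inl pys)) (by rwa [pm', pn'])
    (by
      rw [pm']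
      rintro (h | h | h | h)
      exacts [r4 h, a3 h.symm, b2 h.symm, c1 h.symm])
    (by
      rw [pn']
      rintro (h | h | h | h)
      exacts [r5 h, a4 h.symm, b3 h.symm, c2 h.symm])
  rw [pm', pn'] at C₂
  have pδ := H.map_of_rung hδ
  have pjδ : π (y + s - δ) = j := by rw [map_sub, pδ, pys, sub_zero]
  have pnδ : π (y + s + -a - δ) = n := by rw [map_sub, pδ, pn', sub_zero]
  have k1 : ∀ {ε : Z}, (y + s + s, ε) ∉ M ∪ {(x, 0), (y, 0), (z, 0), (w, 0)} ∪
          {(w, s), (y + s - δ, δ), (w + -a, s), (y + s + -a - δ, δ)} := fun {ε} =>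
    Set.not_mem_union_quadruple (Set.not_mem_union_quadruple (hM pyss r1)
      (rung_ne (hin r1) pyss px) (fun h => H.ss_ne (by simpa [add_assoc] using congrArg Prod.fst h))
      (rung_ne a1 pyss pz) (rung_ne a2 pyss pw)) (rung_ne a2 pyss pw)
      (fun h => by
        have h := congrArg Prod.fst h
        rcases hδ with rfl | rfl
        · exact hs0 (by simpa using h)
        · exact H.ss_ne (by simpa [add_assoc] using h))
      (rung_ne a3 pyss pwa) (rung_ne a4 pyss pnδ)
  obtain ⟨ε, hε, C₃⟩ := H.negB.uDomino C₂ (i := y + -a + s + s) (i' := y + s + s)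
    (j := y + -a + s + s + -b) (j' := y + s + s + -b) (ε := 0) (by abel) rfl rfl (Or.inl rfl)
    (Set.not_mem_union_quadruple (Set.not_mem_union_quadruple (hM pn'' r5)
      (rung_ne (hin r5) pn'' px) (rung_ne (Ne.symm a4) pn'' py) (rung_ne (Ne.symm b3) pn'' pz)
      (rung_ne (Ne.symm c2) pn'' pw)) (rung_ne (Ne.symm c2) pn'' pw)
      (rung_ne (Ne.symm a4) pn'' pjδ) (rung_ne (Ne.symm d1) pn'' pwa)
      (fun h => by
        have h := congrArg Prod.fst h
        rcases hδ with h' | h' <;> rw [h'] at h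
        · exact hs0 ((by abel : s = y + -a + s + s - (y + s + -a - 0)).trans (sub_eq_zero.2 h))
        · exact H.ss_ne ((by abel : s + s = y + -a + s + s - (y + s + -a - s)).trans
            (sub_eq_zero.2 h))))
    k1 k1 (Or.inr (Or.inr pn'')) (Or.inl (Or.inr (Or.inl pyss))) (by rwa [pe', pf'])
    (by
      rw [pe']
      rintro ((h | h | h | h) | h | h)
      exacts [r6 h, a5 h.symm, b4 h.symm, c3 h.symm, d2 h.symm, e1 h.symm])
    (by
      rw [pf']
      rintro ((h | h | h | h) | h | h)
      exacts [r7 h, a6 h.symm, b5 h.symm, c4 h.symm, d3 h.symm, e2 h.symm])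
  rw [pe', pf'] at C₃
  exact ⟨δ, ε, hδ, C₃⟩

theorem grown_corner [Finite Z] (H : Bic G u v a b s π) (hπ : Function.Surjective π)
    (hP : Set.InjOn P D) (hI : I ⊆ D) (g : Grown G u v s π P I F) (p j k l m n e f : ι) (hp : p ∈ F)
    (hN : ∀ c ∈ ({j, k, l, m, n, e, f} : Set ι), c ∈ D ∧ c ∉ I)
    (hnd : [j, k, l, m, n, e, f].Nodup)
    (e1 : P j = P p + -π a) (e2 : P k = P p + π b) (e3 : P l = P j + π b)
    (e4 : P m = P l + -π a) (e5 : P n = P j + -π a) (e6 : P e = P n + -π b)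
    (e7 : P f = P j + -π b) :
    Grown G u v s π P (I ∪ {j, k, l, m, n, e, f}) ((F \ {p}) ∪ {k, l, m}) := by
  obtain ⟨hFI, M, C, hF⟩ := g
  obtain ⟨t, ht⟩ := hF p hp
  obtain ⟨x₀, hx₀⟩ := hπ (P p)
  obtain ⟨x, px, hxt, -⟩ := H.exists_ne_ne x₀ t t
  rw [hx₀] at px
  have hinj : ∀ {c d}, c ∈ D → d ∈ D → P c = P d → c = d := fun hc hd e => hP hc hd e
  have hD1 := hI (hFI hp)
  have hnot : ∀ c ∈ ({j, k, l, m, n, e, f} : Set ι), P c ∉ P '' I := by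
    rintro c hc ⟨d, hd, h⟩
    exact (hN c hc).2 (hP (hI hd) (hN c hc).1 h ▸ hd)
  obtain ⟨y, hy⟩ : ∃ y, y = x + -a := ⟨_, rfl⟩
  obtain ⟨z, hz⟩ : ∃ z, z = x + b := ⟨_, rfl⟩
  obtain ⟨w, hw⟩ : ∃ w, w = y + b := ⟨_, rfl⟩
  have py : π y = P j := by rw [hy, map_add, px, e1, map_neg]
  have pz : π z = P k := by rw [hz, map_add, px, e2]
  have pw : π w = P l := by rw [hw, map_add, py, e3]
  have hPnd : (List.map P [j, k, l, m, n, e, f]).Nodup := by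
    refine hnd.map_on fun c hc d hd e => hinj (hN c ?_).1 (hN d ?_).1 e
    exacts [by simpa using hc, by simpa using hd]
  simp only [List.map_cons, List.map_nil] at hPnd
  obtain ⟨δ, ε, hδ, C'⟩ := H.corner C hy hz hw px py pz pw e4.symm e5.symm e6.symm e7.symm
    ⟨_, hFI hp, rfl⟩ (by
      simp only [Set.mem_insert_iff, Set.mem_singleton_iff, forall_eq_or_imp, forall_eq] at hnot ⊢
      exact hnot) hPnd (fun h => hxt (ht _ _ px h))
  rw [Set.union_assoc M, Set.union_assoc M] at C'
  have pδ := H.map_of_rung hδ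
  have ps := H.map_s
  refine grown_extend hP hI hFI C.1 hF (fun c hc => (hN c hc).1) (fun c hc => (hN c hc).2) ?_
    (by
      convert C' using 1
      simp only [Set.image_insert_eq, Set.image_singleton]
      simp only [Set.insert_eq]
      ac_rfl)
  have pys : π (y + s) = P j := by rw [map_add, ps, add_zero, py]
  have pyss : π (y + s + s) = P j := by rw [map_add, ps, add_zero, pys]
  have pn : π (y + -a + s + s) = P n := by
    rw [map_add, map_add, map_add, ps, add_zero, add_zero, py, map_neg, e5]
  have pe : π (y + -a + s + s + -b) = P e := by rw [map_add, pn, map_neg, e6]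
  have pf : π (y + s + s + -b) = P f := by rw [map_add, pyss, map_neg, e7]
  have pwa : π (w + -a) = P m := by rw [map_add, pw, map_neg, e4]
  have pjδ : π (y + s - δ) = P j := by rw [map_sub, pδ, pys, sub_zero]
  have pnδ : π (y + s + -a - δ) = P n := by
    rw [map_sub, pδ, map_add, pys, sub_zero, map_neg, e5]
  have hne : ∀ c ∈ I, ∀ d ∈ ({j, k, l, m, n, e, f} : Set ι), P d ≠ P c :=
    fun c hc d hd h => hnot d hd ⟨c, hc, h.symm⟩
  have hne1 := hne _ (hFI hp)
  clear C C' hF ht hxt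
  simp only [List.nodup_cons, List.mem_cons, List.not_mem_nil, or_false, not_or, not_false_eq_true,
    and_true, List.nodup_nil] at hPnd
  rintro c (⟨hc, hc'⟩ | hc)
  · refine Or.inl ⟨hc, ?_⟩
    have hc1 : P p ≠ P c := fun h => hc' (hinj hD1 (hI (hFI hc)) h).symm
    have hne3 := hne _ (hFI hc)
    rintro i (((rfl | rfl | rfl | rfl) | (rfl | rfl | rfl | rfl)) | rfl | rfl | rfl | rfl) <;>
      simp only [px, py, pz, pw, pjδ, pwa, pnδ, pn, pyss, pe, pf]
    all_goals first
      | assumption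
      | exact hne3 _ (by simp)
  · refine Or.inr ⟨Or.inr (by rcases hc with rfl | rfl | rfl <;> simp), ?_⟩
    simp only [Set.mem_insert_iff, Set.mem_singleton_iff, forall_eq_or_imp, forall_eq] at hne1
    obtain ⟨g1, g2, g3, g4, g5, g6, g7⟩ := hne1
    obtain ⟨⟨a1, a2, a3, a4, a5, a6⟩, ⟨b1, b2, b3, b4, b5⟩, ⟨c1, c2, c3, c4⟩, ⟨d1, d2, d3⟩,
      ⟨f1, f2⟩, k1⟩ := hPnd
    rcases hc with rfl | rfl | rfl
    · refine ⟨z, fun i ε hi h => ?_⟩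
      rcases h with ((h | h | h | h) | (h | h | h | h)) | h | h | h | h <;>
        obtain ⟨rfl, rfl⟩ := Prod.mk.inj h <;>
        first
          | rfl
          | (simp only [px, py, pw, pjδ, pwa, pnδ, pn, pyss, pe, pf] at hi
             first
               | exact absurd hi (by assumption)
               | exact absurd hi.symm (by assumption))
    · refine ⟨w, fun i ε hi h => ?_⟩
      rcases h with ((h | h | h | h) | (h | h | h | h)) | h | h | h | h <;>
        obtain ⟨rfl, rfl⟩ := Prod.mk.inj h <;>
        first
          | rfl
          | (simp only [px, py, pz, pjδ, pwa, pnδ, pn, pyss, pe, pf] at hi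
             first
               | exact absurd hi (by assumption)
               | exact absurd hi.symm (by assumption))
    · refine ⟨w + -a, fun i ε hi h => ?_⟩
      rcases h with ((h | h | h | h) | (h | h | h | h)) | h | h | h | h <;>
        obtain ⟨rfl, rfl⟩ := Prod.mk.inj h <;>
        first
          | rfl
          | (simp only [px, py, pz, pw, pjδ, pnδ, pn, pyss, pe, pf] at hi
             first
               | exact absurd hi (by assumption)
               | exact absurd hi.symm (by assumption))

end Bic
end Corner

section Grid

variable {W Z Q : Type*} [AddCommGroup Z] [AddCommGroup Q]

/-- The lattice point `(x, y)` stands for `x • A + y • B`. -/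
def lattice (A B : Q) (p : ℕ × ℕ) : Q := p.1 • A + p.2 • B

namespace Bic

variable {G : SimpleGraph W} {u v : Z → W} {a b s : Z} {π : Z →+ Q} {D I F : Set (ℕ × ℕ)}

theorem grown_row [Finite Z] (H : Bic G u v a b s π) (hπ : Function.Surjective π)
    (hP : Set.InjOn (lattice (π a) (π b)) D) (hI : I ⊆ D)
    (g : Grown G u v s π (lattice (π a) (π b)) I F) (x y r : ℕ)
    (hF : ∀ z, x ≤ z → z < x + 2 * r → (z, y) ∈ F)
    (hD : ∀ z, x ≤ z → z < x + 2 * r → (z, y + 1) ∈ D ∧ (z, y + 1) ∉ I) :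
    Grown G u v s π (lattice (π a) (π b)) (I ∪ {p | p.2 = y + 1 ∧ x ≤ p.1 ∧ p.1 < x + 2 * r})
      ((F \ {p | p.2 = y ∧ x ≤ p.1 ∧ p.1 < x + 2 * r}) ∪
        {p | p.2 = y + 1 ∧ x ≤ p.1 ∧ p.1 < x + 2 * r}) := by
  have hFI := g.1
  induction r with
  | zero =>
    convert g using 1 <;> ext ⟨p, q⟩ <;>
      simp only [Set.mem_union, Set.mem_ofPred_eq, Set.mem_sdiff] <;> grind
  | succ r ih =>
    have ih := ih (fun z h h' => hF z h (by omega)) (fun z h h' => hD z h (by omega))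
    have h1 := hF (x + 2 * r) (by omega) (by omega)
    have h2 := hF (x + 2 * r + 1) (by omega) (by omega)
    have h3 := hD (x + 2 * r) (by omega) (by omega)
    have h4 := hD (x + 2 * r + 1) (by omega) (by omega)
    have := H.grown_domino hπ hP (by
        rintro p (hp | hp)
        · exact hI hp
        · obtain ⟨p, q⟩ := p
          obtain ⟨rfl, hp⟩ := hp
          exact (hD p hp.1 (by omega)).1) ih
      (x + 2 * r, y) (x + 2 * r + 1, y) (x + 2 * r, y + 1) (x + 2 * r + 1, y + 1)
      (Or.inl ⟨h1, fun h => by simp at h⟩)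
      (Or.inl ⟨h2, fun h => by simp [add_assoc] at h⟩) h3.1 h4.1
      (by
        rintro (h | h)
        · exact h3.2 h
        · simp at h)
      (by
        rintro (h | h)
        · exact h4.2 h
        · simp [add_assoc] at h)
      (by simp) (by simp only [lattice]; module) (by simp only [lattice]; module)
      (by simp only [lattice]; module)
    convert this using 1 <;> ext ⟨p, q⟩ <;>
      simp only [Set.mem_union, Set.mem_ofPred_eq, Set.mem_sdiff, Set.mem_insert_iff,
        Set.mem_singleton_iff, Prod.mk.injEq] <;> grind

variable {X Y : ℕ}

theorem grown_rect_strip [Finite Z] (H : Bic G u v a b s π) {k : ℕ} (hk : 1 ≤ k) (hkX : k < X)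
    (hY : 2 ≤ Y)
    (hP : Set.InjOn (lattice (π a) (π b)) {p | p.1 < X ∧ p.2 < Y}) :
    Grown G u v s π (lattice (π a) (π b)) {p | p.1 ≤ k ∧ p.2 ≤ 1} {p | p.1 ≤ k ∧ p.2 = 1} := by
  refine H.grown_strip hk ?_ ?_ ?_ ?_ ?_
  · intro x hx y hy h
    exact congrArg Prod.fst (hP (x₁ := (x, 0)) (x₂ := (y, 0)) ⟨by omega, by omega⟩
      ⟨by omega, by omega⟩ (by simpa [lattice] using h))
  · intro x hx y hy h
    exact absurd (congrArg Prod.snd (hP (x₁ := (x, 0)) (x₂ := (y, 1)) ⟨by omega, by omega⟩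
      ⟨by omega, by omega⟩ (by simpa [lattice] using h))) (by simp)
  · rintro p ⟨h, h'⟩
    exact ⟨h, h'.le⟩
  · ext c
    simp only [stripSet, Set.mem_image, Set.mem_ofPred_eq, lattice]
    constructor
    · rintro ⟨⟨x, y⟩, ⟨hx, hy⟩, rfl⟩
      refine ⟨x, hx, ?_⟩
      simp only at hy
      interval_cases y
      · exact Or.inl (by simp)
      · exact Or.inr (by simp)
    · rintro ⟨x, hx, rfl | rfl⟩
      · exact ⟨(x, 0), ⟨hx, by simp⟩, by simp⟩
      · exact ⟨(x, 1), ⟨hx, by simp⟩, by simp⟩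
  · rintro ⟨x, y⟩ ⟨hx, rfl⟩
    exact ⟨x, hx, by simp [lattice]⟩

theorem cyc_of_grid_even [Finite Z] (H : Bic G u v a b s π) (hπ : Function.Surjective π)
    (hP : Set.InjOn (lattice (π a) (π b)) {p | p.1 < X ∧ p.2 < Y})
    (hu : lattice (π a) (π b) '' {p | p.1 < X ∧ p.2 < Y} = Set.univ) (hX : 2 ≤ X) (hXe : Even X)
    (hY : 2 ≤ Y) : Cyc G Set.univ ∅ := by
  obtain ⟨r, rfl⟩ := hXe.two_dvd
  have key : ∀ y, y + 2 ≤ Y → Grown G u v s π (lattice (π a) (π b))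
      {p | p.1 < 2 * r ∧ p.2 < y + 2} {p | p.1 < 2 * r ∧ p.2 = y + 1} := by
    intro y hy
    induction y with
    | zero =>
      convert H.grown_rect_strip (k := 2 * r - 1) (by omega) (by omega) hY hP using 1 <;>
      · ext ⟨p, q⟩
        simp only [Set.mem_ofPred_eq]
        omega
    | succ y ih =>
      have := H.grown_row hπ hP (fun p hp => ⟨hp.1, by have := hp.2; omega⟩) (ih (by omega)) 0
        (y + 1) r (fun z _ hz => ⟨by simp only; omega, rfl⟩)
        (fun z _ hz => ⟨⟨by simp only; omega, by simp only; omega⟩, fun h => by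
          have := h.2
          simp only at this
          omega⟩)
      convert this using 1 <;> ext ⟨p, q⟩ <;>
        simp only [Set.mem_union, Set.mem_ofPred_eq, Set.mem_sdiff] <;> omega
  have := key (Y - 2) (by omega)
  rw [Nat.sub_add_cancel hY] at this
  exact H.cyc_of_grown this hu

theorem cyc_of_grid_odd [Finite Z] (H : Bic G u v a b s π) (hπ : Function.Surjective π)
    (hP : Set.InjOn (lattice (π a) (π b)) {p | p.1 < X ∧ p.2 < Y})
    (hu : lattice (π a) (π b) '' {p | p.1 < X ∧ p.2 < Y} = Set.univ) (hX : 5 ≤ X) (hXo : Odd X)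
    (hXa : X • π a = 0) (hY : 3 ≤ Y) (hYo : Odd Y) : Cyc G Set.univ ∅ := by
  obtain ⟨r, rfl⟩ : ∃ r, X = 2 * r + 3 := by
    obtain ⟨k, rfl⟩ := hXo
    exact ⟨k - 1, by omega⟩
  have g0 := H.grown_rect_strip (k := 2 * r) (by omega) (by omega) (by omega) hP
  have hneg : (2 * r + 2) • π a = -π a := by
    rw [eq_neg_iff_add_eq_zero, ← hXa]
    module
  have hneg2 : (2 * r + 1) • π a = -π a + -π a := by
    have h : (2 * r + 1) • π a + (π a + π a) = 0 := by
      rw [← hXa]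
      module
    rw [eq_neg_of_add_eq_zero_left h, neg_add]
  have hD : ∀ c ∈ ({(2 * r + 2, 1), (0, 2), (2 * r + 2, 2), (2 * r + 1, 2), (2 * r + 1, 1),
      (2 * r + 1, 0), (2 * r + 2, 0)} : Set (ℕ × ℕ)),
      c ∈ {p : ℕ × ℕ | p.1 < 2 * r + 3 ∧ p.2 < Y} ∧ c ∉ {p : ℕ × ℕ | p.1 ≤ 2 * r ∧ p.2 ≤ 1} := by
    rintro _ (rfl | rfl | rfl | rfl | rfl | rfl | rfl) <;> simp only [Set.mem_ofPred_eq] <;> omega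
  have g1 := H.grown_corner hπ hP (fun p hp => by
      have := hp.1
      have := hp.2
      simp only [Set.mem_ofPred_eq]
      omega) g0 (0, 1) (2 * r + 2, 1) (0, 2) (2 * r + 2, 2)
    (2 * r + 1, 2) (2 * r + 1, 1) (2 * r + 1, 0) (2 * r + 2, 0) ⟨by simp, rfl⟩ hD (by simp)
    (by simp only [lattice, hneg]; module) (by simp only [lattice]; module)
    (by simp only [lattice]; module) (by simp only [lattice, hneg, hneg2]; module)
    (by simp only [lattice, hneg, hneg2]; module) (by simp only [lattice]; module)
    (by simp only [lattice]; module)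
  have g2 := H.grown_row hπ hP (fun p hp => by
      rcases hp with hp | hp
      · have := hp.1
        have := hp.2
        simp only [Set.mem_ofPred_eq]
        omega
      · exact (hD p hp).1) g1 1 1 r (fun z h h' => Or.inl ⟨⟨by simp only; omega, rfl⟩, by
          simp only [Set.mem_singleton_iff, Prod.mk.injEq]; omega⟩)
      (fun z h h' => ⟨⟨by simp only; omega, by simp only; omega⟩, by
        simp only [Set.mem_union, Set.mem_insert_iff, Set.mem_ofPred_eq, Set.mem_singleton_iff,
          Prod.mk.injEq]
        omega⟩)
  have key : ∀ y, 2 * y + 3 ≤ Y → Grown G u v s π (lattice (π a) (π b))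
      {p | p.1 < 2 * r + 3 ∧ p.2 < 2 * y + 3} {p | p.1 < 2 * r + 3 ∧ p.2 = 2 * y + 2} := by
    intro y hy
    induction y with
    | zero =>
      convert g2.mono (F' := {p | p.1 < 2 * r + 3 ∧ p.2 = 2 * 0 + 2}) ?_ using 1
      · ext ⟨p, q⟩
        simp only [Set.mem_union, Set.mem_insert_iff, Set.mem_ofPred_eq, Set.mem_singleton_iff,
          Prod.mk.injEq]
        omega
      · rintro ⟨p, q⟩ ⟨h1, h2⟩
        simp only [Set.mem_union, Set.mem_insert_iff, Set.mem_ofPred_eq, Set.mem_singleton_iff,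
          Prod.mk.injEq, Set.mem_sdiff] at h1 h2 ⊢
        omega
    | succ y ih =>
      have hD : ∀ c ∈ ({(0, 2 * y + 3), (1, 2 * y + 3), (2, 2 * y + 3), (0, 2 * y + 4),
          (1, 2 * y + 4), (2, 2 * y + 4)} : Set (ℕ × ℕ)),
          c ∈ {p : ℕ × ℕ | p.1 < 2 * r + 3 ∧ p.2 < Y} ∧
            c ∉ {p : ℕ × ℕ | p.1 < 2 * r + 3 ∧ p.2 < 2 * y + 3} := by
        rintro _ (rfl | rfl | rfl | rfl | rfl | rfl) <;> simp only [Set.mem_ofPred_eq] <;> omega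
      have k1 := H.grown_block hπ hP (fun p hp => ⟨hp.1, by have := hp.2; omega⟩) (ih (by omega))
        (1, 2 * y + 2) (2, 2 * y + 2) (0, 2 * y + 3) (1, 2 * y + 3) (2, 2 * y + 3) (0, 2 * y + 4)
        (1, 2 * y + 4) (2, 2 * y + 4) ⟨by simp only; omega, rfl⟩ ⟨by simp only; omega, rfl⟩ hD
        (by simp) (by simp only [lattice]; module) (by simp only [lattice]; module)
        (by simp only [lattice]; module) (by simp only [lattice]; module)
        (by simp only [lattice]; module) (by simp only [lattice]; module)
        (by simp only [lattice]; module)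
      have k2 := H.grown_row hπ hP (fun p hp => by
          rcases hp with hp | hp
          · exact ⟨hp.1, by have := hp.2; omega⟩
          · exact (hD p hp).1) k1 3 (2 * y + 2) r
        (fun z h h' => Or.inl ⟨⟨by simp only; omega, rfl⟩, by
          simp only [Set.mem_insert_iff, Set.mem_singleton_iff, Prod.mk.injEq]; omega⟩)
        (fun z h h' => ⟨⟨by simp only; omega, by simp only; omega⟩, by
          simp only [Set.mem_union, Set.mem_insert_iff, Set.mem_ofPred_eq, Set.mem_singleton_iff,
            Prod.mk.injEq]
          omega⟩)
      have k3 := H.grown_row hπ hP (fun p hp => by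
          rcases hp with (hp | hp) | hp
          · exact ⟨hp.1, by have := hp.2; omega⟩
          · exact (hD p hp).1
          · have := hp.1
            have := hp.2.2
            exact ⟨by omega, by omega⟩) k2 3 (2 * y + 3) r
        (fun z h h' => Or.inr ⟨rfl, h, h'⟩)
        (fun z h h' => ⟨⟨by simp only; omega, by simp only; omega⟩, by
          simp only [Set.mem_union, Set.mem_insert_iff, Set.mem_ofPred_eq, Set.mem_singleton_iff,
            Prod.mk.injEq]
          omega⟩)
      convert k3.mono (F' := {p | p.1 < 2 * r + 3 ∧ p.2 = 2 * (y + 1) + 2}) ?_ using 1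
      · ext ⟨p, q⟩
        simp only [Set.mem_union, Set.mem_insert_iff, Set.mem_ofPred_eq, Set.mem_singleton_iff,
          Prod.mk.injEq]
        omega
      · rintro ⟨p, q⟩ ⟨h1, h2⟩
        simp only [Set.mem_union, Set.mem_insert_iff, Set.mem_ofPred_eq, Set.mem_singleton_iff,
          Prod.mk.injEq, Set.mem_sdiff] at h1 h2 ⊢
        omega
  have := key ((Y - 3) / 2) (by omega)
  obtain ⟨k, rfl⟩ := hYo
  rw [show 2 * ((2 * k + 1 - 3) / 2) + 3 = 2 * k + 1 by omega] at this
  exact H.cyc_of_grown this hu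

end Bic
end Grid

section Lattice

variable {W Z Q : Type*} [AddCommGroup Z] [AddCommGroup Q]

theorem QuotientAddGroup.mk'_zmultiples_eq_zero {A c : Q} :
    QuotientAddGroup.mk' (AddSubgroup.zmultiples A) c = 0 ↔ ∃ k : ℤ, k • A = c := by
  rw [QuotientAddGroup.mk'_apply, QuotientAddGroup.eq_zero_iff, AddSubgroup.mem_zmultiples_iff]

theorem exists_eq_zsmul_mk' {A B : Q} (hQ : ∀ c : Q, ∃ k l : ℤ, c = k • A + l • B)
    (c : Q ⧸ AddSubgroup.zmultiples A) :
    ∃ k : ℤ, c = k • QuotientAddGroup.mk' (AddSubgroup.zmultiples A) B := by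
  obtain ⟨c, rfl⟩ := QuotientAddGroup.mk'_surjective _ c
  obtain ⟨k, l, rfl⟩ := hQ c
  refine ⟨l, (map_add (QuotientAddGroup.mk' (AddSubgroup.zmultiples A)) _ _).trans ?_⟩
  rw [map_zsmul, map_zsmul, QuotientAddGroup.mk'_zmultiples_eq_zero.2 ⟨1, one_zsmul A⟩,
    smul_zero, zero_add]

theorem addOrderOf_mul_addOrderOf_mk' {A B : Q}
    (hQ : ∀ c : Q, ∃ k l : ℤ, c = k • A + l • B) :
    addOrderOf A * addOrderOf (QuotientAddGroup.mk' (AddSubgroup.zmultiples A) B) =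
      Nat.card Q := by
  rw [AddSubgroup.card_eq_card_quotient_mul_card_addSubgroup (AddSubgroup.zmultiples A),
    Nat.card_zmultiples, mul_comm]
  congr 1
  rw [← Nat.card_zmultiples]
  have : AddSubgroup.zmultiples (QuotientAddGroup.mk' (AddSubgroup.zmultiples A) B) = ⊤ := by
    rw [eq_top_iff]
    rintro c -
    obtain ⟨k, rfl⟩ := exists_eq_zsmul_mk' hQ c
    exact ⟨k, rfl⟩
  rw [this, AddSubgroup.card_top]

theorem exists_lattice_bijOn [Finite Q] {A B : Q} (hQ : ∀ c : Q, ∃ k l : ℤ, c = k • A + l • B) :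
    ∃ Y, addOrderOf A * Y = Nat.card Q ∧
      Set.BijOn (lattice A B) {p | p.1 < addOrderOf A ∧ p.2 < Y} Set.univ := by
  let f := QuotientAddGroup.mk' (AddSubgroup.zmultiples A)
  have hf : ∀ c, f c = 0 ↔ ∃ k : ℤ, k • A = c := fun c =>
    QuotientAddGroup.mk'_zmultiples_eq_zero
  have hfA : f A = 0 := (hf A).2 ⟨1, one_zsmul A⟩
  refine ⟨addOrderOf (f B), addOrderOf_mul_addOrderOf_mk' hQ, ?_, ?_, ?_⟩
  · exact Set.mapsTo_univ _ _
  · rintro ⟨x, y⟩ ⟨hx, hy⟩ ⟨x', y'⟩ ⟨hx', hy'⟩ h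
    simp only [lattice] at *
    have e := congrArg f h
    simp only [map_add, map_nsmul, hfA, smul_zero, zero_add] at e
    obtain rfl := nsmul_injOn_Iio_addOrderOf hy hy' e
    rw [add_left_inj] at h
    obtain rfl := nsmul_injOn_Iio_addOrderOf hx hx' h
    rfl
  · rintro c -
    have hn : (0 : ℤ) < addOrderOf A := by exact_mod_cast addOrderOf_pos A
    have hn' : (0 : ℤ) < addOrderOf (f B) := by exact_mod_cast addOrderOf_pos (f B)
    obtain ⟨l, hl⟩ := exists_eq_zsmul_mk' hQ (f c)
    obtain ⟨y, hy⟩ := Int.eq_ofNat_of_zero_le (Int.emod_nonneg l hn'.ne')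
    obtain ⟨k, hk⟩ := (hf (c - y • B)).1 (by
      rw [map_sub, map_nsmul, hl, ← mod_addOrderOf_zsmul, hy, natCast_zsmul, sub_self])
    obtain ⟨x, hx⟩ := Int.eq_ofNat_of_zero_le (Int.emod_nonneg k hn.ne')
    refine ⟨(x, y), ⟨?_, ?_⟩, ?_⟩
    · have := Int.emod_lt_of_pos k hn
      rw [hx] at this
      exact_mod_cast this
    · have := Int.emod_lt_of_pos l hn'
      rw [hy] at this
      exact_mod_cast this
    · rw [← mod_addOrderOf_zsmul, hx, natCast_zsmul] at hk
      simp only [lattice]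
      rw [hk, sub_add_cancel]

theorem exists_zsmul_of_addOrderOf_eq_card [Finite Q] {A : Q} (h : addOrderOf A = Nat.card Q)
    (c : Q) : ∃ k : ℤ, c = k • A := by
  have hA : AddSubgroup.zmultiples A = ⊤ :=
    AddSubgroup.eq_top_of_card_eq _ (by rw [Nat.card_zmultiples, h])
  obtain ⟨k, hk⟩ := AddSubgroup.mem_zmultiples_iff.1 (hA ▸ AddSubgroup.mem_top c)
  exact ⟨k, hk.symm⟩

namespace Bic

variable {G : SimpleGraph W} {u v : Z → W} {a b s : Z} {π : Z →+ Q}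

theorem cyc_of_even_or_odd [Finite Z] [Finite Q] (H : Bic G u v a b s π)
    (hπ : Function.Surjective π) (hQ : ∀ c : Q, ∃ k l : ℤ, c = k • π a + l • π b)
    (ha : addOrderOf (π a) ≠ Nat.card Q)
    (h : Even (addOrderOf (π a)) ∨ Odd (Nat.card Q) ∧ 5 ≤ addOrderOf (π a)) :
    Cyc G Set.univ ∅ := by
  obtain ⟨Y, hY, hbij⟩ := exists_lattice_bijOn hQ
  have hq : 0 < Nat.card Q := Nat.card_pos
  have hY0 : Y ≠ 0 := by
    rintro rfl
    omega
  have hY1 : Y ≠ 1 := by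
    rintro rfl
    exact ha (by omega)
  rcases h with h | ⟨h, h5⟩
  · have := addOrderOf_pos (π a)
    exact H.cyc_of_grid_even hπ hbij.injOn hbij.image_eq
      (by obtain ⟨k, hk⟩ := h; omega) h (by omega)
  · rw [← hY, Nat.odd_mul] at h
    exact H.cyc_of_grid_odd hπ hbij.injOn hbij.image_eq h5 h.1 (addOrderOf_nsmul_eq_zero _)
      (by obtain ⟨k, hk⟩ := h.2; omega) h.2

theorem cyc_of_two_generators [Finite Z] [Finite Q] [IsAddCyclic Q] (H : Bic G u v a b s π)
    (hπ : Function.Surjective π) (hQ : ∀ c : Q, ∃ k l : ℤ, c = k • π a + l • π b)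
    (ha : addOrderOf (π a) ≠ Nat.card Q) (hb : addOrderOf (π b) ≠ Nat.card Q) :
    Cyc G Set.univ ∅ := by
  have hQ' : ∀ c : Q, ∃ k l : ℤ, c = k • π b + l • π a := fun c => by
    obtain ⟨k, l, rfl⟩ := hQ c
    exact ⟨l, k, add_comm _ _⟩
  have hdvd : Nat.card Q ∣ Nat.lcm (addOrderOf (π a)) (addOrderOf (π b)) := by
    obtain ⟨g, hg⟩ := IsAddCyclic.exists_ofOrder_eq_natCard (α := Q)
    rw [← hg]
    refine addOrderOf_dvd_of_nsmul_eq_zero ?_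
    obtain ⟨k, l, rfl⟩ := hQ g
    rw [smul_add, smul_comm, smul_comm _ l,
      addOrderOf_dvd_iff_nsmul_eq_zero.1 (Nat.dvd_lcm_left _ _),
      addOrderOf_dvd_iff_nsmul_eq_zero.1 (Nat.dvd_lcm_right _ _)]
    simp
  have hda := addOrderOf_dvd_natCard (π a)
  have hdb := addOrderOf_dvd_natCard (π b)
  rcases Nat.even_or_odd (Nat.card Q) with hq | hq
  · have := (hq.two_dvd.trans hdvd).trans (Nat.lcm_dvd_mul _ _)
    rcases (Nat.prime_two.dvd_mul).1 this with h | h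
    · exact H.cyc_of_even_or_odd hπ hQ ha (Or.inl (even_iff_two_dvd.2 h))
    · exact H.swap.cyc_of_even_or_odd hπ hQ' hb (Or.inl (even_iff_two_dvd.2 h))
  · have ha1 : addOrderOf (π a) ≠ 1 := fun h => by
      rw [h, Nat.lcm_one_left] at hdvd
      exact hb (Nat.dvd_antisymm hdb hdvd)
    have hb1 : addOrderOf (π b) ≠ 1 := fun h => by
      rw [h, Nat.lcm_one_right] at hdvd
      exact ha (Nat.dvd_antisymm hda hdvd)
    have hao := Odd.of_dvd_nat hq hda
    have hbo := Odd.of_dvd_nat hq hdb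
    have hpa := addOrderOf_pos (π a)
    have hpb := addOrderOf_pos (π b)
    by_cases ha3 : addOrderOf (π a) = 3
    · by_cases hb3 : addOrderOf (π b) = 3
      · rw [ha3, hb3, Nat.lcm_self] at hdvd
        exact absurd (Nat.dvd_antisymm hda (ha3 ▸ hdvd)) ha
      · exact H.swap.cyc_of_even_or_odd hπ hQ' hb (Or.inr ⟨hq, by
          obtain ⟨k, hk⟩ := hbo
          omega⟩)
    · exact H.cyc_of_even_or_odd hπ hQ ha (Or.inr ⟨hq, by
        obtain ⟨k, hk⟩ := hao
        omega⟩)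

theorem cyc_of_generator [Finite Z] [Finite Q] (H : Bic G u v a b s π)
    (hπ : Function.Surjective π) (hQ : ∀ c : Q, ∃ k : ℤ, c = k • π a) (hb2 : 2 • b ≠ 0) :
    Cyc G Set.univ ∅ := by
  have hn := addOrderOf_pos (π a)
  obtain ⟨κ, hκ, hb⟩ : ∃ κ ≤ addOrderOf (π a) - 1, π b = κ • π a :=
    Set.eq_univ_iff_forall.1 (nsmul_lt_eq_univ hQ) (π b)
  have hneg : π (-b) = (addOrderOf (π a) - κ) • π a := by
    rw [map_neg, neg_eq_iff_add_eq_zero, hb, ← add_smul, Nat.add_sub_cancel' (by omega),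
      addOrderOf_nsmul_eq_zero]
  by_cases h0 : π b = 0
  · obtain ⟨β, hβ⟩ := H.ker 0 b (by rw [h0, _root_.map_zero])
    exact H.swap.cyc_of_mem (α := -β) (by rw [hβ]; module) hb2 hQ
  have hk0 : κ ≠ 0 := by
    rintro rfl
    exact h0 (by rw [hb, zero_smul])
  have ha0 : π a ≠ 0 := fun h => h0 (by rw [hb, h, smul_zero])
  by_cases h1 : κ = 1
  · exact H.cyc_of_parallel (by rw [hb, h1, one_smul]) hQ ha0
  by_cases h2 : addOrderOf (π a) - κ = 1
  · exact H.negB.cyc_of_parallel (by rw [hneg, h2, one_smul]) hQ ha0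
  by_cases h3 : 2 * κ ≤ addOrderOf (π a)
  · exact H.cyc_of_nsmul hπ hQ hb (by omega) h3
  · exact H.negB.cyc_of_nsmul hπ hQ hneg (by omega) (by omega)

theorem cyc [Finite Z] [Finite Q] [IsAddCyclic Q] (H : Bic G u v a b s π)
    (hπ : Function.Surjective π) (hQ : ∀ c : Q, ∃ k l : ℤ, c = k • π a + l • π b)
    (ha2 : 2 • a ≠ 0) (hb2 : 2 • b ≠ 0) : Cyc G Set.univ ∅ := by
  by_cases ha : addOrderOf (π a) = Nat.card Q
  · exact H.cyc_of_generator hπ (exists_zsmul_of_addOrderOf_eq_card ha) hb2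
  by_cases hb : addOrderOf (π b) = Nat.card Q
  · exact H.swap.cyc_of_generator hπ (exists_zsmul_of_addOrderOf_eq_card hb) ha2
  exact H.cyc_of_two_generators hπ hQ ha hb

end Bic
end Lattice

section Tour

theorem Finset.exists_dvd_sub_of_card_lt {P L : Finset ℕ} (h : P.card < L.card) (g : ℤ)
    (hL : ∀ j ∈ L, ∃ p ∈ P, (p : ℤ) ∣ g - j) :
    ∃ p ∈ P, ∃ i ∈ L, ∃ j ∈ L, i < j ∧ p ∣ j - i := by
  choose! f hf using hL
  obtain ⟨i, hi, j, hj, hij, he⟩ :=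
    Finset.exists_ne_map_eq_of_card_lt_of_maps_to h fun j hj => (hf j hj).1
  wlog hlt : i < j generalizing i j
  · exact this j hj i hi hij.symm he.symm (by omega)
  refine ⟨f i, (hf i hi).1, i, hi, j, hj, hlt, ?_⟩
  have := dvd_sub (hf i hi).2 (he ▸ (hf j hj).2)
  rw [sub_sub_sub_cancel_left, ← Nat.cast_sub hlt.le] at this
  exact_mod_cast this

/-- Among six consecutive integers, one is divisible by none of three given primes. -/
theorem exists_forall_prime_not_dvd_sub {P : Finset ℕ} (hP : P.card ≤ 3)
    (hp : ∀ p ∈ P, p.Prime) (g : ℤ) : ∃ j ≤ 5, ∀ p ∈ P, ¬ (p : ℤ) ∣ g - (j : ℕ) := by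
  by_contra! hcon
  have key : ∀ L : Finset ℕ, (∀ j ∈ L, j ≤ 5) → ∀ r : ℕ, (∀ j ∈ L, ¬ (r : ℤ) ∣ g - j) →
      (P.erase r).card < L.card →
      ∃ p ∈ P.erase r, ∃ i ∈ L, ∃ j ∈ L, i < j ∧ p ∣ j - i := fun L h5 r hr hc =>
    Finset.exists_dvd_sub_of_card_lt hc g fun j hj => by
      obtain ⟨p, hp, hd⟩ := hcon j (h5 j hj)
      exact ⟨p, Finset.mem_erase.2 ⟨by rintro rfl; exact hr j hj hd, hp⟩, hd⟩
  by_cases h2 : 2 ∈ P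
  · have hc := Finset.card_erase_of_mem h2
    obtain ⟨o, ho, hg⟩ : ∃ o : ℕ, o ≤ 1 ∧ (g - o) % 2 = 1 := by
      rcases Int.emod_two_eq_zero_or_one g with h | h
      · exact ⟨1, le_rfl, by omega⟩
      · exact ⟨0, zero_le_one, by omega⟩
    obtain ⟨p, hpP, i, hi, j, hj, hij, hd⟩ := key {o, o + 2, o + 4} (by simp; omega) 2
      (by simp; omega) (by
        rw [Finset.card_eq_three.2 ⟨o, o + 2, o + 4, by omega, by omega, by omega, rfl⟩]
        omega)
    obtain ⟨hne, hpP⟩ := Finset.mem_erase.1 hpP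
    have hpp := hp p hpP
    simp only [Finset.mem_insert, Finset.mem_singleton] at hi hj
    have : j - i ∣ 2 ^ 2 := by
      obtain h | h : j - i = 2 ∨ j - i = 4 := by omega
      all_goals rw [h]; decide
    exact hne ((Nat.prime_dvd_prime_iff_eq hpp Nat.prime_two).1
      (hpp.dvd_of_dvd_pow (hd.trans this)))
  have hsmall : ∀ p ∈ P, ∀ d, 0 < d → d ≤ 3 → p ∣ d → p = 3 := fun p hpP d h0 h3 hd => by
    have := Nat.le_of_dvd h0 hd
    have := (hp p hpP).two_le
    have : p ≠ 2 := by
      rintro rfl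
      exact h2 hpP
    omega
  by_cases h3 : 3 ∈ P
  · have hc := Finset.card_erase_of_mem h3
    obtain ⟨x, y, z, hxy, hyz, hz, h⟩ : ∃ x y z : ℕ, x < y ∧ y < z ∧ z ≤ x + 3 ∧ z ≤ 5 ∧
        ¬ (3 : ℤ) ∣ g - x ∧ ¬ (3 : ℤ) ∣ g - y ∧ ¬ (3 : ℤ) ∣ g - z := by
      obtain h | h | h : g % 3 = 0 ∨ g % 3 = 1 ∨ g % 3 = 2 := by omega
      · exact ⟨1, 2, 4, by omega⟩
      · exact ⟨0, 2, 3, by omega⟩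
      · exact ⟨0, 1, 3, by omega⟩
    obtain ⟨p, hpP, i, hi, j, hj, hij, hd⟩ := key {x, y, z} (by simp; omega) 3
      (by simp; omega) (by
        rw [Finset.card_eq_three.2 ⟨x, y, z, by omega, by omega, by omega, rfl⟩]
        omega)
    obtain ⟨hne, hpP⟩ := Finset.mem_erase.1 hpP
    simp only [Finset.mem_insert, Finset.mem_singleton] at hi hj
    exact hne (hsmall p hpP (j - i) (by omega) (by omega) hd)
  · obtain ⟨p, hpP, i, hi, j, hj, hij, hd⟩ :=
      Finset.exists_dvd_sub_of_card_lt (P := P) (L := Finset.range 4) (by simp; omega) g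
        fun j hj => hcon j (by rw [Finset.mem_range] at hj; omega)
    rw [Finset.mem_range] at hi hj
    exact h3 (hsmall p hpP (j - i) (by omega) (by omega) hd ▸ hpP)

variable {W Z : Type*} [AddCommGroup Z] {G : SimpleGraph W} {u v : Z → W}

theorem Cyc.of_tour [Finite Z] {t : Z} (hu : Function.Injective u) (hv : Function.Injective v)
    (huv : ∀ i j, u i ≠ v j) (hcover : ∀ w, (∃ i, w = u i) ∨ ∃ i, w = v i)
    (ht : ∀ i, G.Adj (u i) (v (i + t))) {e : ℕ → Z}
    (he : ∀ k, G.Adj (u (e (k + 1))) (v (e k + t))) (hinj : Set.InjOn e (Set.Iio (Nat.card Z)))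
    (hper : e (Nat.card Z) = e 0) : Cyc G Set.univ ∅ := by
  have hpath : ∀ N < Nat.card Z,
      Pth G {w | ∃ k ≤ N, w = u (e k) ∨ w = v (e k + t)} ∅ (u (e 0)) (v (e N + t)) := by
    have hstep : ∀ k, Pth G {u (e k), v (e k + t)} ∅ (u (e k)) (v (e k + t)) := fun k => by
      have := (Pth.single (G := G) (u (e k))).append' (ht _) (Pth.single (v (e k + t)))
        (Set.disjoint_singleton.2 (huv _ _))
      exact this.mono (Set.empty_subset _)
    intro N
    induction N with
    | zero =>
      intro _
      convert hstep 0 using 1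
      ext w
      simp
    | succ N ih =>
      intro hN
      have := (ih (by omega)).append' (he N).symm (hstep (N + 1)) (by
        rw [Set.disjoint_left]
        rintro w ⟨k, hk, hw⟩ hw'
        have hne : e k ≠ e (N + 1) := fun h => by
          have := hinj (by simp; omega) (by simpa using hN) h
          omega
        rcases hw with rfl | rfl <;> rcases hw' with h | h
        · exact hne (hu h)
        · exact huv _ _ h
        · exact huv _ _ h.symm
        · exact hne (add_right_cancel (hv h)))
      convert this.mono (Set.empty_subset _) using 1
      ext w
      simp only [Set.mem_ofPred_eq, Set.mem_union, Set.mem_insert_iff, Set.mem_singleton_iff]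
      constructor
      · rintro ⟨k, hk, h⟩
        rcases Nat.lt_or_ge k (N + 1) with hlt | hge
        · exact Or.inl ⟨k, by omega, h⟩
        · obtain rfl : k = N + 1 := by omega
          exact Or.inr h
      · rintro (⟨k, hk, h⟩ | h)
        · exact ⟨k, by omega, h⟩
        · exact ⟨N + 1, le_rfl, h⟩
  have hpos : 0 < Nat.card Z := Nat.card_pos
  obtain ⟨N, hN⟩ : ∃ N, Nat.card Z = N + 1 := ⟨Nat.card Z - 1, by omega⟩
  have hsurj : ∀ c, ∃ k ≤ N, e k = c := fun c => by
    have himg : e '' Set.Iio (Nat.card Z) = Set.univ := by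
      rw [Set.eq_univ_iff_ncard, hinj.ncard_image, ← Finset.coe_Iio,
        Set.ncard_coe_finset, Nat.card_Iio]
    obtain ⟨k, hk, rfl⟩ := himg.symm ▸ Set.mem_univ c
    exact ⟨k, by rw [Set.mem_Iio] at hk; omega, rfl⟩
  have hclose := (hpath N (by omega)).close (by
    have := (he N).symm
    rwa [← hN, hper] at this)
  convert hclose.mono (Set.empty_subset _) using 1
  symm
  rw [Set.eq_univ_iff_forall]
  intro w
  rcases hcover w with ⟨i, rfl⟩ | ⟨i, rfl⟩
  · obtain ⟨k, hk, rfl⟩ := hsurj i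
    exact ⟨k, hk, Or.inl rfl⟩
  · obtain ⟨k, hk, h⟩ := hsurj (i - t)
    exact ⟨k, hk, Or.inr (by rw [h, sub_add_cancel])⟩

end Tour

section Triple

variable {W Z : Type*} [AddCommGroup Z] {G : SimpleGraph W} {u v : Z → W}

theorem Nat.mul_succ_div_eq {j q : ℕ} (h : j ≤ q) (k : ℕ) :
    j * (k + 1) / q = j * k / q ∨ j * (k + 1) / q = j * k / q + 1 := by
  rcases Nat.eq_zero_or_pos q with rfl | hq
  · simp
  have h1 : j * k / q ≤ j * (k + 1) / q := Nat.div_le_div_right (by gcongr; omega)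
  have h2 : j * (k + 1) / q ≤ j * k / q + 1 := by
    rw [← Nat.add_div_right _ hq]
    exact Nat.div_le_div_right (by rw [mul_add]; omega)
  omega

theorem Cyc.of_triple [Finite Z] {s t : Z} (hu : Function.Injective u)
    (hv : Function.Injective v) (huv : ∀ i j, u i ≠ v j)
    (hcover : ∀ w, (∃ i, w = u i) ∨ ∃ i, w = v i)
    (h0 : ∀ i, G.Adj (u i) (v i)) (hs : ∀ i, G.Adj (u i) (v (i + s)))
    (ht : ∀ i, G.Adj (u i) (v (i + t))) (hgen : ∀ c : Z, ∃ k l : ℤ, c = k • s + l • t)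
    (hcard : (Nat.card Z).primeFactors.card ≤ 3) (h5 : addOrderOf s * 5 ≤ Nat.card Z) :
    Cyc G Set.univ ∅ := by
  let f := QuotientAddGroup.mk' (AddSubgroup.zmultiples s)
  have hf : ∀ c, f c = 0 ↔ ∃ k : ℤ, k • s = c := fun c =>
    QuotientAddGroup.mk'_zmultiples_eq_zero
  have hfs : f s = 0 := (hf s).2 ⟨1, one_zsmul s⟩
  obtain ⟨q, hq⟩ : ∃ q, q = addOrderOf (f t) := ⟨_, rfl⟩
  obtain ⟨n, hn⟩ : ∃ n, n = addOrderOf s := ⟨_, rfl⟩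
  have hnq : n * q = Nat.card Z := by
    rw [hn, hq]
    exact addOrderOf_mul_addOrderOf_mk' hgen
  have hn0 : 0 < n := hn ▸ addOrderOf_pos s
  have hq0 : 0 < q := hq ▸ addOrderOf_pos (f t)
  have hq5 : 5 ≤ q := by
    rw [← hn, ← hnq] at h5
    exact Nat.le_of_mul_le_mul_left h5 hn0
  obtain ⟨g, hg⟩ := (hf (q • t)).1 (by rw [map_nsmul, hq, addOrderOf_nsmul_eq_zero])
  obtain ⟨j, hj5, hj⟩ := exists_forall_prime_not_dvd_sub hcard
    (fun p hp => Nat.prime_of_mem_primeFactors hp) g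
  have hcop : IsCoprime (n : ℤ) (g - j) := by
    rw [Int.isCoprime_iff_gcd_eq_one]
    by_contra hne
    obtain ⟨p, hp, hd⟩ := Nat.exists_prime_and_dvd hne
    have hd1 : (p : ℤ) ∣ n := (Int.natCast_dvd_natCast.2 hd).trans (Int.gcd_dvd_left _ _)
    have hd2 : (p : ℤ) ∣ g - j := (Int.natCast_dvd_natCast.2 hd).trans (Int.gcd_dvd_right _ _)
    refine hj p (Nat.mem_primeFactors.2 ⟨hp, ?_, Nat.card_pos.ne'⟩) hd2
    exact (Int.natCast_dvd_natCast.1 hd1).trans (hnq ▸ Dvd.intro _ rfl)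
  have hperiod : ∀ k i : ℕ, (k + q * i) • t - (j * (k + q * i) / q) • s =
      k • t - (j * k / q) • s + (i * (g - j)) • s := fun k i => by
    have : j * (k + q * i) / q = j * k / q + j * i := by
      rw [show j * (k + q * i) = j * k + q * (j * i) by ring, Nat.add_mul_div_left _ _ hq0]
    rw [this, add_smul, mul_comm q i, mul_smul, ← hg, mul_sub, sub_smul, mul_smul, mul_comm j i,
      add_smul, natCast_zsmul, ← Nat.cast_mul, natCast_zsmul]
    abel
  refine Cyc.of_tour (t := t) (e := fun k => k • t - (j * k / q) • s) hu hv huv hcover ht ?_ ?_ ?_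
  · intro k
    rcases Nat.mul_succ_div_eq (hj5.trans hq5) k with h | h
    · convert h0 _ using 2
      simp only [h]
      rw [succ_nsmul]
      abel
    · convert hs _ using 2
      simp only [h]
      rw [succ_nsmul, succ_nsmul]
      abel
  · intro k hk k' hk' h
    wlog hle : k ≤ k' generalizing k k'
    · exact (this hk' hk h.symm (by omega)).symm
    simp only [Set.mem_Iio, ← hnq] at hk hk' h
    have hd : q ∣ k' - k := by
      rw [hq, addOrderOf_dvd_iff_nsmul_eq_zero]
      have := congrArg f h
      simp only [map_sub, map_nsmul, hfs, smul_zero, sub_zero] at this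
      have h' : (k' - k) • f t + k • f t = k • f t := by
        rw [← add_smul, Nat.sub_add_cancel hle, this]
      exact add_eq_right.1 h'
    obtain ⟨i, hi⟩ := hd
    obtain rfl : k' = k + q * i := by omega
    rw [hperiod] at h
    have hz := left_eq_add.1 h
    rw [← addOrderOf_dvd_iff_zsmul_eq_zero, ← hn] at hz
    have hni : n ∣ i := Int.natCast_dvd_natCast.1 (hcop.dvd_of_dvd_mul_right hz)
    rcases Nat.eq_zero_or_pos i with rfl | hi0
    · simp
    · have := Nat.mul_le_mul_left q (Nat.le_of_dvd hi0 hni)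
      rw [mul_comm n q] at hk'
      omega
  · have := hperiod 0 n
    rw [zero_add, mul_comm q n, hnq] at this
    simp only [this]
    rw [add_eq_left, mul_comm, mul_smul, natCast_zsmul, hn, addOrderOf_nsmul_eq_zero, smul_zero]

end Triple

section Divisibility

variable {m : ℕ}

theorem ZMod.not_prime_dvd_one {p : ℕ} (hp : p.Prime) (hpm : p ∣ m) : ¬ (p : ZMod m) ∣ 1 := by
  intro h
  have hc : p.Coprime m := (ZMod.isUnit_iff_coprime p m).1 (isUnit_of_dvd_one h)
  exact hp.one_lt.ne' (Nat.Coprime.eq_one_of_dvd hc hpm)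

theorem ZMod.exists_eq_zsmul_add [NeZero m] {a b c : ZMod m}
    (h : ∀ p : ℕ, p.Prime → p ∣ m → (p : ZMod m) ∣ a → (p : ZMod m) ∣ b → ¬ (p : ZMod m) ∣ c)
    (x : ZMod m) : ∃ k l n : ℤ, x = k • a + l • b + n • c := by
  obtain ⟨g, hg⟩ : ∃ g, g = Nat.gcd (Nat.gcd (Nat.gcd a.val b.val) c.val) m := ⟨_, rfl⟩
  have hdvd : ∀ (y : ZMod m) {d : ℕ}, d ∣ y.val → (d : ZMod m) ∣ y := fun y d hd => by
    have := Nat.cast_dvd_cast (α := ZMod m) hd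
    rwa [ZMod.natCast_zmod_val] at this
  have hg1 : g = 1 := by
    by_contra hne
    obtain ⟨p, hp, hd⟩ := Nat.exists_prime_and_dvd hne
    rw [hg, Nat.dvd_gcd_iff, Nat.dvd_gcd_iff, Nat.dvd_gcd_iff] at hd
    exact h p hp hd.2 (hdvd a hd.1.1.1) (hdvd b hd.1.1.2) (hdvd c hd.1.2)
  have bezout : ∀ x y : ℕ, ∃ k l : ℤ, (Nat.gcd x y : ℤ) = x * k + y * l := fun x y =>
    ⟨_, _, Nat.gcd_eq_gcd_ab x y⟩
  obtain ⟨k₁, l₁, e₁⟩ := bezout a.val b.val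
  obtain ⟨k₂, l₂, e₂⟩ := bezout (Nat.gcd a.val b.val) c.val
  obtain ⟨k₃, l₃, e₃⟩ := bezout (Nat.gcd (Nat.gcd a.val b.val) c.val) m
  rw [← hg, hg1, e₂, e₁] at e₃
  have e := congrArg (Int.cast : ℤ → ZMod m) e₃
  push_cast [ZMod.natCast_zmod_val, ZMod.natCast_self] at e
  obtain ⟨y, rfl⟩ := ZMod.intCast_surjective x
  refine ⟨y * (k₁ * k₂ * k₃), y * (l₁ * k₂ * k₃), y * (l₂ * k₃), ?_⟩
  simp only [zsmul_eq_mul]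
  push_cast
  linear_combination (y : ZMod m) * e

/-- Either two elements of `S` are incongruent modulo every prime of `P`, or three elements of `S`
are congruent in pairs modulo different primes of `P`. -/
theorem exists_pair_or_triple {S : Set (ZMod m)} (h0 : 0 ∈ S) (hS : S.Nontrivial)
    {P : Finset ℕ} (hP : P.card ≤ 3) (hprime : ∀ p ∈ P, p.Prime)
    (h : ∀ p ∈ P, ∃ x ∈ S, ¬ (p : ZMod m) ∣ x) :
    (∃ x ∈ S, ∃ y ∈ S, x ≠ y ∧ ∀ p ∈ P, ¬ (p : ZMod m) ∣ y - x) ∨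
    P.card = 3 ∧ ∃ x ∈ S, ∃ y ∈ S, ∃ z ∈ S, ∃ r ∈ P, 5 ≤ r ∧ (r : ZMod m) ∣ y - x ∧
      ∀ p ∈ P, (p : ZMod m) ∣ y - x → ¬ (p : ZMod m) ∣ z - x := by
  have two : ∀ p ∈ P, ∀ q ∈ P, ∃ x ∈ S, ∃ y ∈ S,
      ¬ (p : ZMod m) ∣ y - x ∧ ¬ (q : ZMod m) ∣ y - x := by
    intro p hp q hq
    obtain ⟨x, hx, hpx⟩ := h p hp
    obtain ⟨y, hy, hqy⟩ := h q hq
    by_cases hqx : (q : ZMod m) ∣ x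
    · by_cases hpy : (p : ZMod m) ∣ y
      · exact ⟨x, hx, y, hy, by rwa [dvd_sub_right hpy], by rwa [dvd_sub_left hqx]⟩
      · exact ⟨0, h0, y, hy, by rwa [sub_zero], by rwa [sub_zero]⟩
    · exact ⟨0, h0, x, hx, by rwa [sub_zero], by rwa [sub_zero]⟩
  have hne : ∀ {x y : ZMod m} {p : ℕ}, ¬ (p : ZMod m) ∣ y - x → x ≠ y := by
    rintro x _ p hd rfl
    exact hd (by rw [sub_self]; exact dvd_zero _)
  obtain hc | hc | hc | hc : P.card = 0 ∨ P.card = 1 ∨ P.card = 2 ∨ P.card = 3 := by omega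
  · obtain ⟨x, hx, y, hy, hxy⟩ := hS
    rw [Finset.card_eq_zero] at hc
    exact Or.inl ⟨x, hx, y, hy, hxy, by simp [hc]⟩
  · obtain ⟨p, rfl⟩ := Finset.card_eq_one.1 hc
    obtain ⟨x, hx, y, hy, hp, -⟩ := two p (by simp) p (by simp)
    exact Or.inl ⟨x, hx, y, hy, hne hp, by simpa using hp⟩
  · obtain ⟨p, q, -, rfl⟩ := Finset.card_eq_two.1 hc
    obtain ⟨x, hx, y, hy, hp, hq⟩ := two p (by simp) q (by simp)
    exact Or.inl ⟨x, hx, y, hy, hne hp, by simpa using ⟨hp, hq⟩⟩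
  obtain ⟨p, q, r, hpq, hpr, hqr, rfl⟩ := Finset.card_eq_three.1 hc
  obtain ⟨x, hx, y, hy, hp, hq⟩ := two p (by simp) q (by simp)
  by_contra! hcon
  obtain ⟨hpair, htri⟩ := hcon
  replace htri := htri hc
  have hpair' : ∀ x ∈ S, ∀ y ∈ S, ¬ (p : ZMod m) ∣ y - x → ¬ (q : ZMod m) ∣ y - x →
      (r : ZMod m) ∣ y - x := fun x hx y hy hp hq => by
    obtain ⟨p', hp', hd⟩ := hpair x hx y hy (hne hp)
    simp only [Finset.mem_insert, Finset.mem_singleton] at hp'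
    rcases hp' with rfl | rfl | rfl
    · exact absurd hd hp
    · exact absurd hd hq
    · exact hd
  have hr := hpair' x hx y hy hp hq
  obtain ⟨w, hw, hrw⟩ := h r (by simp)
  obtain ⟨z, hz, hrx⟩ : ∃ z ∈ S, ¬ (r : ZMod m) ∣ z - x := by
    by_contra! hall
    have := dvd_sub (hall w hw) (hall 0 h0)
    rw [sub_sub_sub_cancel_right, sub_zero] at this
    exact hrw this
  have hsub : y - x = (z - x) - (z - y) := by ring
  have hsub' : z - x = (z - y) + (y - x) := by ring
  have hry : ¬ (r : ZMod m) ∣ z - y := fun h => hrx (hsub' ▸ dvd_add h hr)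
  have hx' : ¬ (p : ZMod m) ∣ z - x → (q : ZMod m) ∣ z - x := fun hp => by
    by_contra hq
    exact hrx (hpair' x hx z hz hp hq)
  have hy' : ¬ (p : ZMod m) ∣ z - y → (q : ZMod m) ∣ z - y := fun hp => by
    by_contra hq
    exact hry (hpair' y hy z hz hp hq)
  have hsome : ∀ ℓ ∈ ({p, q, r} : Finset ℕ),
      (ℓ : ZMod m) ∣ y - x ∨ (ℓ : ZMod m) ∣ z - x ∨ (ℓ : ZMod m) ∣ z - y := fun ℓ hℓ => by
    simp only [Finset.mem_insert, Finset.mem_singleton] at hℓ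
    rcases hℓ with rfl | rfl | rfl
    · by_contra! hc
      exact hq (hsub ▸ dvd_sub (hx' hc.2.1) (hy' hc.2.2))
    · by_contra! hc
      exact hp (hsub ▸ dvd_sub (not_imp_comm.1 hx' hc.2.1) (not_imp_comm.1 hy' hc.2.2))
    · exact Or.inl hr
  have hone : ∀ ℓ ∈ ({p, q, r} : Finset ℕ),
      (ℓ : ZMod m) ∣ y - x → ¬ (ℓ : ZMod m) ∣ z - x := fun ℓ hℓ hd => by
    simp only [Finset.mem_insert, Finset.mem_singleton] at hℓ
    rcases hℓ with rfl | rfl | rfl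
    · exact absurd hd hp
    · exact absurd hd hq
    · exact hrx
  obtain ⟨ℓ, hℓ, h5⟩ : ∃ ℓ ∈ ({p, q, r} : Finset ℕ), 5 ≤ ℓ := by
    by_contra! hlt
    have hle : ({p, q, r} : Finset ℕ) ⊆ {2, 3} := fun ℓ hℓ => by
      have := hlt ℓ hℓ
      have hℓp := hprime ℓ hℓ
      interval_cases ℓ <;> first | decide | exact absurd hℓp (by decide)
    have := Finset.card_le_card hle
    rw [hc] at this
    exact absurd this (by decide)
  rcases hsome ℓ hℓ with hd | hd | hd
  · obtain ⟨p', hp', h1, h2⟩ := htri x hx y hy z hz ℓ hℓ h5 hd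
    exact hone p' hp' h1 h2
  · obtain ⟨p', hp', h1, h2⟩ := htri x hx z hz y hy ℓ hℓ h5 hd
    exact hone p' hp' h2 h1
  · obtain ⟨p', hp', h1, h2⟩ := htri y hy z hz x hx ℓ hℓ h5 hd
    rw [dvd_sub_comm] at h2
    exact hone p' hp' h2 (hsub' ▸ dvd_add h1 h2)

end Divisibility

section Bicirculant

variable {m : ℕ}

theorem bicirculant_adj_inl_inl {R S T : Set (ZMod m)} {j : ZMod m} (hj : j ∈ R) (h0 : j ≠ 0)
    (i : ZMod m) : (bicirculant m R S T).Adj (Sum.inl i) (Sum.inl (i + j)) := by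
  refine (SimpleGraph.fromRel_adj _ _ _).2 ⟨fun h => h0 ?_, Or.inl ⟨j, hj, rfl⟩⟩
  exact left_eq_add.1 (Sum.inl_injective h)

theorem bicirculant_adj_inr_inr {R S T : Set (ZMod m)} {j : ZMod m} (hj : j ∈ T) (h0 : j ≠ 0)
    (i : ZMod m) : (bicirculant m R S T).Adj (Sum.inr i) (Sum.inr (i + j)) := by
  refine (SimpleGraph.fromRel_adj _ _ _).2 ⟨fun h => h0 ?_, Or.inl ⟨j, hj, rfl⟩⟩
  exact left_eq_add.1 (Sum.inr_injective h)

theorem bicirculant_adj_inl_inr {R S T : Set (ZMod m)} {j : ZMod m} (hj : j ∈ S)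
    (i : ZMod m) : (bicirculant m R S T).Adj (Sum.inl i) (Sum.inr (i + j)) :=
  (SimpleGraph.fromRel_adj _ _ _).2 ⟨Sum.inl_ne_inr, Or.inl ⟨j, hj, rfl⟩⟩

theorem exists_not_dvd_of_bicirculant_connected {a b : ZMod m} {S : Set (ZMod m)}
    (hconn : (bicirculant m {a, -a} S {b, -b}).Connected) {p : ℕ} (hp : p.Prime) (hpm : p ∣ m)
    (ha : (p : ZMod m) ∣ a) (hb : (p : ZMod m) ∣ b) : ∃ x ∈ S, ¬ (p : ZMod m) ∣ x := by
  by_contra! hS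
  have hadj : ∀ w w', (bicirculant m {a, -a} S {b, -b}).Adj w w' →
      ((p : ZMod m) ∣ Sum.elim id id w ↔ (p : ZMod m) ∣ Sum.elim id id w') := by
    have ha' : ∀ j ∈ ({a, -a} : Set (ZMod m)), (p : ZMod m) ∣ j := by
      rintro j (rfl | rfl)
      exacts [ha, (dvd_neg).2 ha]
    have hb' : ∀ j ∈ ({b, -b} : Set (ZMod m)), (p : ZMod m) ∣ j := by
      rintro j (rfl | rfl)
      exacts [hb, (dvd_neg).2 hb]
    rintro (i | i) (i' | i') h <;>
      rcases ((SimpleGraph.fromRel_adj _ _ _).1 h).2 with h | h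
    · obtain ⟨j, hj, rfl⟩ := h
      exact (dvd_add_left (ha' j hj)).symm
    · obtain ⟨j, hj, rfl⟩ := h
      exact dvd_add_left (ha' j hj)
    · obtain ⟨j, hj, rfl⟩ := h
      exact (dvd_add_left (hS j hj)).symm
    · exact h.elim
    · exact h.elim
    · obtain ⟨j, hj, rfl⟩ := h
      exact dvd_add_left (hS j hj)
    · obtain ⟨j, hj, rfl⟩ := h
      exact (dvd_add_left (hb' j hj)).symm
    · obtain ⟨j, hj, rfl⟩ := h
      exact dvd_add_left (hb' j hj)
  have hwalk : ∀ w w', (bicirculant m {a, -a} S {b, -b}).Walk w w' →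
      ((p : ZMod m) ∣ Sum.elim id id w ↔ (p : ZMod m) ∣ Sum.elim id id w') := by
    intro w w' q
    induction q with
    | nil => rfl
    | cons h _ ih => exact (hadj _ _ h).trans ih
  obtain ⟨q⟩ := hconn.preconnected (Sum.inl 0) (Sum.inl 1)
  exact ZMod.not_prime_dvd_one hp hpm ((hwalk _ _ q).1 (dvd_zero _))

theorem cyc_bicirculant_of_pair [NeZero m] {a b : ZMod m} (ha : a ≠ 0) (hb : b ≠ 0)
    (ha2 : 2 * a ≠ 0) (hb2 : 2 * b ≠ 0) {S : Set (ZMod m)} {x y : ZMod m} (hx : x ∈ S)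
    (hy : y ∈ S) (h2 : 2 * (y - x) ≠ 0)
    (hgen : ∀ c, ∃ k l n : ℤ, c = k • a + l • b + n • (y - x)) :
    Cyc (bicirculant m {a, -a} S {b, -b}) Set.univ ∅ := by
  obtain ⟨s, rfl⟩ : ∃ s, y = x + s := ⟨y - x, by ring⟩
  rw [add_sub_cancel_left] at h2 hgen
  have hπ := QuotientAddGroup.mk'_surjective (AddSubgroup.zmultiples s)
  have H : Bic (bicirculant m {a, -a} S {b, -b}) Sum.inl (fun i => Sum.inr (i + x)) a b s
      (QuotientAddGroup.mk' (AddSubgroup.zmultiples s)) :=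
    { adjA := bicirculant_adj_inl_inl (by simp) ha
      adjB := fun i => by
        rw [add_right_comm]
        exact bicirculant_adj_inr_inr (by simp) hb _
      adj0 := bicirculant_adj_inl_inr hx
      adjS := fun i => by
        rw [add_assoc, add_comm s]
        exact bicirculant_adj_inl_inr hy _
      u_inj := Sum.inl_injective
      v_inj := fun i j h => add_right_cancel (Sum.inr_injective h)
      u_ne_v := fun _ _ => Sum.inl_ne_inr
      cover := by
        rintro (i | i)
        · exact Or.inl ⟨i, rfl⟩
        · exact Or.inr ⟨i - x, by rw [sub_add_cancel]⟩
      map_s := QuotientAddGroup.mk'_zmultiples_eq_zero.2 ⟨1, one_zsmul s⟩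
      ker := fun i j h => by
        obtain ⟨k, hk⟩ := QuotientAddGroup.mk'_zmultiples_eq_zero.1
          (show QuotientAddGroup.mk' (AddSubgroup.zmultiples s) (j - i) = 0 by
            rw [map_sub, h, sub_self])
        exact ⟨k, by rw [hk, add_sub_cancel]⟩
      s_ne := by
        rintro rfl
        exact h2 (mul_zero _)
      ss_ne := by rwa [← two_mul] }
  have : IsAddCyclic (ZMod m ⧸ AddSubgroup.zmultiples s) := isAddCyclic_of_surjective _ hπ
  refine H.cyc hπ (fun c => ?_) (by simpa [two_mul, two_smul] using ha2)
    (by simpa [two_mul, two_smul] using hb2)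
  obtain ⟨c, rfl⟩ := hπ c
  obtain ⟨k, l, n, rfl⟩ := hgen c
  refine ⟨k, l, ?_⟩
  rw [map_add, H.map_zsmul, add_zero, map_add, map_zsmul, map_zsmul]

/-- The pair of elements of `S` may be chosen with a difference of order greater than two. -/
theorem exists_two_mul_sub_ne_zero [NeZero m] {S : Set (ZMod m)} (hS : 3 ≤ S.ncard)
    {x y : ZMod m} (hx : x ∈ S) (hy : y ∈ S) (hxy : x ≠ y) :
    ∃ x' ∈ S, ∃ y' ∈ S, 2 * (y' - x') ≠ 0 ∧ ∃ n : ℤ, y - x = n • (y' - x') := by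
  by_cases h2 : 2 * (y - x) = 0
  swap
  · exact ⟨x, hx, y, hy, h2, 1, (one_zsmul _).symm⟩
  obtain ⟨z, hz, hzxy⟩ : ∃ z ∈ S, z ∉ ({x, y} : Set (ZMod m)) :=
    Set.exists_mem_notMem_of_ncard_lt_ncard ((Set.ncard_pair hxy).trans_lt hS)
  simp only [Set.mem_insert_iff, Set.mem_singleton_iff, not_or] at hzxy
  obtain ⟨s, rfl⟩ : ∃ s, y = x + s := ⟨y - x, by ring⟩
  obtain ⟨t, rfl⟩ : ∃ t, z = x + t := ⟨z - x, by ring⟩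
  rw [add_sub_cancel_left] at h2 ⊢
  have hs0 : s ≠ 0 := by simpa using hxy
  have ht0 : t ≠ 0 := by simpa using hzxy.1
  have hts : t ≠ s := by simpa using hzxy.2
  have hinv : ∀ c : ZMod m, c ≠ 0 → 2 * c = 0 → 2 * c.val = m := fun c hc h => by
    have := (ZMod.neg_eq_self_iff c).1 (neg_eq_of_add_eq_zero_left (by rwa [← two_mul]))
    exact this.resolve_left hc
  have hunique : ∀ c : ZMod m, c ≠ 0 → 2 * c = 0 → c = s := fun c hc h => by
    have h1 := hinv c hc h
    have h2 := hinv s hs0 h2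
    exact ZMod.val_injective m (by omega)
  have h2t : 2 * t ≠ 0 := fun h => hts (hunique t ht0 h)
  have hn := addOrderOf_pos t
  rcases Nat.even_or_odd' (addOrderOf t) with ⟨k, hk | hk⟩
  · refine ⟨x, hx, x + t, hz, by rwa [add_sub_cancel_left], k, ?_⟩
    rw [add_sub_cancel_left, natCast_zsmul]
    refine (hunique _ (nsmul_ne_zero_of_lt_addOrderOf (by omega) (by omega)) ?_).symm
    rw [two_mul, ← add_smul, ← two_mul, ← hk, addOrderOf_nsmul_eq_zero]
  · refine ⟨x + s, hy, x + t, hz, ?_, -(addOrderOf t : ℤ), ?_⟩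
    · rw [add_sub_add_left_eq_sub, mul_sub, h2, sub_zero]
      exact h2t
    · rw [add_sub_add_left_eq_sub, neg_smul, smul_sub, natCast_zsmul, natCast_zsmul,
        addOrderOf_nsmul_eq_zero, zero_sub, neg_neg, hk, succ_nsmul, mul_comm, mul_smul,
        two_smul, ← two_mul, h2, smul_zero, zero_add]

end Bicirculant

/-- A connected bicirculant `B(m;{a,-a},S,{b,-b})` with `|S| ≥ 3` and `m` a product
of at most three prime powers is hamiltonian. -/
theorem bicirculant_isHamiltonian_of_card_ge_three (m : ℕ) [NeZero m] (hm : 3 ≤ m)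
    (hprimes : m.primeFactors.card ≤ 3)
    (a b : ZMod m) (ha : a ≠ 0) (hb : b ≠ 0) (ha2 : 2 * a ≠ 0) (hb2 : 2 * b ≠ 0)
    (S : Set (ZMod m)) (h0S : (0 : ZMod m) ∈ S) (hS : 3 ≤ S.ncard)
    (hconn : (bicirculant m {a, -a} S {b, -b}).Connected) :
    (bicirculant m {a, -a} S {b, -b}).IsHamiltonian := by
  refine Cyc.isHamiltonian (E := ∅) ?_ (by
    rw [Fintype.card_sum, ZMod.card]
    omega)
  classical
  obtain ⟨P, hP⟩ : ∃ P : Finset ℕ, ∀ p, p ∈ P ↔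
      (p.Prime ∧ p ∣ m) ∧ (p : ZMod m) ∣ a ∧ (p : ZMod m) ∣ b :=
    ⟨m.primeFactors.filter fun p => (p : ZMod m) ∣ a ∧ (p : ZMod m) ∣ b, fun p => by
      rw [Finset.mem_filter, Nat.mem_primeFactors_of_ne_zero (NeZero.ne m)]⟩
  have hPsub : P ⊆ m.primeFactors := fun p hp =>
    (Nat.mem_primeFactors_of_ne_zero (NeZero.ne m)).2 ((hP p).1 hp).1
  have hPcard := (Finset.card_le_card hPsub).trans hprimes
  have hS1 : S.Nontrivial := (Set.one_lt_ncard_iff_nontrivial).1 (by omega)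
  rcases exists_pair_or_triple h0S hS1 hPcard (fun p hp => ((hP p).1 hp).1.1) fun p hp => by
      obtain ⟨⟨h1, h2⟩, h3, h4⟩ := (hP p).1 hp
      exact exists_not_dvd_of_bicirculant_connected hconn h1 h2 h3 h4 with
    ⟨x, hx, y, hy, hxy, h⟩ | ⟨hP3, x, hx, y, hy, z, hz, r, hr, h5, hry, h⟩
  · obtain ⟨x', hx', y', hy', h2, n, hn⟩ := exists_two_mul_sub_ne_zero hS hx hy hxy
    refine cyc_bicirculant_of_pair ha hb ha2 hb2 hx' hy' h2 fun c => ?_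
    obtain ⟨k, l, i, rfl⟩ := ZMod.exists_eq_zsmul_add (a := a) (b := b) (c := y - x)
      (fun p hp hpm hpa hpb => h p ((hP p).2 ⟨⟨hp, hpm⟩, hpa, hpb⟩)) c
    exact ⟨k, l, i * n, by rw [hn, mul_smul]⟩
  · have hPm : P = m.primeFactors := Finset.eq_of_subset_of_card_le hPsub (by omega)
    have hv : Function.Injective fun i : ZMod m => (Sum.inr (i + x) : ZMod m ⊕ ZMod m) :=
      fun i j h => add_right_cancel (Sum.inr_injective h)
    have hadj : ∀ {y}, y ∈ S → ∀ i, (bicirculant m {a, -a} S {b, -b}).Adj (Sum.inl i)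
        (Sum.inr (i + (y - x) + x)) := fun hy i => by
      rw [add_assoc, sub_add_cancel]
      exact bicirculant_adj_inl_inr hy i
    refine Cyc.of_triple Sum.inl_injective hv (fun _ _ => Sum.inl_ne_inr) ?_
      (bicirculant_adj_inl_inr hx) (hadj hy) (hadj hz) (fun c => ?_) ?_ ?_
    · rintro (i | i)
      · exact Or.inl ⟨i, rfl⟩
      · exact Or.inr ⟨i - x, by rw [sub_add_cancel]⟩
    · obtain ⟨k, l, i, rfl⟩ := ZMod.exists_eq_zsmul_add (a := y - x) (b := y - x) (c := z - x)
        (fun p hp hpm hpy _ => h p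
          (hPm ▸ (Nat.mem_primeFactors_of_ne_zero (NeZero.ne m)).2 ⟨hp, hpm⟩) hpy) c
      exact ⟨k + l, i, by rw [add_smul]⟩
    · rwa [Nat.card_zmod]
    · obtain ⟨n, hn⟩ := ((hP r).1 hr).1.2
      obtain ⟨w, hw⟩ := hry
      have hz : n • (y - x) = 0 := by
        rw [hw, nsmul_eq_mul, ← mul_assoc, ← Nat.cast_mul, mul_comm n, ← hn, ZMod.natCast_self,
          zero_mul]
      have hn0 : 0 < n := Nat.pos_of_ne_zero fun h => by
        rw [h] at hn
        omega
      rw [Nat.card_zmod]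
      exact (Nat.mul_le_mul (Nat.le_of_dvd hn0 (addOrderOf_dvd_of_nsmul_eq_zero hz)) h5).trans
        ((mul_comm n r).trans hn.symm).le
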